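/- arXiv:1212.0899 — 4 statements merged into one kernel-verified Lean document; each statement's English description precedes it below -/
import Mathlib

section
/- Let X be a metric space, A a subset of X, and V' = {V'_i}_{i∈I} a cover of A by sets open in A. Then there exists a family V = {V_i}_{i∈I} of sets open in X such that V_i ∩ A = V'_i for all i ∈ I, and for all i, j ∈ I, V_i ∩ V_j ≠ ∅ if and only if V'_i ∩ V'_j ≠ ∅. -/
/-- The union of the balls in `X` centred at points of `U` whose concentric balls of twice
the radius meet `A` only in `U`. -/
def relativeThickening {X : Type*} [PseudoMetricSpace X] {A : Set X} (U : Set A) : Set X :=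
  {x | ∃ (a : A) (r : ℝ), a ∈ U ∧ Metric.ball a (2 * r) ⊆ U ∧ dist x a < r}

theorem isOpen_relativeThickening {X : Type*} [PseudoMetricSpace X] {A : Set X} (U : Set A) :
    IsOpen (relativeThickening U) := by
  rw [isOpen_iff_mem_nhds]
  rintro x ⟨a, r, ha, hr, hx⟩
  filter_upwards [Metric.isOpen_ball.mem_nhds (Metric.mem_ball.2 hx)] with y hy
  exact ⟨a, r, ha, hr, hy⟩

theorem relativeThickening_inter {X : Type*} [PseudoMetricSpace X] {A : Set X} {U : Set A}
    (hU : IsOpen U) : relativeThickening U ∩ A = Subtype.val '' U := by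
  ext x
  constructor
  · rintro ⟨⟨a, r, -, hr, hx⟩, hxA⟩
    refine ⟨⟨x, hxA⟩, hr ?_, rfl⟩
    rw [Metric.mem_ball, Subtype.dist_eq]
    linarith [dist_nonneg (x := x) (y := (a : X))]
  · rintro ⟨a, ha, rfl⟩
    obtain ⟨ε, hε, hball⟩ := Metric.isOpen_iff.1 hU a ha
    refine ⟨⟨a, ε / 2, ha, ?_, ?_⟩, a.2⟩
    · rwa [mul_div_cancel₀ ε two_ne_zero]
    · rw [dist_self]
      exact half_pos hε

/-- Let `X` be a metric space, `A ⊆ X`, and `V'` a cover of `A` by sets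
open in `A`. Then `V'` extends to a family `V` of sets open in `X` with `V i ∩ A = V' i`
and such that `V i` meets `V j` exactly when `V' i` meets `V' j`. -/
theorem extend_relative_cover_same_nerve {X : Type*} [MetricSpace X] (A : Set X)
    {I : Type*} (V' : I → Set A) (hopen : ∀ i, IsOpen (V' i))
    (hcover : (⋃ i, V' i) = Set.univ) :
    ∃ V : I → Set X, (∀ i, IsOpen (V i)) ∧
      (∀ i, V i ∩ A = Subtype.val '' V' i) ∧
      (∀ i j, (V i ∩ V j).Nonempty ↔ (V' i ∩ V' j).Nonempty) := by
  refine ⟨fun i => relativeThickening (V' i), fun i => isOpen_relativeThickening _,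
    fun i => relativeThickening_inter (hopen i), fun i j => ⟨?_, ?_⟩⟩
  · rintro ⟨x, ⟨a, r, hai, hra, hxa⟩, ⟨b, s, hbj, hsb, hxb⟩⟩
    have hab : dist (a : X) b < r + s :=
      (dist_triangle_left (a : X) b x).trans_lt (add_lt_add hxa hxb)
    rcases le_total r s with h | h
    · refine ⟨a, hai, hsb ?_⟩
      rw [Metric.mem_ball, Subtype.dist_eq]
      linarith
    · refine ⟨b, hra ?_, hbj⟩
      rw [Metric.mem_ball', Subtype.dist_eq]
      linarith
  · rintro ⟨a, hai, haj⟩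
    have mem {k} (hk : a ∈ V' k) : (a : X) ∈ relativeThickening (V' k) :=
      ((relativeThickening_inter (hopen k)).ge ⟨a, hk, rfl⟩).1
    exact ⟨a, mem hai, mem haj⟩
end

section
/- Let k ≥ 0 and let X be a compact metric space that is k-connected (C^k) and locally k-connected (LC^k). Then cat_g X ≤ dim X / (k+1), where dim denotes the covering dimension. -/
open Set Metric TopologicalSpace

/-- The inclusion of a subset of `X` into `X`, as a continuous map. -/
def ContinuousMap.setInclusion {X : Type*} [TopologicalSpace X] (A : Set X) : C(A, X) :=
  ⟨Subtype.val, continuous_subtype_val⟩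

/-- A subset `A ⊆ X` is *contractible in `X`* if the inclusion map `A → X`
is homotopic to a constant map. -/
def ContractibleIn {X : Type*} [TopologicalSpace X] (A : Set X) : Prop :=
  (ContinuousMap.setInclusion A).Nullhomotopic

/-- The general Lusternik–Schnirelmann category `cat_g X`: the smallest `k` such that
`X` is the union of `k+1` arbitrary subsets, each contractible in `X` (`⊤` if no such
`k` exists). -/
noncomputable def catg (X : Type*) [TopologicalSpace X] : ℕ∞ :=
  sInf {N : ℕ∞ | ∃ k : ℕ, N = k ∧ ∃ A : Fin (k + 1) → Set X,
    (⋃ i, A i) = Set.univ ∧ ∀ i, ContractibleIn (A i)}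

/-- The Lebesgue covering dimension of a topological space, valued in `ℕ∞`:
the least `n` such that every open cover admits an open refinement in which every
point lies in at most `n + 1` members. -/
noncomputable def coveringDim (X : Type*) [TopologicalSpace X] : ℕ∞ :=
  sInf {N : ℕ∞ | ∃ n : ℕ, N = n ∧
    ∀ 𝒰 : Set (Set X), (∀ U ∈ 𝒰, IsOpen U) → ⋃₀ 𝒰 = Set.univ →
      ∃ 𝒱 : Set (Set X), (∀ V ∈ 𝒱, IsOpen V) ∧ ⋃₀ 𝒱 = Set.univ ∧
        (∀ V ∈ 𝒱, ∃ U ∈ 𝒰, V ⊆ U) ∧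
        ∀ x : X, {V | V ∈ 𝒱 ∧ x ∈ V}.encard ≤ (n : ℕ∞) + 1}

/-- A space `X` is `k`-connected (`C^k`) if it is nonempty and its homotopy groups
`π_r` vanish for `0 ≤ r ≤ k`. -/
def IsCConn (k : ℕ) (X : Type*) [TopologicalSpace X] : Prop :=
  Nonempty X ∧ ∀ (x : X) (r : ℕ), r ≤ k → Subsingleton (HomotopyGroup (Fin r) X x)

/-- A space `X` is locally `k`-connected (`LC^k`) if for every `x ∈ X` and every
neighborhood `U` of `x` there is a neighborhood `V` of `x` with `V ⊆ U` such that
for `r ≤ k` every continuous map `S^r → V` is nullhomotopic in `U`. -/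
def IsLCConn (k : ℕ) (X : Type*) [TopologicalSpace X] : Prop :=
  ∀ (x : X) (U : Set X), U ∈ nhds x → ∃ V ∈ nhds x, ∃ hVU : V ⊆ U,
    ∀ r ≤ k, ∀ f : C(Metric.sphere (0 : EuclideanSpace ℝ (Fin (r + 1))) 1, V),
      ((⟨Set.inclusion hVU, continuous_inclusion hVU⟩ : C(V, U)).comp f).Nullhomotopic

/-- Every open cover of `X` has an open refinement of order at most `n + 1`. -/
def CoverDimLE (n : ℕ) (X : Type*) [TopologicalSpace X] : Prop :=
  ∀ 𝒰 : Set (Set X), (∀ U ∈ 𝒰, IsOpen U) → ⋃₀ 𝒰 = Set.univ →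
    ∃ 𝒱 : Set (Set X), (∀ V ∈ 𝒱, IsOpen V) ∧ ⋃₀ 𝒱 = Set.univ ∧
      (∀ V ∈ 𝒱, ∃ U ∈ 𝒰, V ⊆ U) ∧
      ∀ x : X, {V | V ∈ 𝒱 ∧ x ∈ V}.encard ≤ (n : ℕ∞) + 1

theorem coverDimLE_of_coveringDim_eq {X : Type*} [TopologicalSpace X] {n : ℕ}
    (h : coveringDim X = n) : CoverDimLE n X := by
  have hne : {N : ℕ∞ | ∃ n : ℕ, N = n ∧ CoverDimLE n X}.Nonempty := by
    by_contra hemp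
    rw [Set.not_nonempty_iff_eq_empty] at hemp
    have : coveringDim X = sInf ∅ := by rw [← hemp]; rfl
    rw [h, sInf_empty] at this
    exact ENat.natCast_ne_top n this
  obtain ⟨m, hm, hcov⟩ := csInf_mem hne
  have hmn : (n : ℕ∞) = m := h.symm.trans hm
  obtain rfl : n = m := by exact_mod_cast hmn
  exact hcov

/-- A map into `ℝ^(n+1)` from a compact space of covering dimension at most `n` can be
perturbed off the origin. -/
theorem CoverDimLE.exists_near_ne_zero {X : Type*} [TopologicalSpace X] [CompactSpace X]
    [T2Space X] {n : ℕ} (hX : CoverDimLE n X) {E : Type*} [NormedAddCommGroup E]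
    [NormedSpace ℝ E] [FiniteDimensional ℝ E] (hE : Module.finrank ℝ E = n + 1)
    (f : C(X, E)) {ε : ℝ} (hε : 0 < ε) :
    ∃ g : C(X, E), (∀ x, ‖g x - f x‖ < ε) ∧ ∀ x, g x ≠ 0 := by
  classical
  obtain ⟨𝒱, hVo, hVc, hVr, hVord⟩ := hX (Set.range fun x => {y | ‖f y - f x‖ < ε / 2})
    (by rintro _ ⟨x, rfl⟩; exact isOpen_lt (by fun_prop) continuous_const)
    (by
      refine Set.eq_univ_of_forall fun x => ⟨_, ⟨x, rfl⟩, ?_⟩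
      simpa using hε)
  obtain ⟨t, ht⟩ := isCompact_univ.elim_finite_subcover (fun V : 𝒱 => (V : Set X))
    (fun V => hVo V V.2) (by rw [← Set.sUnion_eq_iUnion, hVc])
  obtain ⟨p, hp⟩ := PartitionOfUnity.exists_isSubordinate isClosed_univ
    (fun V : t => ((V : 𝒱) : Set X)) (fun V => hVo _ V.1.2)
    (by rwa [Set.iUnion_subtype])
  have hctr : ∀ V : t, ∃ x, ∀ y ∈ ((V : 𝒱) : Set X), ‖f y - f x‖ < ε / 2 := by
    intro V
    obtain ⟨_, ⟨x, rfl⟩, hVx⟩ := hVr _ V.1.2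
    exact ⟨x, fun y hy => hVx hy⟩
  choose c hc using hctr
  have hsum : ∀ x, ∑ V, p V x = 1 := fun x => by
    rw [← finsum_eq_sum_of_fintype]; exact p.sum_eq_one (Set.mem_univ x)
  have hsupp : ∀ V x, p V x ≠ 0 → x ∈ ((V : 𝒱) : Set X) := fun V x h =>
    hp V (subset_tsupport _ h)
  let A : Finset t → AffineSubspace ℝ E := fun s =>
    affineSpan ℝ (s.image (fun V => f (c V)) : Set E)
  have hA : ∀ s : Finset t, s.card ≤ n + 1 → A s ≠ ⊤ := by
    intro s hs htop
    have hdir : vectorSpan ℝ (s.image (fun V => f (c V)) : Set E) = ⊤ := by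
      rw [← direction_affineSpan]
      change (A s).direction = ⊤
      rw [htop, AffineSubspace.direction_top]
    rcases Nat.eq_zero_or_pos s.card with h0 | h0
    · rw [Finset.card_eq_zero] at h0
      subst h0
      rw [Finset.image_empty, Finset.coe_empty, vectorSpan_empty] at hdir
      have := finrank_bot ℝ E
      rw [hdir, finrank_top, hE] at this
      omega
    · obtain ⟨m, hm⟩ := Nat.exists_eq_add_of_lt h0
      have := finrank_vectorSpan_image_finset_le ℝ (fun V => f (c V)) s (n := m) (by omega)
      rw [hdir, finrank_top, hE] at this
      omega
  borelize E
  have hnull : MeasureTheory.Measure.addHaar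
      (⋃ s : {s : Finset t // s.card ≤ n + 1}, (A s : Set E)) = 0 :=
    MeasureTheory.measure_iUnion_null fun s =>
      MeasureTheory.Measure.addHaar_affineSubspace _ _ (hA s s.2)
  obtain ⟨z, hz, hzA⟩ : ∃ z ∈ Metric.ball (0 : E) (ε / 2),
      z ∉ ⋃ s : {s : Finset t // s.card ≤ n + 1}, (A s : Set E) := by
    by_contra! hcon
    have := MeasureTheory.measure_mono_null (show Metric.ball (0 : E) (ε / 2) ⊆ _ from hcon) hnull
    exact (Metric.measure_ball_pos _ (0 : E) (half_pos hε)).ne' this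
  refine ⟨⟨fun x => ∑ V, p V x • f (c V) - z, by fun_prop⟩, fun x => ?_, fun x hx => hzA ?_⟩
  · have h1 : ∑ V, p V x • f (c V) - f x = ∑ V, p V x • (f (c V) - f x) := by
      simp_rw [smul_sub, Finset.sum_sub_distrib, ← Finset.sum_smul, hsum, one_smul]
    have h2 : ‖∑ V, p V x • (f (c V) - f x)‖ ≤ ε / 2 := by
      calc _ ≤ ∑ V, ‖p V x • (f (c V) - f x)‖ := norm_sum_le _ _
        _ ≤ ∑ V, p V x * (ε / 2) := by
          refine Finset.sum_le_sum fun V _ => ?_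
          rw [norm_smul, Real.norm_of_nonneg (p.nonneg V x)]
          by_cases h0 : p V x = 0
          · simp [h0]
          · refine mul_le_mul_of_nonneg_left ?_ (p.nonneg V x)
            rw [norm_sub_rev]
            exact (hc V x (hsupp V x h0)).le
        _ = ε / 2 := by rw [← Finset.sum_mul, hsum, one_mul]
    have h3 : ‖z‖ < ε / 2 := by simpa using hz
    calc ‖∑ V, p V x • f (c V) - z - f x‖ = ‖(∑ V, p V x • f (c V) - f x) - z‖ := by
          congr 1; abel
      _ ≤ ‖∑ V, p V x • f (c V) - f x‖ + ‖z‖ := norm_sub_le _ _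
      _ < ε := by rw [h1]; linarith
  · let s : Finset t := Finset.univ.filter fun V => p V x ≠ 0
    have hcard : s.card ≤ n + 1 := by
      have hinj : Set.InjOn (fun V : t => ((V : 𝒱) : Set X)) s :=
        fun V _ W _ h => Subtype.ext (Subtype.ext h)
      have h1 : ((s.image fun V : t => ((V : 𝒱) : Set X) : Finset (Set X)) : Set (Set X)).encard
          ≤ (n : ℕ∞) + 1 := by
        refine (Set.encard_le_encard ?_).trans (hVord x)
        intro V hV
        obtain ⟨W, hW, rfl⟩ := Finset.mem_image.1 (Finset.mem_coe.1 hV)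
        exact ⟨W.1.2, hsupp W x (Finset.mem_filter.1 hW).2⟩
      rw [Set.encard_coe_eq_coe_finsetCard, Finset.card_image_of_injOn hinj] at h1
      exact_mod_cast h1
    have hzs : z = ∑ V ∈ s, p V x • f (c V) := by
      rw [Finset.sum_filter_of_ne fun V _ h => left_ne_zero_of_smul h]
      exact (sub_eq_zero.1 hx).symm
    have hs1 : ∑ V ∈ s, p V x = 1 := by
      rw [Finset.sum_filter_of_ne fun V _ h => h, hsum]
    refine Set.mem_iUnion.2 ⟨⟨s, hcard⟩, ?_⟩
    rw [hzs, ← Finset.affineCombination_eq_linear_combination s (fun V => f (c V)) _ hs1]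
    have := affineCombination_mem_affineSpan_image (k := ℝ) hs1 (s' := (s : Set t))
      (fun V h h' => absurd h h') (fun V => f (c V))
    simpa [A] using this

/-- Any sequence of functions can be perturbed so that at every point at most `n` of
them vanish. -/
theorem CoverDimLE.exists_seq_near {X : Type*} [TopologicalSpace X] [CompactSpace X]
    [T2Space X] {n : ℕ} (hX : CoverDimLE n X) (u : ℕ → C(X, ℝ)) :
    ∃ f : ℕ → C(X, ℝ), (∀ l x, |f l x - u l x| < 1) ∧
      ∀ x (L : Finset ℕ), L.card = n + 1 → ∃ l ∈ L, f l x ≠ 0 := by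
  classical
  let D : {L : Finset ℕ // L.card = n + 1} → Set (BoundedContinuousFunction ℕ C(X, ℝ)) := fun L =>
    {h | ∀ x, ∃ l ∈ L.1, (u l + h l) x ≠ 0}
  have hDo : ∀ L, IsOpen (D L) := by
    intro L
    let Φ : BoundedContinuousFunction ℕ C(X, ℝ) → C(X, ℝ) := fun h =>
      ∑ l ∈ L.1, (u l + h l) * (u l + h l)
    have hΦ : Continuous Φ := by
      refine continuous_finsetSum _ fun l _ => ?_
      have : Continuous fun h : BoundedContinuousFunction ℕ C(X, ℝ) => u l + h l :=
        continuous_const.add (BoundedContinuousFunction.lipschitz_eval_const l).continuous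
      exact this.mul this
    have : D L = Φ ⁻¹' {φ | Set.MapsTo φ Set.univ {0}ᶜ} := by
      ext h
      simp only [D, Φ, Set.mem_ofPred_eq, Set.mem_preimage]
      have key : ∀ x, (∑ l ∈ L.1, (u l + h l) * (u l + h l)) x ≠ 0 ↔
          ∃ l ∈ L.1, (u l + h l) x ≠ 0 := by
        intro x
        rw [ContinuousMap.sum_apply]
        simp only [ContinuousMap.mul_apply]
        rw [ne_eq, Finset.sum_eq_zero_iff_of_nonneg fun l _ => mul_self_nonneg _]
        simp only [mul_self_eq_zero]
        push Not
        rfl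
      exact ⟨fun hh x _ => (key x).2 (hh x), fun hh x => (key x).1 (hh (Set.mem_univ x))⟩
    rw [this]
    exact (ContinuousMap.isOpen_setOfPred_mapsTo isCompact_univ isOpen_compl_singleton).preimage hΦ
  have hDd : ∀ L, Dense (D L) := by
    intro L
    rw [Metric.dense_iff]
    intro h ε hε
    obtain ⟨g, hg, hg0⟩ := hX.exists_near_ne_zero (E := L.1 → ℝ) (by simp [L.2])
      (⟨fun x l => (u l + h l) x, by fun_prop⟩) (half_pos hε)
    let h' : BoundedContinuousFunction ℕ C(X, ℝ) :=
      h + BoundedContinuousFunction.ofNormedAddCommGroup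
      (fun l => if hl : l ∈ L.1 then
        (⟨fun x => g x ⟨l, hl⟩ - (u l + h l) x, by fun_prop⟩ : C(X, ℝ)) else 0)
      continuous_of_discreteTopology (ε / 2) (by
        intro l
        split_ifs with hl
        · rw [ContinuousMap.norm_le _ (half_pos hε).le]
          intro x
          exact (norm_le_pi_norm (g x - _) ⟨l, hl⟩).trans (hg x).le
        · simpa using (half_pos hε).le)
    refine ⟨h', ?_, ?_⟩
    · refine lt_of_le_of_lt ?_ (half_lt_self hε)
      refine (BoundedContinuousFunction.dist_le (half_pos hε).le).2 fun l => ?_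
      refine (ContinuousMap.dist_le (half_pos hε).le).2 fun x => ?_
      by_cases hl : l ∈ L.1
      · have h1 : h' l x - h l x = g x ⟨l, hl⟩ - (u l + h l) x := by simp [h', hl]
        rw [Real.dist_eq, h1]
        exact (norm_le_pi_norm (g x - _) ⟨l, hl⟩).trans (hg x).le
      · have h1 : h' l x = h l x := by simp [h', hl]
        rw [h1, dist_self]
        exact (half_pos hε).le
    · intro x
      by_contra! hcon
      refine hg0 x (funext fun l => ?_)
      have := hcon l l.2
      have h1 : (u l + h' l) x = g x l := by
        simp only [h', BoundedContinuousFunction.coe_add, Pi.add_apply,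
          BoundedContinuousFunction.coe_ofNormedAddCommGroup, l.2, dite_true,
          ContinuousMap.add_apply, ContinuousMap.coe_mk]
        ring
      exact h1.symm.trans this
  obtain ⟨h, hb, hh⟩ := (dense_iInter_of_isOpen hDo hDd).inter_open_nonempty (Metric.ball 0 1)
    Metric.isOpen_ball ⟨0, Metric.mem_ball_self one_pos⟩
  refine ⟨fun l => u l + h l, fun l x => ?_, fun x L hL => Set.mem_iInter.1 hh ⟨L, hL⟩ x⟩
  have h1 : dist (h l x) 0 ≤ dist h 0 :=
    (ContinuousMap.dist_apply_le_dist (g := 0) x).trans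
      (BoundedContinuousFunction.dist_coe_le_dist (g := 0) l)
  have h2 : dist (h l x) 0 < 1 := h1.trans_lt hb
  simpa using h2

/-- Any two disjoint closed sets of `Y` enlarge to disjoint closed sets covering `C`. -/
def SeparatesOn {Y : Type*} [TopologicalSpace Y] (C : Set Y) : Prop :=
  ∀ P Q : Set Y, IsClosed P → IsClosed Q → Disjoint P Q → ∃ P' Q' : Set Y,
    IsClosed P' ∧ IsClosed Q' ∧ Disjoint P' Q' ∧ P ⊆ P' ∧ Q ⊆ Q' ∧ C ⊆ P' ∪ Q'

/-- Countable sum theorem: if closed sets can be separated along each of countably many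
sets covering `Y`, then they can be separated by a clopen set. -/
theorem exists_isClopen_of_separatesOn {Y : Type*} [TopologicalSpace Y] [NormalSpace Y]
    {C : ℕ → Set Y} (hC : ∀ m, SeparatesOn (C m)) (hcov : ⋃ m, C m = Set.univ)
    {P Q : Set Y} (hP : IsClosed P) (hQ : IsClosed Q) (hPQ : Disjoint P Q) :
    ∃ W : Set Y, IsClopen W ∧ P ⊆ W ∧ Disjoint W Q := by
  let T := {p : Set Y × Set Y // IsClosed p.1 ∧ IsClosed p.2 ∧ Disjoint p.1 p.2}
  have step : ∀ (m : ℕ) (p : T), ∃ q : T, p.1.1 ⊆ interior q.1.1 ∧ p.1.2 ⊆ interior q.1.2 ∧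
      C m ⊆ q.1.1 ∪ q.1.2 := by
    rintro m ⟨⟨P, Q⟩, hP, hQ, hPQ⟩
    obtain ⟨U, hU, hPU, hUQ⟩ := normal_exists_closure_subset hP hQ.isOpen_compl
      (Set.subset_compl_iff_disjoint_right.2 hPQ)
    obtain ⟨V, hV, hQV, hVU⟩ := normal_exists_closure_subset hQ isClosed_closure.isOpen_compl
      (Set.subset_compl_comm.1 hUQ)
    obtain ⟨P', Q', hP', hQ', hd, hP1, hQ1, hc⟩ := hC m (closure U) (closure V)
      isClosed_closure isClosed_closure (Set.subset_compl_iff_disjoint_left.1 hVU)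
    exact ⟨⟨(P', Q'), hP', hQ', hd⟩,
      hPU.trans (interior_maximal (subset_closure.trans hP1) hU),
      hQV.trans (interior_maximal (subset_closure.trans hQ1) hV), hc⟩
  choose nxt h1 h2 h3 using step
  let s : ℕ → T := fun m => Nat.rec ⟨(P, Q), hP, hQ, hPQ⟩ nxt m
  have hs : ∀ m, s (m + 1) = nxt m (s m) := fun m => rfl
  have mono1 : Monotone fun m => (s m).1.1 := monotone_nat_of_le_succ fun m => by
    rw [hs]; exact (h1 m (s m)).trans interior_subset
  have mono2 : Monotone fun m => (s m).1.2 := monotone_nat_of_le_succ fun m => by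
    rw [hs]; exact (h2 m (s m)).trans interior_subset
  have hopen1 : IsOpen (⋃ m, (s m).1.1) := by
    have : ⋃ m, (s m).1.1 = ⋃ m, interior (s (m + 1)).1.1 := by
      refine Set.Subset.antisymm (Set.iUnion_mono fun m => h1 m (s m)) ?_
      exact Set.iUnion_subset fun m => interior_subset.trans
        (Set.subset_iUnion (fun m => (s m).1.1) (m + 1))
    rw [this]
    exact isOpen_iUnion fun m => isOpen_interior
  have hopen2 : IsOpen (⋃ m, (s m).1.2) := by
    have : ⋃ m, (s m).1.2 = ⋃ m, interior (s (m + 1)).1.2 := by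
      refine Set.Subset.antisymm (Set.iUnion_mono fun m => h2 m (s m)) ?_
      exact Set.iUnion_subset fun m => interior_subset.trans
        (Set.subset_iUnion (fun m => (s m).1.2) (m + 1))
    rw [this]
    exact isOpen_iUnion fun m => isOpen_interior
  have hdisj : Disjoint (⋃ m, (s m).1.1) (⋃ m, (s m).1.2) := by
    rw [Set.disjoint_iUnion_left]
    intro a
    rw [Set.disjoint_iUnion_right]
    intro b
    exact (s (max a b)).2.2.2.mono (mono1 (le_max_left a b)) (mono2 (le_max_right a b))
  have hall : (⋃ m, (s m).1.1) ∪ (⋃ m, (s m).1.2) = Set.univ := by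
    rw [← Set.univ_subset_iff, ← hcov]
    refine Set.iUnion_subset fun m => (h3 m (s m)).trans (Set.union_subset_union ?_ ?_)
    · exact Set.subset_iUnion (fun m => (s m).1.1) (m + 1)
    · exact Set.subset_iUnion (fun m => (s m).1.2) (m + 1)
  refine ⟨⋃ m, (s m).1.1, ⟨?_, hopen1⟩, Set.subset_iUnion (fun m => (s m).1.1) 0,
    hdisj.mono_right (Set.subset_iUnion (fun m => (s m).1.2) 0)⟩
  rw [← isOpen_compl_iff]
  convert! hopen2 using 1
  exact (IsCompl.of_le hdisj.le_bot hall.ge).compl_eq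

/-- A closed set with countably many relatively clopen subsets forming a basis. -/
theorem separatesOn_of_isClopen_basis {Y : Type*} [TopologicalSpace Y] {C : Set Y}
    (hC : IsClosed C) (N : ℕ → Set Y) (hN : ∀ l, IsClosed (C ∩ N l))
    (hN' : ∀ l, IsClosed (C \ N l))
    (hb : ∀ y ∈ C, ∀ U, IsOpen U → y ∈ U → ∃ l, y ∈ N l ∧ N l ⊆ U) : SeparatesOn C := by
  classical
  intro P Q hP hQ hPQ
  let good : ℕ → Prop := fun l => Disjoint (N l) P ∨ Disjoint (N l) Q
  have hex : ∀ y : C, ∃ l, (y : Y) ∈ N l ∧ good l := by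
    intro y
    by_cases hy : (y : Y) ∈ P
    · obtain ⟨l, h1, h2⟩ := hb y y.2 _ hQ.isOpen_compl (Set.disjoint_left.1 hPQ hy)
      exact ⟨l, h1, Or.inr (Set.disjoint_left.2 fun z hz => h2 hz)⟩
    · obtain ⟨l, h1, h2⟩ := hb y y.2 _ hP.isOpen_compl hy
      exact ⟨l, h1, Or.inl (Set.disjoint_left.2 fun z hz => h2 hz)⟩
  have hclopen : ∀ l, IsClopen {y : C | (y : Y) ∈ N l} := by
    intro l
    constructor
    · convert! (hN l).preimage (continuous_subtype_val : Continuous ((↑) : C → Y)) using 1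
      ext y; simp
    · rw [← isClosed_compl_iff]
      convert! (hN' l).preimage (continuous_subtype_val : Continuous ((↑) : C → Y)) using 1
      ext y; simp
  let lam : C → ℕ := fun y => Nat.find (hex y)
  have hlam : IsLocallyConstant lam := by
    rw [IsLocallyConstant.iff_eventually_eq]
    intro y
    have h1 : ∀ᶠ z : C in nhds y, ∀ l ∈ Finset.range (lam y + 1),
        ((z : Y) ∈ N l ↔ (y : Y) ∈ N l) := by
      rw [Filter.eventually_all_finset]
      intro l _
      by_cases hy : (y : Y) ∈ N l
      · filter_upwards [(hclopen l).isOpen.mem_nhds hy] with z hz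
        exact iff_of_true hz hy
      · filter_upwards [(hclopen l).compl.isOpen.mem_nhds hy] with z hz
        exact iff_of_false hz hy
    filter_upwards [h1] with z hz
    rw [Nat.find_eq_iff]
    have hspec := Nat.find_spec (hex y)
    refine ⟨⟨(hz _ (by simp)).2 hspec.1, hspec.2⟩, fun m hm hm' => ?_⟩
    exact Nat.find_min (hex y) hm ⟨(hz m (by simp; omega)).1 hm'.1, hm'.2⟩
  let G : Set ℕ := {l | Disjoint (N l) Q}
  have hcl : ∀ G : Set ℕ, IsClosed (((↑) : C → Y) '' (lam ⁻¹' G)) := fun G =>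
    hC.isClosedMap_subtype_val _ ((isOpen_compl_iff (s := lam ⁻¹' G)).1 (hlam Gᶜ))
  refine ⟨P ∪ (↑) '' (lam ⁻¹' G), Q ∪ (↑) '' (lam ⁻¹' Gᶜ), hP.union (hcl _), hQ.union (hcl _),
    ?_, Set.subset_union_left, Set.subset_union_left, ?_⟩
  · rw [Set.disjoint_union_left, Set.disjoint_union_right, Set.disjoint_union_right]
    refine ⟨⟨hPQ, ?_⟩, ?_, ?_⟩
    · rw [Set.disjoint_right]
      rintro _ ⟨y, hy, rfl⟩
      have := Nat.find_spec (hex y)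
      exact Set.disjoint_left.1 (this.2.resolve_right hy) this.1
    · rw [Set.disjoint_left]
      rintro _ ⟨y, hy, rfl⟩
      exact Set.disjoint_left.1 hy (Nat.find_spec (hex y)).1
    · refine (Set.disjoint_image_iff Subtype.val_injective).2 ?_
      exact Disjoint.preimage _ disjoint_compl_right
  · intro y hy
    by_cases h : lam ⟨y, hy⟩ ∈ G
    · exact Or.inl (Or.inr ⟨⟨y, hy⟩, h, rfl⟩)
    · exact Or.inr (Or.inr ⟨⟨y, hy⟩, h, rfl⟩)

/-- The distance to a set, capped by `1` (so that the distance to `∅` is `1`). -/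
noncomputable def cappedInfDist {X : Type*} [PseudoEMetricSpace X] (B : Set X) (x : X) : ℝ :=
  (min 1 (Metric.infEDist x B)).toReal

section cappedInfDist

variable {X : Type*} [PseudoEMetricSpace X] {B B' : Set X} {x : X}

theorem continuous_cappedInfDist : Continuous (cappedInfDist B) :=
  ENNReal.continuousOn_toReal.comp_continuous (continuous_const.min Metric.continuous_infEDist)
    fun x => ne_top_of_le_ne_top ENNReal.one_ne_top (min_le_left 1 (Metric.infEDist x B))

theorem cappedInfDist_anti (h : B ⊆ B') : cappedInfDist B' x ≤ cappedInfDist B x :=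
  ENNReal.toReal_mono (ne_top_of_le_ne_top ENNReal.one_ne_top (min_le_left _ _))
    (min_le_min_left _ (Metric.infEDist_anti h))

theorem cappedInfDist_of_mem (h : x ∈ B) : cappedInfDist B x = 0 := by
  simp [cappedInfDist, Metric.infEDist_zero_of_mem h]

theorem cappedInfDist_pos (h : x ∉ closure B) : 0 < cappedInfDist B x := by
  refine ENNReal.toReal_pos ?_ (ne_top_of_le_ne_top ENNReal.one_ne_top (min_le_left _ _))
  rw [Metric.mem_closure_iff_infEDist_zero] at h
  exact (lt_min one_pos (pos_iff_ne_zero.2 h)).ne'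

end cappedInfDist

/-- `Z` is covered by finite disjoint families of open sets of arbitrarily small mesh. The open
sets are the supports of nonnegative functions indexed by centers of small balls. -/
def IsZeroDimIn {X : Type*} [PseudoMetricSpace X] (Z : Set X) : Prop :=
  ∀ ε > 0, ∃ (S : Finset X) (g : X → C(X, ℝ)), (∀ s x, 0 ≤ g s x) ∧
    (∀ s s' x, 0 < g s x → 0 < g s' x → s = s') ∧ (∀ s x, 0 < g s x → dist x s < ε) ∧
    (∀ s x, 0 < g s x → s ∈ S) ∧ ∀ x ∈ Z, ∃ s, 0 < g s x

theorem isZeroDimIn_of_exists_isClopen {X : Type*} [PseudoMetricSpace X] [CompactSpace X]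
    {Z : Set X} (hZ : ∀ P Q : Set Z, IsClosed P → IsClosed Q → Disjoint P Q →
      ∃ W : Set Z, IsClopen W ∧ P ⊆ W ∧ Disjoint W Q) : IsZeroDimIn Z := by
  intro ε hε
  obtain ⟨t, -, htf, ht⟩ := finite_cover_balls_of_compact (isCompact_univ (X := X)) (half_pos hε)
  lift t to Finset X using htf
  obtain ⟨e, he⟩ : ∃ e : X → ℕ, Set.InjOn e t :=
    Set.countable_iff_exists_injOn.1 t.countable_toSet
  have hW : ∀ s : X, ∃ W : Set Z, IsClopen W ∧ (∀ y : Z, dist (y : X) s ≤ ε / 2 → y ∈ W) ∧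
      ∀ y ∈ W, dist (y : X) s < ε := by
    intro s
    obtain ⟨W, h1, h2, h3⟩ := hZ {y | dist (y : X) s ≤ ε / 2} {y | ε ≤ dist (y : X) s}
      (isClosed_le (by fun_prop) continuous_const) (isClosed_le continuous_const (by fun_prop))
      (Set.disjoint_left.2 fun y (hy : dist (y : X) s ≤ ε / 2) (hy' : ε ≤ dist (y : X) s) => by
        linarith)
    exact ⟨W, h1, fun y hy => h2 hy, fun y hy => not_le.1 (Set.disjoint_left.1 h3 hy)⟩
  choose W hWc hWs hWl using hW
  let D : X → Set Z := fun s => {y | s ∈ t ∧ y ∈ W s ∧ ∀ s' ∈ t, e s' < e s → y ∉ W s'}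
  have hDo : ∀ s, IsOpen (D s) := by
    intro s
    have : D s = {y | s ∈ t} ∩ W s ∩ ⋂ s' ∈ t, {y | e s' < e s → y ∉ W s'} := by
      ext y; simp [D, and_assoc]
    rw [this]
    refine (isOpen_const.inter (hWc s).isOpen).inter (isOpen_biInter_finset fun s' _ => ?_)
    by_cases h : e s' < e s
    · simpa only [h, true_imp_iff] using! (hWc s').compl.isOpen
    · simp [h]
  have hDdisj : ∀ s s' y, y ∈ D s → y ∈ D s' → s = s' := by
    rintro s s' y ⟨hs, hy, hmin⟩ ⟨hs', hy', hmin'⟩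
    rcases lt_trichotomy (e s) (e s') with h | h | h
    · exact absurd hy (hmin' s hs h)
    · exact he hs hs' h
    · exact absurd hy' (hmin s' hs' h)
  let ρ : X → X → ℝ := fun s x => cappedInfDist ((↑) '' (D s)ᶜ : Set X) x -
    cappedInfDist ((↑) '' D s : Set X) x
  refine ⟨t, fun s => ⟨fun x => min (max 0 (ρ s x)) (max 0 (ε - dist x s)), ?_⟩,
    fun s x => ?_, fun s s' x h h' => ?_, fun s x h => ?_, fun s x h => ?_, fun x hx => ?_⟩
  · exact (continuous_const.max (continuous_cappedInfDist.sub continuous_cappedInfDist)).min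
      (by fun_prop)
  · exact le_min (le_max_left _ _) (le_max_left _ _)
  · by_contra hne
    have h1 : 0 < ρ s x := by simpa using (lt_min_iff.1 h).1
    have h2 : 0 < ρ s' x := by simpa using (lt_min_iff.1 h').1
    have h3 : ((↑) '' D s : Set X) ⊆ (↑) '' (D s')ᶜ :=
      Set.image_mono fun y hy hy' => hne (hDdisj s s' y hy hy')
    have h4 : ((↑) '' D s' : Set X) ⊆ (↑) '' (D s)ᶜ :=
      Set.image_mono fun y hy hy' => hne (hDdisj s s' y hy' hy)
    have h5 := cappedInfDist_anti (x := x) h3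
    have h6 := cappedInfDist_anti (x := x) h4
    simp only [ρ] at h1 h2
    linarith
  · have : 0 < ε - dist x s := by simpa using (lt_min_iff.1 h).2
    linarith
  · by_contra hs
    have h1 : 0 < ρ s x := by simpa using (lt_min_iff.1 h).1
    have h2 : D s = ∅ := by ext y; simp [D, hs]
    have h3 := cappedInfDist_anti (x := x) (Set.empty_subset ((↑) '' (D s)ᶜ : Set X))
    simp only [ρ, h2, Set.image_empty] at h1 h3
    linarith
  · have hex : ∃ s ∈ t, (⟨x, hx⟩ : Z) ∈ W s := by
      obtain ⟨s, hs, hxs⟩ := Set.mem_iUnion₂.1 (ht (Set.mem_univ x))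
      exact ⟨s, hs, hWs s _ (Metric.mem_ball.1 hxs).le⟩
    classical
    obtain ⟨s, hs, hmin⟩ := (t.filter fun s => (⟨x, hx⟩ : Z) ∈ W s).exists_min_image e
      (by obtain ⟨s, h1, h2⟩ := hex; exact ⟨s, Finset.mem_filter.2 ⟨h1, h2⟩⟩)
    rw [Finset.mem_filter] at hs
    have hxD : (⟨x, hx⟩ : Z) ∈ D s := ⟨hs.1, hs.2, fun s' hs' hlt hmem =>
      hlt.not_ge (hmin s' (Finset.mem_filter.2 ⟨hs', hmem⟩))⟩
    refine ⟨s, lt_min (lt_max_of_lt_right ?_) (lt_max_of_lt_right (sub_pos.2 (hWl s _ hs.2)))⟩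
    simp only [ρ]
    rw [cappedInfDist_of_mem (B := Subtype.val '' D s) ⟨_, hxD, rfl⟩, sub_zero]
    refine cappedInfDist_pos fun hcl => ?_
    have := (hDo s).isClosed_compl.closure_eq ▸ (closure_subtype (s := (D s)ᶜ) (x := ⟨x, hx⟩)).2 hcl
    exact this hxD

theorem exists_seq_isClopen_inter_zero {X : Type*} [MetricSpace X] [CompactSpace X] [Nonempty X]
    {n : ℕ} (hX : CoverDimLE n X) :
    ∃ f : ℕ → C(X, ℝ), (∀ x, ∀ U, IsOpen U → x ∈ U → ∃ l, f l x < 0 ∧ ∀ y, f l y < 0 → y ∈ U) ∧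
      ∀ x, {l | f l x = 0}.encard ≤ n := by
  obtain ⟨f, hfu, hf⟩ := hX.exists_seq_near fun l =>
    ⟨fun x => 4 * 2 ^ l.unpair.2 * dist x (denseSeq X l.unpair.1) - 3, by fun_prop⟩
  refine ⟨f, fun x U hU hxU => ?_, fun x => ?_⟩
  · obtain ⟨ε, hε, hεU⟩ := Metric.isOpen_iff.1 hU x hxU
    obtain ⟨j, hj⟩ := pow_unbounded_of_one_lt (2 / ε) one_lt_two
    rw [div_lt_iff₀ hε] at hj
    have h2 : (0 : ℝ) < 2 ^ j := by positivity
    obtain ⟨a, ha⟩ := (denseRange_denseSeq X).exists_dist_lt x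
      (ε := 1 / (2 * 2 ^ j)) (by positivity)
    rw [lt_div_iff₀ (by positivity)] at ha
    refine ⟨Nat.pair a j, ?_, fun y hy => hεU ?_⟩
    · have := (abs_lt.1 (hfu (Nat.pair a j) x)).2
      simp only [Nat.unpair_pair, ContinuousMap.coe_mk] at this
      nlinarith
    · have := (abs_lt.1 (hfu (Nat.pair a j) y)).1
      simp only [Nat.unpair_pair, ContinuousMap.coe_mk] at this
      rw [Metric.mem_ball]
      have h3 := dist_triangle_right y x (denseSeq X a)
      by_contra! h4
      nlinarith
  · by_contra! h
    obtain ⟨t, ht, hcard⟩ := Set.exists_subset_encard_eq (Order.add_one_le_of_lt h)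
    have htf : t.Finite := Set.finite_of_encard_eq_coe (k := n + 1) (by exact_mod_cast hcard)
    lift t to Finset ℕ using htf
    obtain ⟨l, hl, hne⟩ := hf x t (by
      rw [Set.encard_coe_eq_coe_finsetCard] at hcard
      exact_mod_cast hcard)
    exact hne (ht hl)

/-- A compact metric space of covering dimension at most `n` is a union of `n + 1` subsets of
dimension at most zero. -/
theorem CoverDimLE.exists_isZeroDimIn {X : Type*} [MetricSpace X] [CompactSpace X] [Nonempty X]
    {n : ℕ} (hX : CoverDimLE n X) :
    ∃ Z : ℕ → Set X, (∀ i, IsZeroDimIn (Z i)) ∧ ∀ x, ∃ i ≤ n, x ∈ Z i := by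
  obtain ⟨f, hbase, hcard⟩ := exists_seq_isClopen_inter_zero hX
  refine ⟨fun i => {x | {l | f l x = 0}.encard = i}, fun i => ?_, fun x => ?_⟩
  · refine isZeroDimIn_of_exists_isClopen fun P Q hP hQ hPQ => ?_
    set Z : Set X := {x | {l | f l x = 0}.encard = i}
    obtain ⟨L, hL⟩ := exists_surjective_nat (Finset ℕ)
    have hZ : ∀ y : Z, ∀ K : Finset ℕ, K.card = i → (∀ l ∈ K, f l y = 0) →
        ∀ l, f l y = 0 → l ∈ K := by
      intro y K hK hy l hl
      have hy' : {l | f l y = 0}.encard = i := y.2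
      have : (K : Set ℕ) = {l | f l y = 0} :=
        (Set.finite_of_encard_eq_coe hy').eq_of_subset_of_encard_le'
          (fun l hl => hy l (Finset.mem_coe.1 hl))
          (by rw [hy', Set.encard_coe_eq_coe_finsetCard, hK])
      exact Finset.mem_coe.1 (this.symm.subset hl)
    refine exists_isClopen_of_separatesOn
      (C := fun m => {y : Z | (L m).card = i ∧ ∀ l ∈ L m, f l y = 0})
      (fun m => ?_) ?_ hP hQ hPQ
    · have hcl : IsClosed {y : Z | (L m).card = i ∧ ∀ l ∈ L m, f l y = 0} := by
        simp only [Set.ofPred_and, Set.ofPred_forall]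
        exact isClosed_const.inter (isClosed_biInter fun l _ =>
          isClosed_eq (by fun_prop) continuous_const)
      refine separatesOn_of_isClopen_basis hcl (fun l => {y : Z | f l y < 0}) (fun l => ?_)
        (fun l => ?_) fun y _ U hU hyU => ?_
      · by_cases hl : l ∈ L m
        · convert isClosed_empty
          ext y
          simp only [Set.mem_inter_iff, Set.mem_ofPred_eq, Set.mem_empty_iff_false, iff_false]
          exact fun h => h.2.ne (h.1.2 l hl)
        · convert hcl.inter (isClosed_le (f := fun y : Z => f l y) (by fun_prop)
            (continuous_const (y := (0 : ℝ)))) using 1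
          ext y
          simp only [Set.mem_inter_iff, Set.mem_ofPred_eq]
          exact ⟨fun h => ⟨h.1, h.2.le⟩, fun h => ⟨h.1, h.2.lt_of_ne fun h0 =>
            hl (hZ y _ h.1.1 h.1.2 l h0)⟩⟩
      · convert hcl.inter (isClosed_le (continuous_const (y := (0 : ℝ)))
          (g := fun y : Z => f l y) (by fun_prop)) using 1
        ext y
        simp
      · obtain ⟨V, hV, rfl⟩ := isOpen_induced_iff.1 hU
        obtain ⟨l, hl, hlV⟩ := hbase y V hV hyU
        exact ⟨l, hl, fun z hz => hlV z hz⟩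
    · refine Set.eq_univ_of_forall fun y => ?_
      have hy' : {l | f l y = 0}.encard = i := y.2
      have hfin := Set.finite_of_encard_eq_coe hy'
      obtain ⟨m, hm⟩ := hL hfin.toFinset
      refine Set.mem_iUnion.2 ⟨m, ?_, fun l hl => ?_⟩
      · rw [hm]
        rw [hfin.encard_eq_coe_toFinset_card] at hy'
        exact_mod_cast hy'
      · rw [hm] at hl
        simpa using hl
  · obtain ⟨i, hi⟩ :=
      ENat.ne_top_iff_exists.1 (ne_top_of_le_ne_top (ENat.natCast_ne_top n) (hcard x))
    exact ⟨i, by exact_mod_cast hi ▸ hcard x, hi.symm⟩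

/-- A nullhomotopic map on a sphere extends to the ball. -/
theorem ContinuousMap.Nullhomotopic.exists_extension_closedBall {E X : Type*}
    [NormedAddCommGroup E] [NormedSpace ℝ E] [FiniteDimensional ℝ E] [Nontrivial E]
    [TopologicalSpace X] {f : C(sphere (0 : E) 1, X)} (hf : f.Nullhomotopic) :
    ∃ g : C(closedBall (0 : E) 1, X),
      ∀ x : sphere (0 : E) 1, g ⟨x, sphere_subset_closedBall x.2⟩ = f x := by
  obtain ⟨y, ⟨H⟩⟩ := hf
  let q : C(unitInterval × sphere (0 : E) 1, closedBall (0 : E) 1) :=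
    ⟨fun p => ⟨(1 - (p.1 : ℝ)) • (p.2 : E), by
      rw [mem_closedBall_zero_iff, norm_smul, norm_eq_of_mem_sphere p.2, mul_one, Real.norm_eq_abs,
        abs_of_nonneg (by linarith [p.1.2.2])]
      linarith [p.1.2.1]⟩, by fun_prop⟩
  have hnorm : ∀ p, ‖(q p : E)‖ = 1 - (p.1 : ℝ) := fun p => by
    simp only [q, ContinuousMap.coe_mk, norm_smul, norm_eq_of_mem_sphere p.2, mul_one,
      Real.norm_eq_abs]
    exact abs_of_nonneg (by linarith [p.1.2.2])
  have hqs : Function.Surjective q := by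
    rintro ⟨x, hx⟩
    rw [mem_closedBall_zero_iff] at hx
    by_cases h0 : x = 0
    · obtain ⟨e, he⟩ := NormedSpace.sphere_nonempty (x := (0 : E)) (r := 1) |>.2 zero_le_one
      exact ⟨(1, ⟨e, he⟩), Subtype.ext (by simp [q, h0])⟩
    · have h1 := norm_pos_iff.2 h0
      refine ⟨(⟨1 - ‖x‖, by linarith, by linarith⟩, ⟨‖x‖⁻¹ • x, ?_⟩), Subtype.ext ?_⟩
      · simp [norm_smul, h1.ne']
      · simp [q, smul_smul, h1.ne']
  have hq : Topology.IsQuotientMap q := q.continuous.isClosedMap.isQuotientMap q.continuous hqs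
  have hfac : Function.FactorsThrough H.toContinuousMap q := by
    intro a b hab
    have h1 : a.1 = b.1 := Subtype.ext (by
      have := congrArg (fun z : closedBall (0 : E) 1 => ‖(z : E)‖) hab
      simp only [hnorm] at this
      linarith)
    obtain ⟨t, a⟩ := a
    obtain ⟨t', b⟩ := b
    obtain rfl : t = t' := h1
    by_cases ht : t = 1
    · subst ht
      exact (H.apply_one a).trans (H.apply_one b).symm
    · have h2 : (1 : ℝ) - t ≠ 0 := fun h => ht (Subtype.ext (by simpa using (sub_eq_zero.1 h).symm))
      have h3 : a = b := Subtype.ext (smul_right_injective E h2 (congrArg Subtype.val hab))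
      rw [h3]
  refine ⟨hq.lift H.toContinuousMap hfac, fun x => ?_⟩
  have h1 : (⟨x, sphere_subset_closedBall x.2⟩ : closedBall (0 : E) 1) = q (0, x) :=
    Subtype.ext (by simp [q])
  rw [h1]
  exact (DFunLike.congr_fun (hq.lift_comp _ hfac) (0, x)).trans (H.apply_zero x)

section cubeToSphere

variable {r : ℕ}

/-- The affine identification of the unit cube with the cube `[-1, 1] ^ r`. -/
def cubeCoord (t : Fin r → unitInterval) : Fin r → ℝ := fun i => 2 * (t i : ℝ) - 1

theorem norm_cubeCoord_le (t : Fin r → unitInterval) : ‖cubeCoord t‖ ≤ 1 :=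
  (pi_norm_le_iff_of_nonneg zero_le_one).2 fun i => by
    rw [Real.norm_eq_abs, abs_le]
    constructor <;> simp only [cubeCoord] <;> linarith [(t i).2.1, (t i).2.2]

theorem mem_boundary_iff_norm_cubeCoord {t : Fin r → unitInterval} :
    t ∈ Cube.boundary (Fin r) ↔ ‖cubeCoord t‖ = 1 := by
  refine ⟨fun ⟨i, hi⟩ => (norm_cubeCoord_le t).antisymm ?_, fun h => ?_⟩
  · refine le_trans ?_ (norm_le_pi_norm (cubeCoord t) i)
    rcases hi with hi | hi <;> norm_num [cubeCoord, hi]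
  · by_contra hn
    refine h.not_lt ((pi_norm_lt_iff zero_lt_one).2 fun i => ?_)
    have h0 : t i ≠ 0 := fun h => hn ⟨i, Or.inl h⟩
    have h1 : t i ≠ 1 := fun h => hn ⟨i, Or.inr h⟩
    have h0' := unitInterval.pos_iff_ne_zero.2 h0
    have h1' := unitInterval.lt_one_iff_ne_one.2 h1
    have h0'' : (0 : ℝ) < t i := h0'
    have h1'' : (t i : ℝ) < 1 := h1'
    rw [Real.norm_eq_abs, abs_lt]
    constructor <;> simp only [cubeCoord] <;> linarith

theorem cubeToSphere_denom_pos (y : Fin r → ℝ) : 0 < ∑ i, y i ^ 2 + (1 - ‖y‖) ^ 2 := by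
  have h0 : 0 ≤ ∑ i, y i ^ 2 := Finset.sum_nonneg fun i _ => sq_nonneg _
  by_cases hy : y = 0
  · simp [hy]
  · obtain ⟨i, hi⟩ := Function.ne_iff.1 hy
    have h1 : 0 < ∑ i, y i ^ 2 := Finset.sum_pos' (fun i _ => sq_nonneg _)
      ⟨i, Finset.mem_univ i, sq_pos_of_ne_zero hi⟩
    positivity

/-- The map from the unit cube to the sphere which collapses the boundary of the cube to a point
and is injective elsewhere: inverse stereographic projection of `y / (1 - ‖y‖)`. -/
noncomputable def cubeToSphere (r : ℕ) :
    C(Fin r → unitInterval, sphere (0 : EuclideanSpace ℝ (Fin (r + 1))) 1) where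
  toFun t := ⟨WithLp.toLp 2 (Fin.cons
      ((∑ i, cubeCoord t i ^ 2 - (1 - ‖cubeCoord t‖) ^ 2) /
        (∑ i, cubeCoord t i ^ 2 + (1 - ‖cubeCoord t‖) ^ 2))
      fun i => 2 * (1 - ‖cubeCoord t‖) * cubeCoord t i /
        (∑ i, cubeCoord t i ^ 2 + (1 - ‖cubeCoord t‖) ^ 2)), by
    have hD := (cubeToSphere_denom_pos (cubeCoord t)).ne'
    rw [mem_sphere_zero_iff_norm, EuclideanSpace.norm_eq, Real.sqrt_eq_one]
    simp only [Real.norm_eq_abs, sq_abs, Fin.sum_univ_succ, Fin.cons_zero, Fin.cons_succ, div_pow,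
      mul_pow]
    rw [← Finset.sum_div, ← Finset.mul_sum]
    field_simp
    ring⟩
  continuous_toFun := by
    have hc : Continuous (cubeCoord (r := r)) := by unfold cubeCoord; fun_prop
    have hD := fun t : Fin r → unitInterval => (cubeToSphere_denom_pos (cubeCoord t)).ne'
    refine Continuous.subtype_mk ((PiLp.continuous_toLp 2 _).comp (continuous_pi fun i => ?_)) _
    refine Fin.cases ?_ (fun i => ?_) i
    · simp only [Fin.cons_zero]
      exact Continuous.div (by fun_prop) (by fun_prop) hD
    · simp only [Fin.cons_succ]
      exact Continuous.div (by fun_prop) (by fun_prop) hD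

theorem cubeToSphere_zero (t : Fin r → unitInterval) : (cubeToSphere r t).1 0 =
    (∑ i, cubeCoord t i ^ 2 - (1 - ‖cubeCoord t‖) ^ 2) /
      (∑ i, cubeCoord t i ^ 2 + (1 - ‖cubeCoord t‖) ^ 2) := rfl

theorem cubeToSphere_succ (t : Fin r → unitInterval) (i : Fin r) :
    (cubeToSphere r t).1 i.succ = 2 * (1 - ‖cubeCoord t‖) * cubeCoord t i /
      (∑ i, cubeCoord t i ^ 2 + (1 - ‖cubeCoord t‖) ^ 2) := rfl

theorem cubeToSphere_eq_iff_of_notMem {t t' : Fin r → unitInterval}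
    (ht : t ∉ Cube.boundary (Fin r)) (h : cubeToSphere r t = cubeToSphere r t') : t = t' := by
  rw [mem_boundary_iff_norm_cubeCoord] at ht
  have hD := cubeToSphere_denom_pos (cubeCoord t)
  have hD' := cubeToSphere_denom_pos (cubeCoord t')
  have e0 := congrArg (fun x => x.1 0) h
  have e1 := fun i : Fin r => congrArg (fun x => x.1 i.succ) h
  simp only [cubeToSphere_zero, cubeToSphere_succ] at e0 e1
  have hb : 0 < 1 - ‖cubeCoord t‖ := sub_pos.2 (lt_of_le_of_ne (norm_cubeCoord_le t) ht)
  have hb' : 0 ≤ 1 - ‖cubeCoord t'‖ := sub_nonneg.2 (norm_cubeCoord_le t')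
  suffices hy : cubeCoord t = cubeCoord t' by
    funext i
    have := congrFun hy i
    simp only [cubeCoord] at this
    exact Subtype.ext (by linarith)
  generalize cubeCoord t = y at *
  generalize cubeCoord t' = y' at *
  clear ht h
  set D := ∑ i, y i ^ 2 + (1 - ‖y‖) ^ 2
  set D' := ∑ i, y' i ^ 2 + (1 - ‖y'‖) ^ 2
  set b := 1 - ‖y‖ with hbdef
  set b' := 1 - ‖y'‖ with hbdef'
  have hc : b ^ 2 / D = b' ^ 2 / D' := by
    have h1 : (∑ i, y i ^ 2 - b ^ 2) / D = 1 - 2 * (b ^ 2 / D) := by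
      field_simp
      simp only [D]; ring
    have h2 : (∑ i, y' i ^ 2 - b' ^ 2) / D' = 1 - 2 * (b' ^ 2 / D') := by
      field_simp
      simp only [D']; ring
    linarith
  have hb'0 : 0 < b' := by
    refine hb'.lt_of_ne fun h0 => ?_
    have : 0 < b ^ 2 / D := by positivity
    rw [hc, ← h0] at this
    simp at this
  have hz : b' • y = b • y' := by
    funext i
    have h1 := e1 i
    rw [div_eq_div_iff hD.ne' hD'.ne'] at h1 hc
    have h2 : b * b' * D' * b * (b' * y i - b * y' i) = 0 := by
      linear_combination (b * b' * b' / 2) * h1 - b * b' * y' i * hc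
    have h3 : b * b' * D' * b ≠ 0 := by positivity
    simpa [sub_eq_zero, h3] using h2
  have hn := congrArg norm hz
  rw [norm_smul, norm_smul, Real.norm_of_nonneg hb', Real.norm_of_nonneg hb.le] at hn
  have hbb : b = b' := by
    have h1 : ‖y‖ = 1 - b := by simp [b]
    have h2 : ‖y'‖ = 1 - b' := by simp [b']
    rw [h1, h2] at hn
    linarith
  rw [hbb] at hz
  exact smul_right_injective _ hb'0.ne' hz

theorem cubeToSphere_of_mem {t : Fin r → unitInterval} (ht : t ∈ Cube.boundary (Fin r)) :
    (cubeToSphere r t).1 = EuclideanSpace.single 0 1 := by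
  have hD := (cubeToSphere_denom_pos (cubeCoord t)).ne'
  rw [mem_boundary_iff_norm_cubeCoord] at ht
  ext i
  refine Fin.cases ?_ (fun i => ?_) i
  · rw [cubeToSphere_zero]
    simp only [ht, sub_self, ne_eq, OfNat.ofNat_ne_zero, not_false_eq_true, zero_pow, sub_zero,
      add_zero] at hD ⊢
    simp [hD]
  · rw [cubeToSphere_succ]
    simp [ht]

theorem surjective_cubeToSphere [NeZero r] : Function.Surjective (cubeToSphere r) := by
  rintro ⟨p, hp⟩
  have hp' : p 0 ^ 2 + ∑ i : Fin r, p i.succ ^ 2 = 1 := by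
    rw [mem_sphere_zero_iff_norm, EuclideanSpace.norm_eq, Real.sqrt_eq_one] at hp
    simpa [Fin.sum_univ_succ] using hp
  have hA : 0 ≤ ∑ i : Fin r, p i.succ ^ 2 := Finset.sum_nonneg fun i _ => sq_nonneg _
  by_cases h1 : p 0 = 1
  · refine ⟨fun _ => 0, Subtype.ext ?_⟩
    rw [cubeToSphere_of_mem ⟨0, Or.inl rfl⟩]
    ext i
    refine Fin.cases ?_ (fun i => ?_) i
    · simp [h1]
    · rw [h1, one_pow, add_eq_left, Finset.sum_eq_zero_iff_of_nonneg fun i _ => sq_nonneg _] at hp'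
      have := hp' i (Finset.mem_univ i)
      simpa using ((pow_eq_zero_iff two_ne_zero).1 this).symm
  · have h2 : 0 < 1 - p 0 := sub_pos.2 (lt_of_le_of_ne (by nlinarith) h1)
    let z : Fin r → ℝ := fun i => p i.succ / (1 - p 0)
    let b : ℝ := (1 + ‖z‖)⁻¹
    have hb : 0 < b := by positivity
    have hbz : ‖b • z‖ = 1 - b := by
      rw [norm_smul, Real.norm_of_nonneg hb.le]
      simp only [b]
      field_simp
      ring
    clear_value b
    have hle : ∀ i, |b * z i| ≤ 1 := fun i =>
      (norm_le_pi_norm (b • z) i).trans (by rw [hbz]; linarith)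
    refine ⟨fun i => ⟨(1 + b * z i) / 2, ?_, ?_⟩, Subtype.ext ?_⟩
    · linarith [(abs_le.1 (hle i)).1]
    · linarith [(abs_le.1 (hle i)).2]
    have hy : cubeCoord (fun i => ⟨(1 + b * z i) / 2, by linarith [(abs_le.1 (hle i)).1],
        by linarith [(abs_le.1 (hle i)).2]⟩ : Fin r → unitInterval) = b • z := by
      funext i
      simp only [cubeCoord, Pi.smul_apply, smul_eq_mul]
      ring
    have hz : ∑ i, (b • z) i ^ 2 = b ^ 2 * ((1 + p 0) / (1 - p 0)) := by
      simp only [Pi.smul_apply, smul_eq_mul, mul_pow, z, div_pow]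
      rw [← Finset.mul_sum, ← Finset.sum_div, eq_sub_of_add_eq' hp']
      field_simp
      ring
    ext i
    refine Fin.cases ?_ (fun i => ?_) i
    · rw [cubeToSphere_zero, hy, hz, hbz, sub_sub_cancel]
      field_simp
      ring
    · rw [cubeToSphere_succ, hy, hz, hbz, sub_sub_cancel]
      simp only [Pi.smul_apply, smul_eq_mul, z]
      field_simp
      ring

end cubeToSphere

theorem nullhomotopic_of_subsingleton_homotopyGroup {X : Type*} [TopologicalSpace X] {r : ℕ}
    [NeZero r] (hX : ∀ x : X, Subsingleton (HomotopyGroup (Fin r) X x))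
    (f : C(sphere (0 : EuclideanSpace ℝ (Fin (r + 1))) 1, X)) : f.Nullhomotopic := by
  let p : sphere (0 : EuclideanSpace ℝ (Fin (r + 1))) 1 := ⟨EuclideanSpace.single 0 1, by simp⟩
  let F : GenLoop (Fin r) X (f p) := ⟨f.comp (cubeToSphere r), fun t ht =>
    congrArg f (Subtype.ext (cubeToSphere_of_mem ht))⟩
  have hF : GenLoop.Homotopic F GenLoop.const :=
    Quotient.exact ((hX (f p)).elim (Quotient.mk _ F) (Quotient.mk _ GenLoop.const))
  obtain ⟨H⟩ := hF
  let q : C(unitInterval × (Fin r → unitInterval),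
      unitInterval × sphere (0 : EuclideanSpace ℝ (Fin (r + 1))) 1) :=
    ⟨fun z => (z.1, cubeToSphere r z.2), by fun_prop⟩
  have hq : Topology.IsQuotientMap q := q.continuous.isClosedMap.isQuotientMap q.continuous
    (Function.surjective_id.prodMap surjective_cubeToSphere)
  have hfac : Function.FactorsThrough H.toContinuousMap q := by
    rintro ⟨s, t⟩ ⟨s', t'⟩ h
    obtain ⟨h1, h2⟩ := Prod.ext_iff.1 h
    obtain rfl : s = s' := h1
    by_cases ht : t ∈ Cube.boundary (Fin r)
    · by_cases ht' : t' ∈ Cube.boundary (Fin r)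
      · exact ((H.eq_fst s ht).trans (F.2 t ht)).trans
          ((H.eq_fst s ht').trans (F.2 t' ht')).symm
      · obtain rfl := cubeToSphere_eq_iff_of_notMem ht' h2.symm
        rfl
    · obtain rfl := cubeToSphere_eq_iff_of_notMem ht h2
      rfl
  have hlift : ∀ s t, hq.lift H.toContinuousMap hfac (s, cubeToSphere r t) = H (s, t) := fun s t =>
    DFunLike.congr_fun (hq.lift_comp _ hfac) (s, t)
  refine ⟨f p, ⟨⟨hq.lift H.toContinuousMap hfac, fun a => ?_, fun a => ?_⟩⟩⟩
  · obtain ⟨t, rfl⟩ := surjective_cubeToSphere a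
    exact (hlift 0 t).trans (H.apply_zero t)
  · obtain ⟨t, rfl⟩ := surjective_cubeToSphere a
    exact (hlift 1 t).trans (H.apply_one t)

theorem IsCConn.pathConnectedSpace {k : ℕ} {X : Type*} [TopologicalSpace X] (hX : IsCConn k X) :
    PathConnectedSpace X := by
  obtain ⟨⟨x⟩, h⟩ := hX
  have h0 := h x 0 (Nat.zero_le k)
  have e : HomotopyGroup (Fin 0) X x ≃ ZerothHomotopy X := HomotopyGroup.pi0EquivZerothHomotopy
  exact pathConnectedSpace_iff_zerothHomotopy.2 ⟨⟨Quotient.mk _ x⟩, e.symm.subsingleton⟩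

theorem IsCConn.exists_extension_closedBall {k : ℕ} {X : Type*} [TopologicalSpace X]
    (hX : IsCConn k X) {r : ℕ} (hr : r ≤ k)
    (f : C(sphere (0 : EuclideanSpace ℝ (Fin (r + 1))) 1, X)) :
    ∃ g : C(closedBall (0 : EuclideanSpace ℝ (Fin (r + 1))) 1, X),
      ∀ x : sphere (0 : EuclideanSpace ℝ (Fin (r + 1))) 1,
        g ⟨x, sphere_subset_closedBall x.2⟩ = f x := by
  obtain rfl | hr0 := eq_or_ne r 0
  · have := hX.pathConnectedSpace
    let p : ℝ → EuclideanSpace ℝ (Fin 1) := fun c => EuclideanSpace.single 0 c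
    let γ := PathConnectedSpace.somePath (f ⟨p (-1), by simp [p]⟩) (f ⟨p 1, by simp [p]⟩)
    refine ⟨⟨fun x => γ.extend ((x.1 0 + 1) / 2), γ.continuous_extend.comp (by fun_prop)⟩,
      fun x => ?_⟩
    have hx : x.1 0 ^ 2 = 1 := by
      have := x.2
      rw [mem_sphere_zero_iff_norm, EuclideanSpace.norm_eq, Real.sqrt_eq_one] at this
      simpa using this
    have hxp : x.1 = p (x.1 0) := by
      ext i
      obtain rfl : i = 0 := Fin.fin_one_eq_zero i
      simp [p]
    obtain h | h := sq_eq_one_iff.1 hx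
    · have h1 : x = ⟨p 1, by simp [p]⟩ := Subtype.ext (hxp.trans (by rw [h]))
      rw [ContinuousMap.coe_mk, h, h1]
      simp
    · have h1 : x = ⟨p (-1), by simp [p]⟩ := Subtype.ext (hxp.trans (by rw [h]))
      rw [ContinuousMap.coe_mk, h, h1]
      simp
  · have : NeZero r := ⟨hr0⟩
    exact (nullhomotopic_of_subsingleton_homotopyGroup (fun x => hX.2 x r hr)
      f).exists_extension_closedBall

/-- Maps of the `r`-sphere with image of diameter at most `δ` extend to the ball, with image of
diameter at most `ε`. -/
def FillsSpheres (r : ℕ) (δ ε : ENNReal) (X : Type*) [PseudoEMetricSpace X] : Prop :=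
  ∀ f : C(sphere (0 : EuclideanSpace ℝ (Fin (r + 1))) 1, X), (∀ a b, edist (f a) (f b) ≤ δ) →
    ∃ g : C(closedBall (0 : EuclideanSpace ℝ (Fin (r + 1))) 1, X),
      (∀ x : sphere (0 : EuclideanSpace ℝ (Fin (r + 1))) 1,
        g ⟨x, sphere_subset_closedBall x.2⟩ = f x) ∧ ∀ a b, edist (g a) (g b) ≤ ε

theorem exists_fillsSpheres {k : ℕ} {X : Type*} [PseudoMetricSpace X] [CompactSpace X]
    (hC : IsCConn k X) (hLC : IsLCConn k X) {ε : ENNReal} (hε : 0 < ε) :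
    ∃ δ > 0, (ε = ⊤ → δ = ⊤) ∧ ∀ r ≤ k, FillsSpheres r δ ε X := by
  obtain rfl | hε' := eq_or_ne ε ⊤
  · refine ⟨⊤, hε, fun _ => rfl, fun r hr f _ => ?_⟩
    obtain ⟨g, hg⟩ := hC.exists_extension_closedBall hr f
    exact ⟨g, hg, fun _ _ => le_top⟩
  have he := ENNReal.toReal_pos hε.ne' hε'
  set e := ε.toReal
  choose V hV hVU hVf using fun x => hLC x (ball x (e / 2)) (ball_mem_nhds x (half_pos he))
  obtain ⟨δ, hδ, hδV⟩ := lebesgue_number_lemma_of_metric (isCompact_univ (X := X))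
    (fun x => isOpen_interior (s := V x))
    fun x _ => Set.mem_iUnion.2 ⟨x, mem_interior_iff_mem_nhds.2 (hV x)⟩
  refine ⟨ENNReal.ofReal (δ / 2), ENNReal.ofReal_pos.2 (half_pos hδ), fun h => absurd h hε',
    fun r hr f hf => ?_⟩
  let p : sphere (0 : EuclideanSpace ℝ (Fin (r + 1))) 1 := ⟨EuclideanSpace.single 0 1, by simp⟩
  obtain ⟨x, hx⟩ := hδV (f p) (Set.mem_univ _)
  have hfV : ∀ a, f a ∈ V x := fun a => interior_subset (hx (by
    have := hf a p
    rw [edist_le_ofReal (half_pos hδ).le] at this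
    exact mem_ball.2 (this.trans_lt (half_lt_self hδ))))
  obtain ⟨g, hg⟩ := (hVf x r hr ⟨fun a => ⟨f a, hfV a⟩, by fun_prop⟩).exists_extension_closedBall
  refine ⟨⟨fun a => g a, by fun_prop⟩, fun a => congrArg Subtype.val (hg a), fun a b => ?_⟩
  have h1 := mem_ball.1 (g a).2
  have h2 := mem_ball.1 (g b).2
  rw [← ENNReal.ofReal_toReal hε', ContinuousMap.coe_mk, edist_le_ofReal he.le]
  linarith [dist_triangle_right (g a : X) (g b) x]

/-- The simplex spanned by the finite set `σ`, in barycentric coordinates. -/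
def simplexSet {V : Type*} (σ : Finset V) : Set (V → ℝ) :=
  {w | (∀ v, 0 ≤ w v) ∧ (∀ v ∉ σ, w v = 0) ∧ ∑ v ∈ σ, w v = 1}

/-- The boundary of the simplex spanned by the finite set `σ`. -/
def simplexBoundary {V : Type*} (σ : Finset V) : Set (V → ℝ) :=
  {w ∈ simplexSet σ | ∃ v ∈ σ, w v = 0}

theorem exists_simplexSet_equiv_closedBall {V : Type*} {n : ℕ} {σ : Finset V}
    (hσ : σ.card = n + 1) :
    ∃ (α : EuclideanSpace ℝ (Fin n) → V → ℝ) (β : (V → ℝ) → EuclideanSpace ℝ (Fin n)),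
      Continuous α ∧ Continuous β ∧ MapsTo α (closedBall 0 1) (simplexSet σ) ∧
      MapsTo α (sphere 0 1) (simplexBoundary σ) ∧ MapsTo β (simplexSet σ) (closedBall 0 1) ∧
      MapsTo β (simplexBoundary σ) (sphere 0 1) ∧ ∀ w ∈ simplexSet σ, α (β w) = w := by
  classical
  obtain ⟨b⟩ := AffineBasis.exists_affineBasis_of_finiteDimensional (ι := σ) (k := ℝ)
    (P := EuclideanSpace ℝ (Fin n)) (by simp [hσ])
  set C := convexHull ℝ (Set.range b) with hCdef
  have hC : IsCompact C := (Set.finite_range b).isCompact_convexHull ℝ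
  have hCi : (interior C).Nonempty := ⟨_, b.centroid_mem_interior_convexHull⟩
  obtain ⟨h, -, hcl, hfr⟩ := exists_homeomorph_image_interior_closure_frontier_eq_unitBall
    (convex_convexHull ℝ _) hCi hC.isBounded
  rw [hC.isClosed.closure_eq] at hcl
  rw [hC.isClosed.frontier_eq] at hfr
  have hCm : ∀ x, x ∈ C ↔ ∀ i, 0 ≤ b.coord i x := fun x => by
    rw [hCdef, b.convexHull_eq_nonneg_coord]; rfl
  have hCim : ∀ x, x ∈ interior C ↔ ∀ i, 0 < b.coord i x := fun x => by
    rw [hCdef, b.interior_convexHull]; rfl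
  let φ : EuclideanSpace ℝ (Fin n) → V → ℝ := fun x v =>
    if hv : v ∈ σ then b.coord ⟨v, hv⟩ x else 0
  have hφ : Continuous φ := continuous_pi fun v => by
    by_cases hv : v ∈ σ
    · simpa [φ, hv] using continuous_barycentric_coord b _
    · simpa [φ, hv] using continuous_const
  have hφv : ∀ x (v : σ), φ x v = b.coord v x := fun x v => by simp [φ]
  let ψ : (V → ℝ) → EuclideanSpace ℝ (Fin n) := fun w => ∑ v : σ, w v • b v
  have hψ : Continuous ψ := by fun_prop
  have hsum : ∀ w ∈ simplexSet σ, ∑ v : σ, w v = 1 := fun w hw => by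
    rw [Finset.sum_coe_sort σ w]; exact hw.2.2
  have hcoord : ∀ w ∈ simplexSet σ, ∀ v : σ, b.coord v (ψ w) = w v := fun w hw v => by
    have := b.coord_apply_combination_of_mem (Finset.mem_univ v) (hsum w hw)
    rwa [Finset.affineCombination_eq_linear_combination _ _ _ (hsum w hw)] at this
  have hφC : ∀ x ∈ C, φ x ∈ simplexSet σ := by
    refine fun x hx => ⟨fun v => ?_, fun v hv => by simp [φ, hv], ?_⟩
    · by_cases hv : v ∈ σ
      · simpa [φ, hv] using (hCm x).1 hx ⟨v, hv⟩
      · simp [φ, hv]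
    · rw [← Finset.sum_coe_sort σ (φ x)]
      simp_rw [hφv]
      exact b.sum_coord_apply_eq_one x
  have hψC : ∀ w ∈ simplexSet σ, ψ w ∈ C := fun w hw => (hCm _).2 fun i => by
    rw [hcoord w hw]; exact hw.1 _
  refine ⟨φ ∘ h.symm, h ∘ ψ, by fun_prop, by fun_prop, fun y hy => ?_, fun y hy => ?_,
    fun w hw => ?_, fun w hw => ?_, fun w hw => ?_⟩
  · rw [← hcl] at hy
    obtain ⟨x, hx, rfl⟩ := hy
    simpa using hφC x hx
  · rw [← hfr] at hy
    obtain ⟨x, hx, rfl⟩ := hy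
    have hx2 := hx.2
    rw [hCim] at hx2
    push Not at hx2
    obtain ⟨v, hv⟩ := hx2
    rw [Function.comp_apply, h.symm_apply_apply]
    exact ⟨hφC x hx.1, v, v.2, (hφv x v).trans (hv.antisymm ((hCm x).1 hx.1 v))⟩
  · rw [← hcl]
    exact Set.mem_image_of_mem h (hψC w hw)
  · rw [← hfr]
    refine Set.mem_image_of_mem h ⟨hψC w hw.1, fun hi => ?_⟩
    obtain ⟨v, hv, hv0⟩ := hw.2
    have := (hCim _).1 hi ⟨v, hv⟩
    rw [hcoord w hw.1] at this
    exact this.ne' hv0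
  · funext v
    simp only [Function.comp_apply, h.symm_apply_apply]
    by_cases hv : v ∈ σ
    · exact (hφv _ ⟨v, hv⟩).trans (hcoord w hw ⟨v, hv⟩)
    · rw [hw.2.1 v hv]
      simp [φ, hv]

theorem FillsSpheres.exists_extension_simplexSet {X : Type*} [PseudoEMetricSpace X] {r : ℕ}
    {δ ε : ENNReal} (h : FillsSpheres r δ ε X) {V : Type*} {σ : Finset V} (hσ : σ.card = r + 2)
    {F : (V → ℝ) → X} (hF : ContinuousOn F (simplexBoundary σ))
    (hFδ : ∀ w ∈ simplexBoundary σ, ∀ w' ∈ simplexBoundary σ, edist (F w) (F w') ≤ δ) :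
    ∃ G : (V → ℝ) → X, ContinuousOn G (simplexSet σ) ∧ EqOn G F (simplexBoundary σ) ∧
      ∀ w ∈ simplexSet σ, ∀ w' ∈ simplexSet σ, edist (G w) (G w') ≤ ε := by
  classical
  obtain ⟨α, β, hα, hβ, hα1, hα2, hβ1, hβ2, hαβ⟩ := exists_simplexSet_equiv_closedBall hσ
  obtain ⟨g, hgf, hg⟩ := h ⟨fun x => F (α x), hF.comp_continuous (by fun_prop) fun x => hα2 x.2⟩
    fun a b => hFδ _ (hα2 a.2) _ (hα2 b.2)
  refine ⟨fun w => if hw : β w ∈ closedBall 0 1 then g ⟨β w, hw⟩ else F w, ?_, fun w hw => ?_,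
    fun w hw w' hw' => ?_⟩
  · rw [continuousOn_iff_continuous_domRestrict]
    have : Continuous fun w : simplexSet σ => g ⟨β w, hβ1 w.2⟩ := by fun_prop
    convert this using 2 with w
    exact dif_pos (hβ1 w.2)
  · have h1 := hgf ⟨β w, hβ2 hw⟩
    simp only [ContinuousMap.coe_mk, hαβ w hw.1] at h1
    rw [← h1]
    exact dif_pos _
  · simp only [dif_pos (hβ1 hw), dif_pos (hβ1 hw')]
    exact hg _ _

section simplexSet

variable {V : Type*} {σ τ : Finset V} {v : V} {w : V → ℝ}

theorem isClosed_simplexSet (σ : Finset V) : IsClosed (simplexSet σ) := by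
  simp only [simplexSet, Set.ofPred_and, Set.ofPred_forall]
  exact (isClosed_iInter fun v => isClosed_le continuous_const (by fun_prop)).inter
    ((isClosed_biInter fun v _ => isClosed_eq (by fun_prop) continuous_const).inter
      (isClosed_eq (by fun_prop) continuous_const))

theorem simplexSet_mono (h : τ ⊆ σ) : simplexSet τ ⊆ simplexSet σ := fun w hw =>
  ⟨hw.1, fun v hv => hw.2.1 v fun hv' => hv (h hv'), by
    rw [← hw.2.2]
    exact (Finset.sum_subset h fun v _ hv => hw.2.1 v hv).symm⟩

theorem mem_simplexSet_erase [DecidableEq V] (hw : w ∈ simplexSet σ) (hv : w v = 0) :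
    w ∈ simplexSet (σ.erase v) := by
  refine ⟨hw.1, fun v' hv' => ?_, ?_⟩
  · by_cases h : v' = v
    · rw [h, hv]
    · exact hw.2.1 v' fun hs => hv' (Finset.mem_erase.2 ⟨h, hs⟩)
  · rw [Finset.sum_erase _ hv, hw.2.2]

theorem nonempty_of_mem_simplexSet (hw : w ∈ simplexSet σ) : σ.Nonempty := by
  refine Finset.nonempty_iff_ne_empty.2 fun h => ?_
  have := hw.2.2
  simp [h] at this

theorem single_mem_simplexSet [DecidableEq V] (hv : v ∈ σ) : Pi.single v 1 ∈ simplexSet σ := by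
  refine ⟨fun v' => ?_, fun v' hv' => Pi.single_eq_of_ne (by rintro rfl; exact hv' hv) _, ?_⟩
  · by_cases h : v' = v <;> simp [h]
  · simp [Pi.single_apply, hv]

theorem eq_of_mem_simplexSet_singleton [DecidableEq V] (hw : w ∈ simplexSet {v}) :
    w = Pi.single v 1 := by
  funext v'
  by_cases h : v' = v
  · have := hw.2.2
    rw [Finset.sum_singleton] at this
    simp [h, this]
  · rw [hw.2.1 v' (by simpa using h), Pi.single_eq_of_ne h]

/-- A face containing a point of the relative interior of a simplex contains the simplex. -/
theorem subset_of_mem_simplexSet (hτ : w ∈ simplexSet τ) (hσ : w ∈ simplexSet σ)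
    (hσ' : w ∉ simplexBoundary σ) : σ ⊆ τ := by
  intro v hv
  by_contra h
  exact hσ' ⟨hσ, v, hv, hτ.2.1 v h⟩

theorem simplexBoundary_eq [DecidableEq V] (σ : Finset V) :
    simplexBoundary σ = ⋃ v : σ, simplexSet (σ.erase v) := by
  ext w
  refine ⟨fun ⟨hw, v, hv, h0⟩ => Set.mem_iUnion.2 ⟨⟨v, hv⟩, mem_simplexSet_erase hw h0⟩,
    fun hw => ?_⟩
  obtain ⟨v, hv⟩ := Set.mem_iUnion.1 hw
  exact ⟨simplexSet_mono (Finset.erase_subset _ _) hv, v, v.2,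
    hv.2.1 v (Finset.notMem_erase _ _)⟩

end simplexSet

/-- Vertex maps of simplicial complexes which are `θ`-controlled extend to `η`-controlled maps on
the skeleton formed by the simplices with at most `p` vertices. The control on a simplex depends
on the levels of its vertices. -/
def HasControlledExtension (p : ℕ) (θ η : ℕ → ENNReal) (X : Type v)
    [PseudoEMetricSpace X] : Prop :=
  ∀ (V : Type v) (lvl : V → ℕ) (K : Set (Finset V)) (x : V → X), (∀ σ ∈ K, ∀ τ ⊆ σ, τ ∈ K) →
    (∀ σ ∈ K, ∀ j, (∀ v ∈ σ, j ≤ lvl v) → ∀ v ∈ σ, ∀ v' ∈ σ, edist (x v) (x v') ≤ θ j) →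
    ∃ F : (V → ℝ) → X, (∀ v, ∀ w ∈ simplexSet {v}, F w = x v) ∧
      (∀ σ ∈ K, σ.card ≤ p → ContinuousOn F (simplexSet σ)) ∧
      ∀ σ ∈ K, ∀ j, (∀ v ∈ σ, j ≤ lvl v) → ∀ τ ⊆ σ, τ.card ≤ p → ∀ τ' ⊆ σ, τ'.card ≤ p →
        ∀ w ∈ simplexSet τ, ∀ w' ∈ simplexSet τ', edist (F w) (F w') ≤ η j

theorem hasControlledExtension_one {X : Type v} [PseudoEMetricSpace X] [Nonempty X]
    (η : ℕ → ENNReal) : HasControlledExtension 1 η η X := by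
  classical
  intro V lvl K x hK hx
  let F : (V → ℝ) → X := fun w =>
    if h : ∃ v, w ∈ simplexSet {v} then x h.choose else Classical.arbitrary X
  have hF : ∀ v, ∀ w ∈ simplexSet {v}, F w = x v := by
    intro v w hw
    have h : ∃ v, w ∈ simplexSet {v} := ⟨v, hw⟩
    have h1 : F w = x h.choose := dif_pos h
    have h2 := (eq_of_mem_simplexSet_singleton h.choose_spec).symm.trans
      (eq_of_mem_simplexSet_singleton hw)
    have h3 := congrFun h2 v
    by_cases h4 : v = h.choose
    · rw [h1, ← h4]
    · rw [Pi.single_eq_of_ne h4, Pi.single_eq_same] at h3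
      exact absurd h3 zero_ne_one
  have hex : ∀ τ : Finset V, τ.card ≤ 1 → ∀ w ∈ simplexSet τ, ∃ v, τ = {v} := fun τ hτ w hw =>
    Finset.card_eq_one.1 (hτ.antisymm (nonempty_of_mem_simplexSet hw).card_pos)
  refine ⟨F, hF, fun σ _ hσ => Set.Subsingleton.continuousOn (fun w hw w' hw' => ?_) _,
    fun σ hσ j hj τ hτ hτ1 τ' hτ' hτ1' w hw w' hw' => ?_⟩
  · obtain ⟨v, rfl⟩ := hex σ hσ w hw
    rw [eq_of_mem_simplexSet_singleton hw, eq_of_mem_simplexSet_singleton hw']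
  · obtain ⟨v, rfl⟩ := hex τ hτ1 w hw
    obtain ⟨v', rfl⟩ := hex τ' hτ1' w' hw'
    rw [hF v w hw, hF v' w' hw']
    exact hx σ hσ j hj v (by simpa using hτ) v' (by simpa using hτ')

theorem HasControlledExtension.succ {X : Type v} [PseudoEMetricSpace X] [Nonempty X] {r : ℕ}
    {θ η' ε η : ℕ → ENNReal} (h : HasControlledExtension (r + 1) θ η' X) (hε : Antitone ε)
    (hη' : ∀ j, η' j ≤ ε j) (hη : ∀ j, 3 * ε j ≤ η j)
    (hfill : ∀ j, FillsSpheres r (η' j) (ε j) X) :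
    HasControlledExtension (r + 2) θ η X := by
  classical
  intro V lvl K x hK hx
  obtain ⟨F, hFx, hFc, hF⟩ := h V lvl K x hK hx
  have hG : ∀ σ : Finset V, ∃ G : (V → ℝ) → X, σ ∈ K → σ.card = r + 2 →
      ContinuousOn G (simplexSet σ) ∧ EqOn G F (simplexBoundary σ) ∧
      ∀ j, (∀ v ∈ σ, j ≤ lvl v) → ∀ w ∈ simplexSet σ, ∀ w' ∈ simplexSet σ,
        edist (G w) (G w') ≤ ε j := by
    intro σ
    by_cases hσ : σ ∈ K ∧ σ.card = r + 2
    swap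
    · exact ⟨F, fun h1 h2 => absurd ⟨h1, h2⟩ hσ⟩
    have hne : σ.Nonempty := Finset.card_pos.1 (by omega)
    have hcard : ∀ v : σ, (σ.erase v).card ≤ r + 1 := fun v => by
      rw [Finset.card_erase_of_mem v.2]; omega
    obtain ⟨G, hG1, hG2, hG3⟩ := (hfill (σ.inf' hne lvl)).exists_extension_simplexSet hσ.2
      (F := F) (by
        rw [simplexBoundary_eq]
        exact (locallyFinite_of_finite _).continuousOn_iUnion (fun v => isClosed_simplexSet _)
          fun v => hFc _ (hK σ hσ.1 _ (Finset.erase_subset _ _)) (hcard v))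
      (by
        rw [simplexBoundary_eq]
        intro w hw w' hw'
        obtain ⟨v, hv⟩ := Set.mem_iUnion.1 hw
        obtain ⟨v', hv'⟩ := Set.mem_iUnion.1 hw'
        exact hF σ hσ.1 _ (fun v hv => Finset.inf'_le _ hv) _ (Finset.erase_subset _ _) (hcard v)
          _ (Finset.erase_subset _ _) (hcard v') w hv w' hv')
    exact ⟨G, fun _ _ => ⟨hG1, hG2, fun j hj w hw w' hw' =>
      (hG3 w hw w' hw').trans (hε (Finset.le_inf' _ _ hj))⟩⟩
  choose G hG using hG
  let P : (V → ℝ) → Finset V → Prop := fun w σ =>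
    σ ∈ K ∧ σ.card = r + 2 ∧ w ∈ simplexSet σ ∧ w ∉ simplexBoundary σ
  let F' : (V → ℝ) → X := fun w => if h : ∃ σ, P w σ then G h.choose w else F w
  have hlow : ∀ τ : Finset V, τ.card ≤ r + 1 → EqOn F' F (simplexSet τ) := by
    intro τ hτ w hw
    refine dif_neg fun ⟨σ, hσ, hσc, hwσ, hwσ'⟩ => ?_
    have := Finset.card_le_card (subset_of_mem_simplexSet hw hwσ hwσ')
    omega
  have htop : ∀ σ ∈ K, σ.card = r + 2 → EqOn F' (G σ) (simplexSet σ) := by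
    intro σ hσ hσc w hw
    by_cases hwb : w ∈ simplexBoundary σ
    · rw [(hG σ hσ hσc).2.1 hwb]
      rw [simplexBoundary_eq] at hwb
      obtain ⟨v, hv⟩ := Set.mem_iUnion.1 hwb
      exact hlow _ (by rw [Finset.card_erase_of_mem v.2]; omega) hv
    · have hex : ∃ σ, P w σ := ⟨σ, hσ, hσc, hw, hwb⟩
      obtain ⟨-, -, h3, h4⟩ := hex.choose_spec
      have : hex.choose = σ := (subset_of_mem_simplexSet hw h3 h4).antisymm
        (subset_of_mem_simplexSet h3 hw hwb)
      calc F' w = G hex.choose w := dif_pos hex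
        _ = G σ w := by rw [this]
  have hvert : ∀ v, ∀ w ∈ simplexSet {v}, F' w = x v := fun v w hw =>
    (hlow {v} (by simp) hw).trans (hFx v w hw)
  refine ⟨F', hvert, fun σ hσ hσc => ?_, fun σ hσ j hj τ hτ hτc τ' hτ' hτc' w hw w' hw' => ?_⟩
  · obtain hlt | heq := Nat.lt_or_eq_of_le hσc
    · exact (hFc σ hσ (Nat.le_of_lt_succ hlt)).congr (hlow σ (Nat.le_of_lt_succ hlt))
    · exact (hG σ hσ heq).1.congr (htop σ hσ heq)
  · have hnear : ∀ τ ⊆ σ, τ.card ≤ r + 2 → ∀ w ∈ simplexSet τ,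
        ∃ v ∈ σ, edist (F' w) (x v) ≤ ε j := by
      intro τ hτ hτc w hw
      obtain ⟨v, hv⟩ := nonempty_of_mem_simplexSet hw
      have hvτ := single_mem_simplexSet hv
      have hv1 := single_mem_simplexSet (Finset.mem_singleton_self v)
      refine ⟨v, hτ hv, ?_⟩
      rw [← hvert v _ hv1]
      obtain hlt | heq := Nat.lt_or_eq_of_le hτc
      · rw [hlow τ (Nat.le_of_lt_succ hlt) hw, hlow τ (Nat.le_of_lt_succ hlt) hvτ]
        exact (hF σ hσ j hj τ hτ (Nat.le_of_lt_succ hlt) τ hτ (Nat.le_of_lt_succ hlt) _ hw _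
          hvτ).trans (hη' j)
      · have hτK := hK σ hσ τ hτ
        rw [htop τ hτK heq hw, htop τ hτK heq hvτ]
        exact (hG τ hτK heq).2.2 j (fun v hv => hj v (hτ hv)) _ hw _ hvτ
    obtain ⟨v, hv, hwv⟩ := hnear τ hτ hτc w hw
    obtain ⟨v', hv', hwv'⟩ := hnear τ' hτ' hτc' w' hw'
    have hvv' : edist (x v) (x v') ≤ ε j := by
      have hv1 := single_mem_simplexSet (Finset.mem_singleton_self v)
      have hv1' := single_mem_simplexSet (Finset.mem_singleton_self v')
      rw [← hFx v _ hv1, ← hFx v' _ hv1']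
      exact (hF σ hσ j hj _ (Finset.singleton_subset_iff.2 hv) (by simp) _
        (Finset.singleton_subset_iff.2 hv') (by simp) _ hv1 _ hv1').trans (hη' j)
    calc edist (F' w) (F' w') ≤ edist (F' w) (x v) + edist (x v) (x v') + edist (x v') (F' w') :=
          edist_triangle4 _ _ _ _
      _ ≤ ε j + ε j + ε j := by
          rw [edist_comm (x v')]
          gcongr
      _ = 3 * ε j := by ring
      _ ≤ η j := hη j

theorem exists_hasControlledExtension {k : ℕ} {X : Type v} [PseudoMetricSpace X] [CompactSpace X]
    (hC : IsCConn k X) (hLC : IsLCConn k X) {p : ℕ} (hp : p ≤ k + 1) {η : ℕ → ENNReal}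
    (hη : Antitone η) (hη0 : ∀ j, 0 < η j) :
    ∃ θ : ℕ → ENNReal, (∀ j, 0 < θ j) ∧ (∀ j, η j = ⊤ → θ j = ⊤) ∧
      HasControlledExtension (p + 1) θ η X := by
  have := hC.1
  induction p generalizing η with
  | zero => exact ⟨η, hη0, fun _ h => h, hasControlledExtension_one η⟩
  | succ r ih =>
    have hε0 : ∀ j, 0 < η j / 3 := fun j => ENNReal.div_pos (hη0 j).ne' (by simp)
    choose δ hδ0 hδt hδ using fun j => exists_fillsSpheres hC hLC (hε0 j)
    let η' : ℕ → ENNReal := fun j => (Finset.range (j + 1)).inf fun i => min (δ i) (η i / 3)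
    have hη' : ∀ j, η' j ≤ min (δ j) (η j / 3) := fun j =>
      Finset.inf_le (f := fun i => min (δ i) (η i / 3)) (Finset.self_mem_range_succ j)
    have htop : ∀ j, η j = ⊤ → η j / 3 = ⊤ := fun j h => by
      rw [h, ENNReal.top_div_of_ne_top (by simp)]
    obtain ⟨θ, hθ0, hθt, hθ⟩ := ih (by omega) (η := η')
      (fun i j hij => Finset.inf_mono (Finset.range_mono (by omega)))
      (fun j => (Finset.lt_inf_iff ENNReal.zero_lt_top).2 fun i _ => lt_min (hδ0 i) (hε0 i))
    refine ⟨θ, hθ0, fun j hj => hθt j ?_, hθ.succ (ε := fun j => η j / 3) ?_ ?_ ?_ ?_⟩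
    · refine (Finset.inf_eq_top_iff _ _).2 fun i hi => ?_
      have hi' : η i = ⊤ := top_unique (hj ▸ hη (Nat.lt_succ_iff.1 (Finset.mem_range.1 hi)))
      rw [hδt i (htop i hi'), htop i hi', min_self]
    · exact fun i j hij => ENNReal.div_le_div_right (hη hij) 3
    · exact fun j => (hη' j).trans (min_le_right _ _)
    · exact fun j => (ENNReal.mul_div_cancel (by simp) (by simp)).le
    · exact fun j f hf => hδ j r (by omega) f fun a b =>
        (hf a b).trans ((hη' j).trans (min_le_left _ _))

/-- A set is contractible in `X` if there is a homotopy, parametrized by a half line, which starts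
at a constant map and converges uniformly to the inclusion. -/
theorem contractibleIn_of_continuous_nnreal {X : Type*} [PseudoMetricSpace X] {A : Set X}
    (Φ : C(NNReal × A, X)) {x₀ : X} (h0 : ∀ a, Φ (0, a) = x₀)
    (h : ∀ ε > 0, ∃ T₀ : NNReal, ∀ T ≥ T₀, ∀ a, dist (Φ (T, a)) a < ε) : ContractibleIn A := by
  let H : unitInterval × A → X := fun p =>
    if p.1 = 0 then (p.2 : X) else Φ (Real.toNNReal ((p.1 : ℝ)⁻¹ - 1), p.2)
  have hH : Continuous H := by
    refine continuous_iff_continuousAt.2 fun ⟨t, a⟩ => ?_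
    by_cases ht : t = 0
    · subst ht
      refine Metric.tendsto_nhds.2 fun ε hε => ?_
      obtain ⟨T₀, hT₀⟩ := h (ε / 2) (half_pos hε)
      have h1 : ∀ᶠ p : unitInterval × A in nhds (0, a), (p.1 : ℝ) < (T₀ + 1 : ℝ)⁻¹ :=
        (isOpen_lt (by fun_prop) continuous_const).mem_nhds (by
          simp only [Set.mem_ofPred_eq, Set.Icc.coe_zero]
          positivity)
      have h2 : ∀ᶠ p : unitInterval × A in nhds (0, a), dist (p.2 : X) a < ε / 2 :=
        (isOpen_lt (by fun_prop) continuous_const).mem_nhds (by simpa using half_pos hε)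
      filter_upwards [h1, h2] with p hp1 hp2
      have h3 : dist (H p) p.2 < ε / 2 := by
        by_cases hp : p.1 = 0
        · simpa [H, hp] using half_pos hε
        · simp only [H, if_neg hp]
          refine hT₀ _ (NNReal.le_toNNReal_of_coe_le ?_) _
          have hp0 : (0 : ℝ) < p.1 := unitInterval.pos_iff_ne_zero.2 hp
          rw [lt_inv_comm₀ hp0 (by positivity)] at hp1
          linarith
      have h4 : H (0, a) = a := if_pos rfl
      rw [h4]
      linarith [dist_triangle (H p) p.2 a]
    · have h1 : ∀ᶠ p : unitInterval × A in nhds (t, a), p.1 ≠ 0 :=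
        continuous_fst.continuousAt.eventually_ne ht
      have ht' : (t : ℝ) ≠ 0 := fun h => ht (Subtype.ext h)
      have h2 : ContinuousAt (fun p : unitInterval × A =>
          Φ (Real.toNNReal ((p.1 : ℝ)⁻¹ - 1), p.2)) (t, a) := by
        refine Φ.continuous.continuousAt.comp (ContinuousAt.prodMk ?_ continuous_snd.continuousAt)
        refine continuous_real_toNNReal.continuousAt.comp (ContinuousAt.sub ?_ continuousAt_const)
        exact (continuous_subtype_val.comp continuous_fst).continuousAt.inv₀ ht'
      refine h2.congr ?_
      filter_upwards [h1] with p hp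
      simp [H, hp]
  refine ⟨x₀, ⟨⟨⟨H, hH⟩, fun a => if_pos rfl, fun a => ?_⟩⟩⟩
  simp [H, h0]

/-- A locally finite family of nonnegative functions without common zeros defines a map to
barycentric coordinates. Its composition with a map which is continuous on the simplices is
continuous. -/
theorem exists_barycentric_map {Y V : Type*} [TopologicalSpace Y] {W : V → Y → ℝ}
    (hc : ∀ v, Continuous (W v)) (h0 : ∀ v y, 0 ≤ W v y)
    (hlf : LocallyFinite fun v => Function.support (W v)) (hpos : ∀ y, ∃ v, 0 < W v y) :
    ∃ w : Y → V → ℝ,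
      (∀ y (σ : Finset V), (∀ v, 0 < W v y → v ∈ σ) → w y ∈ simplexSet σ) ∧
      (∀ y y', (∀ v, W v y = W v y') → w y = w y') ∧
      ∀ {X : Type*} [TopologicalSpace X] (F : (V → ℝ) → X) (K : Set (Finset V)),
        (∀ σ ∈ K, ContinuousOn F (simplexSet σ)) →
        (∀ y, ∃ σ ∈ K, ∀ v, v ∈ σ ↔ 0 < W v y) → Continuous (F ∘ w) := by
  classical
  have hW : ∀ v y, W v y ≠ 0 → 0 < W v y := fun v y h => (h0 v y).lt_of_ne' h
  have hsupp : ∀ y (σ : Finset V), (∀ v, 0 < W v y → v ∈ σ) →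
      ∑ᶠ v, W v y = ∑ v ∈ σ, W v y := fun y σ hσ =>
    finsum_eq_sum_of_support_subset _ fun v hv => hσ v (hW v y hv)
  have htot : ∀ y, 0 < ∑ᶠ v, W v y := fun y => by
    have hfin : {v | 0 < W v y}.Finite :=
      (hlf.point_finite y).subset fun v (hv : 0 < W v y) => hv.ne'
    rw [hsupp y hfin.toFinset fun v hv => by simpa using hv]
    obtain ⟨v, hv⟩ := hpos y
    exact Finset.sum_pos' (fun v _ => h0 v y) ⟨v, by simpa using hv, hv⟩
  let w : Y → V → ℝ := fun y v => W v y / ∑ᶠ v', W v' y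
  have hwc : Continuous w := continuous_pi fun v =>
    (hc v).div (continuous_finsum hc hlf) fun y => (htot y).ne'
  have hws : ∀ y (σ : Finset V), (∀ v, 0 < W v y → v ∈ σ) → w y ∈ simplexSet σ := by
    refine fun y σ hσ => ⟨fun v => div_nonneg (h0 v y) (htot y).le, fun v hv => ?_, ?_⟩
    · have : W v y = 0 := by
        by_contra h
        exact hv (hσ v (hW v y h))
      simp [w, this]
    · simp only [w]
      rw [← Finset.sum_div, ← hsupp y σ hσ, div_self (htot y).ne']
  refine ⟨w, hws, fun y y' h => by simp only [w, h], fun F K hF hK => ?_⟩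
  refine continuous_iff_continuousAt.2 fun y => ?_
  obtain ⟨U, hU, hUf⟩ := hlf y
  let Q := hUf.toFinset
  let I := {σ // σ ∈ Q.powerset.filter (· ∈ K)}
  have hcov : U ⊆ ⋃ σ : I, w ⁻¹' simplexSet σ.1 := by
    intro z hz
    obtain ⟨σ, hσ, hσz⟩ := hK z
    refine Set.mem_iUnion.2 ⟨⟨σ, Finset.mem_filter.2 ⟨Finset.mem_powerset.2 fun v hv => ?_, hσ⟩⟩,
      hws z σ fun v => (hσz v).2⟩
    simp only [Q, Set.Finite.mem_toFinset]
    exact ⟨z, ((hσz v).1 hv).ne', hz⟩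
  have hcont : ContinuousOn (F ∘ w) (⋃ σ : I, w ⁻¹' simplexSet σ.1) :=
    (locallyFinite_of_finite _).continuousOn_iUnion
      (fun σ => (isClosed_simplexSet _).preimage hwc)
      fun σ => (hF σ.1 (Finset.mem_filter.1 σ.2).2).comp hwc.continuousOn fun _ h => h
  exact (hcont.mono hcov).continuousAt hU

theorem exists_antitone_tolerance {θ : ℕ → ENNReal} (hθ : ∀ j, 0 < θ j) (hθ0 : θ 0 = ⊤) :
    ∃ E : ℕ → ENNReal, Antitone E ∧ (∀ j, 0 < E j) ∧ E 0 = ⊤ ∧ (∀ j, E j + E j ≤ θ j) ∧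
      ∀ j : ℕ, E j ≤ (j : ENNReal)⁻¹ := by
  refine ⟨fun j => min (j : ENNReal)⁻¹ ((Finset.range (j + 1)).inf θ / 2), fun i j hij => ?_,
    fun j => lt_min ?_ (ENNReal.div_pos ?_ (by simp)), ?_, fun j => ?_, fun j => min_le_left _ _⟩
  · refine min_le_min (ENNReal.inv_le_inv.2 (by exact_mod_cast hij)) ?_
    exact ENNReal.div_le_div_right (Finset.inf_mono (Finset.range_mono (by omega))) 2
  · simp
  · exact ((Finset.lt_inf_iff ENNReal.zero_lt_top).2 fun i _ => hθ i).ne'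
  · simp [hθ0, ENNReal.top_div_of_ne_top]
  · calc _ ≤ (Finset.range (j + 1)).inf θ / 2 + (Finset.range (j + 1)).inf θ / 2 :=
          add_le_add (min_le_right _ _) (min_le_right _ _)
      _ = (Finset.range (j + 1)).inf θ := ENNReal.add_halves _
      _ ≤ θ j := Finset.inf_le (Finset.self_mem_range_succ j)

theorem IsZeroDimIn.exists_family {X : Type*} [PseudoMetricSpace X] [Nonempty X] {Z : Set X}
    (hZ : IsZeroDimIn Z) {ε : ENNReal} (hε : 0 < ε) :
    ∃ (S : Finset X) (g : X → C(X, ℝ)), (∀ s x, 0 ≤ g s x) ∧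
      (∀ s s' x, 0 < g s x → 0 < g s' x → s = s') ∧ (∀ s x, 0 < g s x → edist s x ≤ ε) ∧
      (∀ s x, 0 < g s x → s ∈ S) ∧ (∀ x ∈ Z, ∃ s, 0 < g s x) ∧
      (ε = ⊤ → ∀ s x x', g s x = g s x') := by
  classical
  obtain rfl | hε' := eq_or_ne ε ⊤
  · let x₀ : X := Classical.arbitrary X
    have hg : ∀ s, (0 : ℝ) < (if s = x₀ then 1 else 0) → s = x₀ := fun s h => by
      by_contra hs
      simp [hs] at h
    refine ⟨{x₀}, fun s => ContinuousMap.const X (if s = x₀ then 1 else 0), fun s x => ?_,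
      fun s s' x h h' => (hg s h).trans (hg s' h').symm, fun _ _ _ => le_top,
      fun s x h => Finset.mem_singleton.2 (hg s h), fun x _ => ⟨x₀, by simp⟩, fun _ _ _ _ => rfl⟩
    simp only [ContinuousMap.const_apply]
    split_ifs <;> norm_num
  · obtain ⟨S, g, h1, h2, h3, h4, h5⟩ := hZ ε.toReal (ENNReal.toReal_pos hε.ne' hε')
    refine ⟨S, g, h1, h2, fun s x h => ?_, h4, h5, fun h => absurd h hε'⟩
    rw [edist_comm, edist_dist, ← ENNReal.ofReal_toReal hε']
    exact ENNReal.ofReal_le_ofReal (h3 s x h).le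

/-- A tent function of time, positive exactly for `b - k - 1 < T < b + 1`. -/
noncomputable def timeTent (k b : ℕ) (T : NNReal) : ℝ :=
  max 0 (min ((T : ℝ) - b + k + 1) (b + 1 - T))

theorem timeTent_nonneg (k b : ℕ) (T : NNReal) : 0 ≤ timeTent k b T := le_max_left _ _

theorem timeTent_pos_iff {k b : ℕ} {T : NNReal} :
    0 < timeTent k b T ↔ (b : ℝ) < T + k + 1 ∧ (T : ℝ) < b + 1 := by
  simp only [timeTent, lt_max_iff, lt_irrefl, false_or, lt_min_iff]
  constructor <;> rintro ⟨h1, h2⟩ <;> constructor <;> linarith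

theorem continuous_timeTent (k b : ℕ) : Continuous (timeTent k b) := by
  unfold timeTent
  fun_prop

theorem contractibleIn_iUnion_of_isZeroDimIn {k : ℕ} {X : Type u} [MetricSpace X] [CompactSpace X]
    (hC : IsCConn k X) (hLC : IsLCConn k X) {Z : Fin (k + 1) → Set X}
    (hZ : ∀ c, IsZeroDimIn (Z c)) : ContractibleIn (⋃ c, Z c) := by
  classical
  have := hC.1
  have hη : Antitone fun j : ℕ => (j : ENNReal)⁻¹ := fun i j hij =>
    ENNReal.inv_le_inv.2 (by exact_mod_cast hij)
  obtain ⟨θ, hθ0, hθt, hext⟩ :=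
    exists_hasControlledExtension hC hLC le_rfl hη (by simp)
  obtain ⟨E, hE, hE0, hEt, hEθ, hEi⟩ := exists_antitone_tolerance hθ0 (hθt 0 (by simp))
  choose S g hg0 hgd hge hgS hgZ hgt using fun b : ℕ =>
    (hZ (Fin.ofNat (k + 1) b)).exists_family (hE0 (b - k))
  let A : Set X := ⋃ c, Z c
  let K : Set (Finset (ℕ × X)) := {σ | ∃ a : X, ∀ v ∈ σ, 0 < g v.1 v.2 a}
  obtain ⟨F, hFv, hFc, hFη⟩ := hext (ℕ × X) (fun v => v.1 - k) K Prod.snd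
    (fun σ ⟨a, ha⟩ τ hτ => ⟨a, fun v hv => ha v (hτ hv)⟩) (by
      rintro σ ⟨a, ha⟩ j hj v hv v' hv'
      calc edist v.2 v'.2 ≤ edist v.2 a + edist v'.2 a := edist_triangle_right _ _ _
        _ ≤ E j + E j := add_le_add ((hge _ _ _ (ha v hv)).trans (hE (hj v hv)))
            ((hge _ _ _ (ha v' hv')).trans (hE (hj v' hv')))
        _ ≤ θ j := hEθ j)
  let W : ℕ × X → NNReal × A → ℝ := fun v y => timeTent k v.1 y.1 * g v.1 v.2 y.2
  have hW : ∀ v y, 0 < W v y ↔ 0 < timeTent k v.1 y.1 ∧ 0 < g v.1 v.2 y.2 := fun v y =>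
    ⟨fun h => ⟨(timeTent_nonneg _ _ _).lt_of_ne' (left_ne_zero_of_mul h.ne'),
      (hg0 _ _ _).lt_of_ne' (right_ne_zero_of_mul h.ne')⟩, fun h => mul_pos h.1 h.2⟩
  have hW0 : ∀ v y, 0 ≤ W v y := fun v y => mul_nonneg (timeTent_nonneg _ _ _) (hg0 _ _ _)
  have hWc : ∀ v, Continuous (W v) := fun v =>
    ((continuous_timeTent k v.1).comp continuous_fst).mul
      ((g v.1 v.2).continuous.comp (continuous_subtype_val.comp continuous_snd))
  have hfin : ∀ N : ℕ, {v : ℕ × X | v.1 < N ∧ v.2 ∈ S v.1}.Finite := fun N =>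
    ((Finset.range N).sigma S).finite_toSet.image (fun v => (v.1, v.2)) |>.subset fun v hv =>
      ⟨⟨v.1, v.2⟩, by simpa using hv, rfl⟩
  have hlf : LocallyFinite fun v => Function.support (W v) := by
    intro y
    obtain ⟨N, hN⟩ := exists_nat_gt ((y.1 : ℝ) + 1 + k + 1)
    refine ⟨{y' | (y'.1 : ℝ) < y.1 + 1}, (isOpen_lt (by fun_prop) continuous_const).mem_nhds
      (by simp), (hfin N).subset ?_⟩
    rintro v ⟨y', hv, hy'⟩
    have hv' := (hW v y').1 ((hW0 v y').lt_of_ne' hv)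
    have hy'' : (y'.1 : ℝ) < y.1 + 1 := hy'
    refine ⟨?_, hgS _ _ _ hv'.2⟩
    have h1 := (timeTent_pos_iff.1 hv'.1).1
    have h2 : (v.1 : ℝ) < N := by linarith
    exact_mod_cast h2
  have hpos : ∀ y, ∃ v, 0 < W v y := by
    rintro ⟨T, a, ha⟩
    obtain ⟨c, hc⟩ := Set.mem_iUnion.1 ha
    obtain ⟨b, hb1, hb2, hbc⟩ : ∃ b : ℕ, ⌊T⌋₊ ≤ b ∧ b ≤ ⌊T⌋₊ + k ∧ Fin.ofNat (k + 1) b = c := by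
      have hlt := Nat.mod_lt (c + (k + 1) * ⌊T⌋₊ - ⌊T⌋₊) (Nat.add_one_pos k)
      have hle : ⌊T⌋₊ ≤ (k + 1) * ⌊T⌋₊ := Nat.le_mul_of_pos_left _ k.succ_pos
      refine ⟨⌊T⌋₊ + (c + (k + 1) * ⌊T⌋₊ - ⌊T⌋₊) % (k + 1), by omega, by omega, Fin.ext ?_⟩
      rw [Fin.val_ofNat, Nat.add_mod_mod, Nat.add_sub_cancel' (by omega), Nat.add_mul_mod_self_left,
        Nat.mod_eq_of_lt c.2]
    obtain ⟨s, hs⟩ := hgZ b a (hbc ▸ hc)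
    refine ⟨(b, s), (hW _ _).2 ⟨timeTent_pos_iff.2 ⟨?_, ?_⟩, hs⟩⟩
    · have h1 : (⌊T⌋₊ : ℝ) ≤ T := by exact_mod_cast Nat.floor_le (zero_le : 0 ≤ T)
      have h2 : (b : ℝ) ≤ ⌊T⌋₊ + k := by exact_mod_cast hb2
      dsimp only
      linarith
    · have h1 : (T : ℝ) < ⌊T⌋₊ + 1 := by exact_mod_cast Nat.lt_floor_add_one T
      have h2 : (⌊T⌋₊ : ℝ) ≤ b := by exact_mod_cast hb1
      dsimp only
      linarith
  have hfloor : ∀ v y, 0 < W v y → ⌊y.1⌋₊ ≤ v.1 ∧ v.1 ≤ ⌊y.1⌋₊ + (k + 1) := by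
    intro v y hv
    obtain ⟨h1, h2⟩ := timeTent_pos_iff.1 ((hW v y).1 hv).1
    have h3 : (⌊y.1⌋₊ : ℝ) ≤ y.1 := by exact_mod_cast Nat.floor_le (zero_le : 0 ≤ y.1)
    have h4 : (y.1 : ℝ) < ⌊y.1⌋₊ + 1 := by exact_mod_cast Nat.lt_floor_add_one y.1
    have h5 : (⌊y.1⌋₊ : ℝ) < v.1 + 1 := by linarith
    have h6 : (v.1 : ℝ) < ⌊y.1⌋₊ + (k + 1) + 1 := by linarith
    norm_cast at h5 h6
    omega
  have hsupp : ∀ y, ∃ σ ∈ K, σ.card ≤ k + 1 + 1 ∧ ∀ v, v ∈ σ ↔ 0 < W v y := by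
    intro y
    have hf : {v | 0 < W v y}.Finite := (hlf.point_finite y).subset fun v hv => hv.ne'
    have hmem : ∀ v, v ∈ hf.toFinset ↔ 0 < W v y := fun v => by simp
    refine ⟨hf.toFinset, ⟨y.2, fun v hv => ((hW v y).1 ((hmem v).1 hv)).2⟩, ?_, hmem⟩
    calc hf.toFinset.card ≤ (Finset.Icc ⌊y.1⌋₊ (⌊y.1⌋₊ + (k + 1))).card := by
          refine Finset.card_le_card_of_injOn Prod.fst
            (fun v hv => Finset.mem_Icc.2 (hfloor v y ((hmem v).1 hv))) ?_
          rintro ⟨b, s⟩ hv ⟨b', s'⟩ hv' h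
          obtain rfl : b = b' := h
          have h1 := ((hW _ y).1 ((hmem _).1 hv)).2
          have h2 := ((hW _ y).1 ((hmem _).1 hv')).2
          rw [hgd b s s' y.2 h1 h2]
      _ ≤ k + 1 + 1 := by simp; omega
  obtain ⟨w, hws, hweq, hwc⟩ := exists_barycentric_map hWc hW0 hlf hpos
  have hcont : Continuous (F ∘ w) := hwc F {σ ∈ K | σ.card ≤ k + 1 + 1}
    (fun σ hσ => hFc σ hσ.1 hσ.2) fun y => by
      obtain ⟨σ, h1, h2, h3⟩ := hsupp y
      exact ⟨σ, ⟨h1, h2⟩, h3⟩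
  have hclose : ∀ y : NNReal × A, edist (F (w y)) y.2 ≤
      ((⌊y.1⌋₊ - k : ℕ) : ENNReal)⁻¹ + ((⌊y.1⌋₊ - k : ℕ) : ENNReal)⁻¹ := by
    intro y
    obtain ⟨σ, hσK, hσc, hσ⟩ := hsupp y
    obtain ⟨v, hv⟩ := hpos y
    have hj : ∀ v ∈ σ, ⌊y.1⌋₊ - k ≤ v.1 - k := fun v hv =>
      Nat.sub_le_sub_right (hfloor v y ((hσ v).1 hv)).1 k
    have hvσ := (hσ v).2 hv
    refine (edist_triangle _ v.2 _).trans (add_le_add ?_ ?_)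
    · rw [← hFv v _ (single_mem_simplexSet (Finset.mem_singleton_self v))]
      exact hFη σ hσK _ hj σ subset_rfl hσc {v} (by simpa using hvσ) (by simp) _
        (hws y σ fun v' => (hσ v').2) _ (single_mem_simplexSet (Finset.mem_singleton_self v))
    · exact (hge _ _ _ ((hW v y).1 hv).2).trans ((hE (hj v hvσ)).trans (hEi _))
  obtain ⟨x₀, hx₀⟩ : ∃ x₀, ∀ a, F (w (0, a)) = x₀ := by
    by_cases hA : Nonempty A
    · obtain ⟨a₀⟩ := hA
      refine ⟨F (w (0, a₀)), fun a => congrArg F (hweq _ _ fun v => ?_)⟩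
      by_cases hv : 0 < timeTent k v.1 0
      · have h1 : v.1 < k + 1 := by
          have := (timeTent_pos_iff.1 hv).1
          rw [NNReal.coe_zero, zero_add] at this
          exact_mod_cast this
        have h2 : v.1 - k = 0 := by omega
        simp only [W, hgt v.1 (by rw [h2, hEt]) v.2 a a₀]
      · simp only [W, le_antisymm (not_lt.1 hv) (timeTent_nonneg _ _ _), zero_mul]
    · exact ⟨this.some, fun a => absurd ⟨a⟩ hA⟩
  refine contractibleIn_of_continuous_nnreal ⟨F ∘ w, hcont⟩ hx₀ fun ε hε => ?_
  obtain ⟨N, hN⟩ := ENNReal.exists_inv_nat_lt (ENNReal.ofReal_pos.2 (half_pos hε)).ne'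
  refine ⟨(N + k : ℕ), fun T hT a => ?_⟩
  have hN' : N ≤ ⌊T⌋₊ - k := by
    have := Nat.le_floor hT
    omega
  have h1 : ((⌊T⌋₊ - k : ℕ) : ENNReal)⁻¹ < ENNReal.ofReal (ε / 2) := (hη hN').trans_lt hN
  rw [← edist_lt_ofReal]
  calc edist (F (w (T, a))) a ≤ _ := hclose (T, a)
    _ < ENNReal.ofReal (ε / 2) + ENNReal.ofReal (ε / 2) := ENNReal.add_lt_add h1 h1
    _ = ENNReal.ofReal ε := by rw [← ENNReal.ofReal_add (by positivity) (by positivity), add_halves]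

/-- For `k ≥ 0` and a compact metric space `X` that is `k`-connected
and locally `k`-connected, `cat_g X ≤ dim X / (k+1)`, i.e. `(k+1) · cat_g X ≤ dim X`,
where `dim` is the covering dimension. -/
theorem catg_le_dim_div_of_connected (k : ℕ) (X : Type u) [MetricSpace X]
    [CompactSpace X] (hC : IsCConn k X) (hLC : IsLCConn k X) :
    catg X * (k + 1 : ℕ∞) ≤ coveringDim X := by
  have := hC.1
  obtain hX | hX := eq_or_ne (coveringDim X) ⊤
  · exact hX ▸ le_top
  obtain ⟨n, hn⟩ := ENat.ne_top_iff_exists.1 hX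
  obtain ⟨Z, hZ, hcov⟩ := CoverDimLE.exists_isZeroDimIn (coverDimLE_of_coveringDim_eq hn.symm)
  have hcat : catg X ≤ (n / (k + 1) : ℕ) := by
    refine sInf_le ⟨n / (k + 1), rfl, fun b => ⋃ c : Fin (k + 1), Z (b * (k + 1) + c), ?_, fun b =>
      contractibleIn_iUnion_of_isZeroDimIn hC hLC fun c => hZ _⟩
    refine Set.eq_univ_of_forall fun x => ?_
    obtain ⟨i, hi, hx⟩ := hcov x
    refine Set.mem_iUnion.2 ⟨⟨i / (k + 1), Nat.lt_succ_of_le (Nat.div_le_div_right hi)⟩,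
      Set.mem_iUnion.2 ⟨⟨i % (k + 1), Nat.mod_lt _ k.succ_pos⟩, ?_⟩⟩
    simpa only [Nat.div_add_mod'] using hx
  calc catg X * (k + 1 : ℕ∞) ≤ (n / (k + 1) : ℕ) * (k + 1 : ℕ∞) := mul_le_mul_left hcat _
    _ ≤ n := by exact_mod_cast Nat.div_mul_le_self n (k + 1)
    _ = coveringDim X := hn
end

section
/- (Grossman–Whitehead Theorem) For a k-connected finite CW complex X, the Lusternik–Schnirelmann category satisfies cat X ≤ dim X / (k+1). -/
open Set Metric

/-- The (classical) Lusternik–Schnirelmann category `cat X`: the smallest `m` such that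
`X` is the union of `m+1` *open* subsets, each contractible in `X` (`⊤` if no such
`m` exists). -/
noncomputable def lsCat (X : Type*) [TopologicalSpace X] : ℕ∞ :=
  sInf {N : ℕ∞ | ∃ k : ℕ, N = k ∧ ∃ A : Fin (k + 1) → Set X,
    (∀ i, IsOpen (A i)) ∧ (⋃ i, A i) = Set.univ ∧ ∀ i, ContractibleIn (A i)}

/-- A structure of a finite CW complex of dimension at most `dim` on a (Hausdorff)
space `X`: finitely many cells in each dimension `n ≤ dim`, given by characteristic
maps on closed `n`-balls which are injective on the open balls, whose open cells
partition `X`, and whose boundary spheres are mapped into cells of lower dimension.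
(For a finite complex the weak-topology axiom is automatic.) -/
structure FiniteCWStructure (X : Type*) [TopologicalSpace X] where
  /-- dimension bound for the complex -/
  dim : ℕ
  /-- the (finite) number of `n`-cells -/
  cells : ℕ → ℕ
  cells_eq_zero : ∀ n, dim < n → cells n = 0
  /-- characteristic maps of the cells -/
  attach : ∀ n, Fin (cells n) → C(Metric.closedBall (0 : EuclideanSpace ℝ (Fin n)) 1, X)
  attach_injOn : ∀ n i, Set.InjOn (attach n i)
    {x | ‖(x : EuclideanSpace ℝ (Fin n))‖ < 1}
  openCells_disjoint : ∀ (n : ℕ) (i : Fin (cells n)) (m : ℕ) (j : Fin (cells m)),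
    (⟨n, i⟩ : Σ n, Fin (cells n)) ≠ ⟨m, j⟩ →
      Disjoint (attach n i '' {x | ‖(x : EuclideanSpace ℝ (Fin n))‖ < 1})
        (attach m j '' {x | ‖(x : EuclideanSpace ℝ (Fin m))‖ < 1})
  openCells_cover : (⋃ (n) (i), attach n i '' {x | ‖(x : EuclideanSpace ℝ (Fin n))‖ < 1})
    = Set.univ
  sphere_mapsTo : ∀ (n : ℕ) (i : Fin (cells n))
    (x : Metric.closedBall (0 : EuclideanSpace ℝ (Fin n)) 1),
      ‖(x : EuclideanSpace ℝ (Fin n))‖ = 1 →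
        attach n i x ∈ ⋃ (m : ℕ) (_ : m < n) (j : Fin (cells m)), Set.range (attach m j)

namespace GrossmanWhitehead

open scoped unitInterval Topology

/-! ### Squeezing the real line towards the integers -/

/-- The set of integers inside the real line. -/
abbrev integers : Set ℝ := Set.range ((↑) : ℤ → ℝ)

/-- Clamp a real number to the unit interval. -/
noncomputable def clamp (t : ℝ) : I := projIcc 0 1 zero_le_one t

lemma continuous_clamp : Continuous clamp :=
  continuous_projIcc (h := zero_le_one)

lemma clamp_of_nonpos {t : ℝ} (h : t ≤ 0) : clamp t = 0 := projIcc_of_le_left _ h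

lemma clamp_of_one_le {t : ℝ} (h : 1 ≤ t) : clamp t = 1 := projIcc_of_right_le _ h

lemma coe_clamp_of_mem {t : ℝ} (h0 : 0 ≤ t) (h1 : t ≤ 1) : (clamp t : ℝ) = t := by
  rw [clamp, projIcc_of_mem zero_le_one ⟨h0, h1⟩]

lemma clamp_coe (t : I) : clamp t = t := projIcc_val _ t

/-- A map of the line which preserves every interval `[m, m + 1]` and collapses the
`a`-neighbourhood of each integer to that integer. -/
noncomputable def squeeze (a u : ℝ) : ℝ :=
  u + ((clamp ((Int.fract u - a) / (1 - 2 * a)) : ℝ) - Int.fract u)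

lemma squeeze_eq (a u : ℝ) :
    squeeze a u = ⌊u⌋ + (clamp ((Int.fract u - a) / (1 - 2 * a)) : ℝ) := by
  have := Int.floor_add_fract u
  unfold squeeze
  linarith

lemma continuous_squeeze {a : ℝ} (ha0 : 0 ≤ a) (ha : a < 1 / 2) : Continuous (squeeze a) := by
  have h : Continuous fun w : ℝ => (clamp ((w - a) / (1 - 2 * a)) : ℝ) - w := by
    have := continuous_clamp
    fun_prop
  refine continuous_id.add (h.continuousOn.comp_fract'' ?_)
  have hpos : 0 < 1 - 2 * a := by linarith
  rw [clamp_of_nonpos (div_nonpos_of_nonpos_of_nonneg (by linarith) hpos.le),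
    clamp_of_one_le ((one_le_div hpos).2 (by linarith))]
  simp

lemma squeeze_of_fract_le {a u : ℝ} (ha : a < 1 / 2) (h : Int.fract u ≤ a) : squeeze a u = ⌊u⌋ := by
  rw [squeeze_eq, clamp_of_nonpos
    (div_nonpos_of_nonpos_of_nonneg (by linarith) (by linarith))]
  simp

lemma squeeze_of_le_fract {a u : ℝ} (ha : a < 1 / 2) (h : 1 - a ≤ Int.fract u) :
    squeeze a u = ⌊u⌋ + 1 := by
  rw [squeeze_eq, clamp_of_one_le ((one_le_div (by linarith)).2 (by linarith))]
  simp

lemma squeeze_intCast {a : ℝ} (ha0 : 0 ≤ a) (ha : a < 1 / 2) (m : ℤ) : squeeze a m = m := by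
  rw [squeeze_of_fract_le ha (by simpa)]
  simp

lemma fract_mem_of_squeeze_notMem {a u : ℝ} (ha : a < 1 / 2) (h : squeeze a u ∉ integers) :
    a < Int.fract u ∧ Int.fract u < 1 - a := by
  constructor <;> by_contra! h'
  · exact h ⟨⌊u⌋, (squeeze_of_fract_le ha h').symm⟩
  · exact h ⟨⌊u⌋ + 1, by rw [squeeze_of_le_fract ha h']; push_cast; rfl⟩

lemma abs_squeeze_sub_le (a u : ℝ) : |squeeze a u - u| ≤ 1 := by
  have h0 := Int.fract_nonneg u
  have h1 := (Int.fract_lt_one u).le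
  have h2 := (clamp ((Int.fract u - a) / (1 - 2 * a))).2
  unfold squeeze
  rw [abs_le]
  constructor <;> linarith [h2.1, h2.2]

/-! ### The integral grid in `ℝⁿ` -/

variable {n : ℕ}

open Classical in
/-- The set of non-integral coordinates of a vector. -/
noncomputable def nonint (x : Fin n → ℝ) : Finset (Fin n) :=
  Finset.univ.filter fun i => x i ∉ integers

lemma mem_nonint {x : Fin n → ℝ} {i : Fin n} : i ∈ nonint x ↔ x i ∉ integers := by
  simp [nonint]

lemma card_nonint_le_iff {x : Fin n → ℝ} {r : ℕ} :
    (nonint x).card ≤ r ↔ ∃ S : Finset (Fin n), S.card ≤ r ∧ ∀ i, i ∉ S → x i ∈ integers := by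
  constructor
  · exact fun h => ⟨_, h, fun i hi => by simpa [mem_nonint] using hi⟩
  · rintro ⟨S, hS, h⟩
    refine (Finset.card_le_card fun i hi => ?_).trans hS
    by_contra h'
    exact mem_nonint.1 hi (h i h')

lemma isClosed_skeleton (n r : ℕ) : IsClosed {x : Fin n → ℝ | (nonint x).card ≤ r} := by
  have : {x : Fin n → ℝ | (nonint x).card ≤ r} =
      ⋃ S ∈ {S : Finset (Fin n) | S.card ≤ r}, ⋂ i, ⋂ (_ : i ∉ S), {x | x i ∈ integers} := by
    ext x
    simp [card_nonint_le_iff]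
  rw [this]
  refine (Set.toFinite _).isClosed_biUnion fun S _ => isClosed_iInter fun i =>
    isClosed_iInter fun _ => ?_
  exact (Int.isClosedEmbedding_coe_real.isClosed_range).preimage (continuous_apply i)

/-- Coordinatewise squeezing. -/
noncomputable def squeezeMap (n : ℕ) {a : ℝ} (ha0 : 0 ≤ a) (ha : a < 1 / 2) :
    C(Fin n → ℝ, Fin n → ℝ) where
  toFun x i := squeeze a (x i)
  continuous_toFun := continuous_pi fun i => (continuous_squeeze ha0 ha).comp (continuous_apply i)

section

variable {a : ℝ} (ha0 : 0 ≤ a) (ha : a < 1 / 2)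

@[simp]
lemma squeezeMap_apply (x : Fin n → ℝ) (i : Fin n) :
    squeezeMap n ha0 ha x i = squeeze a (x i) := rfl

lemma nonint_squeezeMap_subset (x : Fin n → ℝ) : nonint (squeezeMap n ha0 ha x) ⊆ nonint x := by
  intro i hi
  rw [mem_nonint] at hi ⊢
  rintro ⟨m, hm⟩
  exact hi ⟨m, by rw [squeezeMap_apply, ← hm, squeeze_intCast ha0 ha]⟩

lemma dist_squeezeMap_le (x : Fin n → ℝ) : dist (squeezeMap n ha0 ha x) x ≤ 1 :=
  (dist_pi_le_iff zero_le_one).2 fun i => by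
    simpa [Real.dist_eq] using abs_squeeze_sub_le a (x i)

/-- Near the `r`-skeleton of the grid, squeezing lands in the `r`-skeleton. -/
lemma exists_cutoff (hpos : 0 < a) (r : ℕ) : ∃ χ : C(Fin n → ℝ, I),
    (∀ x, (nonint x).card ≤ r → χ x = 1) ∧
    ∀ x, r < (nonint (squeezeMap n ha0 ha x)).card → χ x = 0 := by
  let W : Set ℝ := ⋃ m : ℤ, Metric.ball (m : ℝ) a
  have hWo : IsOpen W := isOpen_iUnion fun _ => isOpen_ball
  have hWs : ∀ u ∈ W, squeeze a u ∈ integers := by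
    intro u hu
    by_contra h
    obtain ⟨h1, h2⟩ := fract_mem_of_squeeze_notMem ha h
    obtain ⟨m, hm⟩ := mem_iUnion.1 hu
    rw [mem_ball, Real.dist_eq, abs_lt] at hm
    have hfl := Int.floor_add_fract u
    have h3 : ((⌊u⌋ : ℤ) : ℝ) < (m : ℝ) := by linarith
    have h4 : (m : ℝ) < ((⌊u⌋ + 1 : ℤ) : ℝ) := by push_cast; linarith
    rw [Int.cast_lt] at h3 h4
    omega
  let V : Set (Fin n → ℝ) :=
    ⋃ S ∈ {S : Finset (Fin n) | S.card ≤ r}, ⋂ i, ⋂ (_ : i ∉ S), {x | x i ∈ W}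
  have hVo : IsOpen V := isOpen_biUnion fun S _ => isOpen_iInter_of_finite fun i =>
    isOpen_iInter_of_finite fun _ => hWo.preimage (continuous_apply i)
  obtain ⟨f, hf0, hf1, hf⟩ := exists_continuous_zero_one_of_isClosed hVo.isClosed_compl
    (isClosed_skeleton n r) (by
      rw [Set.disjoint_left]
      intro x hx hx'
      obtain ⟨S, hS, h⟩ := card_nonint_le_iff.1 hx'
      refine hx (mem_biUnion hS (mem_iInter₂.2 fun i hi => ?_))
      obtain ⟨m, hm⟩ := h i hi
      exact mem_iUnion.2 ⟨m, by simpa [hm] using hpos⟩)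
  refine ⟨⟨fun x => ⟨f x, hf x⟩, by fun_prop⟩, fun x hx => Subtype.ext (hf1 hx),
    fun x hx => Subtype.ext (hf0 fun hxV => ?_)⟩
  obtain ⟨S, hS, h⟩ := mem_iUnion₂.1 hxV
  exact hx.not_ge (card_nonint_le_iff.2 ⟨S, hS, fun i hi => hWs _ (mem_iInter₂.1 h i hi)⟩)

end

/-- The closed cell of the integral grid with base vertex `v` and directions `S`. -/
def gridCell (S : Finset (Fin n)) (v : Fin n → ℤ) : Set (Fin n → ℝ) :=
  {x | ∀ i, (v i : ℝ) ≤ x i ∧ x i ≤ v i + if i ∈ S then 1 else 0}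

lemma isClosed_gridCell (S : Finset (Fin n)) (v : Fin n → ℤ) : IsClosed (gridCell S v) := by
  have : gridCell S v = Icc (fun i => (v i : ℝ)) fun i => v i + if i ∈ S then 1 else 0 := by
    ext x
    simp [gridCell, Pi.le_def, forall_and]
  rw [this]
  exact isClosed_Icc

lemma mem_gridCell_floor (x : Fin n → ℝ) : x ∈ gridCell (nonint x) fun i => ⌊x i⌋ := by
  intro i
  refine ⟨Int.floor_le _, ?_⟩
  split_ifs with h
  · exact (Int.lt_floor_add_one _).le
  · obtain ⟨m, hm⟩ : x i ∈ integers := by simpa [mem_nonint] using h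
    simp [← hm]

lemma nonint_subset_of_mem_gridCell {S : Finset (Fin n)} {v : Fin n → ℤ} {x : Fin n → ℝ}
    (hx : x ∈ gridCell S v) : nonint x ⊆ S := by
  intro i hi
  by_contra h
  have := hx i
  simp only [h, if_false, add_zero] at this
  exact mem_nonint.1 hi ⟨v i, le_antisymm this.1 this.2⟩

lemma floor_eq_of_mem_gridCell {S : Finset (Fin n)} {v : Fin n → ℤ} {x : Fin n → ℝ}
    (hx : x ∈ gridCell S v) (h : nonint x = S) : (fun i => ⌊x i⌋) = v := by
  funext i
  have h1 := hx i
  rw [Int.floor_eq_iff]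
  refine ⟨h1.1, ?_⟩
  split_ifs at h1 with hi
  · refine lt_of_le_of_ne h1.2 fun h' => ?_
    rw [← h] at hi
    exact mem_nonint.1 hi ⟨v i + 1, by rw [h']; push_cast; rfl⟩
  · linarith [h1.2]

lemma dist_le_of_mem_gridCell {S : Finset (Fin n)} {v : Fin n → ℤ} {x y : Fin n → ℝ}
    (hx : x ∈ gridCell S v) (hy : y ∈ gridCell S v) : dist x y ≤ 1 :=
  (dist_pi_le_iff zero_le_one).2 fun i => by
    have h1 := hx i
    have h2 := hy i
    rw [Real.dist_eq, abs_le]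
    split_ifs at h1 h2 <;> constructor <;> linarith

lemma locallyFinite_gridCell :
    LocallyFinite fun c : Finset (Fin n) × (Fin n → ℤ) => gridCell c.1 c.2 := by
  intro x
  refine ⟨ball x 1, ball_mem_nhds _ one_pos, ?_⟩
  refine (Set.toFinite ((Set.univ : Set (Finset (Fin n))) ×ˢ
    Icc (fun i => ⌊x i⌋ - 3) fun i => ⌊x i⌋ + 3)).subset ?_
  rintro ⟨S, v⟩ ⟨y, hy, hyx⟩
  refine ⟨mem_univ _, ?_⟩
  have key : ∀ i, ⌊x i⌋ - 3 ≤ v i ∧ v i ≤ ⌊x i⌋ + 3 := by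
    intro i
    have h1 := hy i
    have h2 : dist (y i) (x i) < 1 := (dist_le_pi_dist y x i).trans_lt hyx
    rw [Real.dist_eq, abs_lt] at h2
    have h3 := Int.floor_le (x i)
    have h4 := Int.lt_floor_add_one (x i)
    have h5 : (v i : ℝ) < ((⌊x i⌋ + 3 : ℤ) : ℝ) := by push_cast; linarith
    have h6 : ((⌊x i⌋ - 3 : ℤ) : ℝ) < (v i : ℝ) := by
      push_cast
      split_ifs at h1 <;> linarith [h1.2]
    rw [Int.cast_lt] at h5 h6
    omega
  exact ⟨fun i => (key i).1, fun i => (key i).2⟩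

/-! ### Controlled homotopies -/

variable {Y : Type*} [TopologicalSpace Y]

/-- A contraction of `B` to the point `y₀` inside `B`, keeping `y₀` fixed. -/
structure Contraction (B : Set Y) (y₀ : Y) where
  /-- the homotopy, only meaningful on `B × I` -/
  toFun : Y × I → Y
  continuousOn : ContinuousOn toFun (B ×ˢ univ)
  apply_zero : ∀ y ∈ B, toFun (y, 0) = y
  apply_one : ∀ y ∈ B, toFun (y, 1) = y₀
  apply_base : ∀ t, toFun (y₀, t) = y₀
  base_mem : y₀ ∈ B
  mapsTo : ∀ y ∈ B, ∀ t, toFun (y, t) ∈ B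

/-- `g` and `g'` are homotopic through a homotopy which stays in `B` at all points `x` such that
`g₀` maps the closed ball of radius `R` around `x` into `B`. -/
def ControlledHomotopic {E : Type*} [PseudoMetricSpace E] (B : Set Y) (g₀ : C(E, Y)) (R : ℝ)
    (g g' : C(E, Y)) : Prop :=
  ∃ F : g.Homotopy g', ∀ x, (∀ z, dist z x ≤ R → g₀ z ∈ B) → ∀ t, F (t, x) ∈ B

namespace ControlledHomotopic

variable {E : Type*} [PseudoMetricSpace E] {B : Set Y} {g₀ g g' g'' : C(E, Y)} {R R' : ℝ}

lemma refl (hR : 0 ≤ R) : ControlledHomotopic B g R g g :=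
  ⟨.refl g, fun x h _ => h x (by simpa using hR)⟩

lemma trans (h : ControlledHomotopic B g₀ R g g') (h' : ControlledHomotopic B g₀ R g' g'') :
    ControlledHomotopic B g₀ R g g'' := by
  obtain ⟨F, hF⟩ := h
  obtain ⟨F', hF'⟩ := h'
  refine ⟨F.trans F', fun x hx t => ?_⟩
  rw [ContinuousMap.Homotopy.trans_apply]
  split_ifs
  · exact hF x hx _
  · exact hF' x hx _

lemma mono (h : ControlledHomotopic B g₀ R g g') (hR : R ≤ R') :
    ControlledHomotopic B g₀ R' g g' := by
  obtain ⟨F, hF⟩ := h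
  exact ⟨F, fun x hx => hF x fun z hz => hx z (hz.trans hR)⟩

lemma comp (h : ControlledHomotopic B g R g g') (h' : ControlledHomotopic B g' R' g' g'')
    (hR' : 0 ≤ R') : ControlledHomotopic B g (R + R') g g'' := by
  refine (h.mono (by linarith)).trans ?_
  obtain ⟨F, hF⟩ := h
  obtain ⟨F', hF'⟩ := h'
  refine ⟨F', fun x hx => hF' x fun z hz => ?_⟩
  rw [← F.apply_one]
  exact hF z (fun w hw => hx w ((dist_triangle w z x).trans (add_le_add hw hz))) 1

end ControlledHomotopic

lemma controlledHomotopic_squeezeMap {a : ℝ} (ha0 : 0 ≤ a) (ha : a < 1 / 2) (B : Set Y)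
    (g : C(Fin n → ℝ, Y)) :
    ControlledHomotopic B g 1 g (g.comp (squeezeMap n ha0 ha)) := by
  refine ⟨⟨⟨fun p => g (p.2 + (p.1 : ℝ) • (squeezeMap n ha0 ha p.2 - p.2)), by fun_prop⟩,
    by simp, by simp⟩, fun x hx t => hx _ ?_⟩
  rw [dist_eq_norm, add_sub_cancel_left, norm_smul, ← dist_eq_norm, Real.norm_of_nonneg t.2.1]
  exact mul_le_one₀ t.2.2 dist_nonneg (dist_squeezeMap_le ha0 ha x)

/-- A map which sends the boundary of an `r`-cell to the base point can be deformed to the base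
point on this cell, relative to the boundary. -/
lemma exists_cell_homotopy {B : Set Y} {y₀ : Y} (c : Contraction B y₀) {r : ℕ}
    (hπ : Subsingleton (HomotopyGroup (Fin r) Y y₀)) (g : C(Fin n → ℝ, Y))
    (hg : ∀ x, (nonint x).card < r → g x = y₀) (S : Finset (Fin n)) (hS : S.card = r)
    (v : Fin n → ℤ) :
    ∃ F : (Fin n → ℝ) × I → Y, ContinuousOn F (gridCell S v ×ˢ univ) ∧
      (∀ z ∈ gridCell S v, F (z, 0) = g z) ∧ (∀ z ∈ gridCell S v, F (z, 1) = y₀) ∧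
      (∀ z ∈ gridCell S v, (nonint z).card < r → ∀ t, F (z, t) = y₀) ∧
      ((∀ z ∈ gridCell S v, g z ∈ B) → ∀ z ∈ gridCell S v, ∀ t, F (z, t) ∈ B) := by
  by_cases hB : ∀ z ∈ gridCell S v, g z ∈ B
  · refine ⟨fun p => c.toFun (g p.1, p.2), c.continuousOn.comp (by fun_prop) ?_,
      fun z hz => c.apply_zero _ (hB z hz), fun z hz => c.apply_one _ (hB z hz), ?_,
      fun _ z hz t => c.mapsTo _ (hB z hz) t⟩
    · rintro ⟨z, t⟩ ⟨hz, -⟩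
      exact ⟨hB z hz, mem_univ _⟩
    · intro z _ hr t
      simp only [hg z hr, c.apply_base]
  · let e : S ≃ Fin r := S.equivFinOfCardEq hS
    let ψ : (Fin r → I) → Fin n → ℝ := fun y i => v i + if h : i ∈ S then (y (e ⟨i, h⟩) : ℝ) else 0
    have hψ : Continuous ψ := by
      refine continuous_pi fun i => continuous_const.add ?_
      by_cases h : i ∈ S
      · simp only [h, dif_pos]
        fun_prop
      · simp only [h, dif_neg, not_false_iff]
        fun_prop
    have hψS : ∀ y, nonint (ψ y) ⊆ S := by
      intro y i hi
      by_contra h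
      exact mem_nonint.1 hi ⟨v i, by simp [ψ, h]⟩
    let φ : GenLoop (Fin r) Y y₀ := ⟨⟨fun y => g (ψ y), by fun_prop⟩, by
      rintro y ⟨b, hb⟩
      refine hg _ ?_
      rw [← hS]
      refine Finset.card_lt_card ⟨hψS y, fun hsub => ?_⟩
      refine mem_nonint.1 (hsub (e.symm b).2) ?_
      have : ψ y (e.symm b) = v (e.symm b) + (y b : ℝ) := by simp [ψ]
      rw [this]
      rcases hb with hb | hb
      · exact ⟨v (e.symm b), by simp [hb]⟩
      · exact ⟨v (e.symm b) + 1, by simp [hb]⟩⟩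
    have hφ : GenLoop.Homotopic φ GenLoop.const :=
      Quotient.exact (@Subsingleton.elim _ hπ (Quotient.mk _ φ) (Quotient.mk _ GenLoop.const))
    obtain ⟨H⟩ := hφ
    let q : (Fin n → ℝ) → Fin r → I := fun z b => clamp (z (e.symm b) - v (e.symm b))
    have hq : Continuous q := by
      have := continuous_clamp
      fun_prop
    have hψq : ∀ z ∈ gridCell S v, ψ (q z) = z := by
      intro z hz
      funext i
      have h1 := hz i
      by_cases h : i ∈ S
      · simp only [h, if_true] at h1
        simp only [ψ, q, h, dif_pos, Equiv.symm_apply_apply]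
        rw [coe_clamp_of_mem (by linarith) (by linarith)]
        ring
      · simp only [h, if_false] at h1
        simp only [ψ, h, dif_neg, not_false_iff]
        linarith
    refine ⟨fun p => H (p.2, q p.1), by fun_prop, ?_, ?_, ?_, fun h => absurd h hB⟩
    · intro z hz
      simp only [H.apply_zero]
      exact congrArg g (hψq z hz)
    · intro z hz
      simp only [H.apply_one]
      rfl
    · intro z hz hr t
      obtain ⟨i, hi, hi'⟩ : ∃ i ∈ S, i ∉ nonint z := by
        by_contra! h
        have := Finset.card_le_card h
        omega
      obtain ⟨m, hm⟩ : z i ∈ integers := by simpa [mem_nonint] using hi'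
      have hbd : q z ∈ Cube.boundary (Fin r) := by
        refine ⟨e ⟨i, hi⟩, ?_⟩
        simp only [q, Equiv.symm_apply_apply]
        have h1 := hz i
        simp only [hi, if_true, ← hm] at h1
        have h2 : v i ≤ m := by exact_mod_cast h1.1
        have h3 : m ≤ v i + 1 := by exact_mod_cast h1.2
        rcases h2.eq_or_lt with h4 | h4
        · left
          exact clamp_of_nonpos (by rw [← hm, h4]; simp)
        · right
          have h5 : m = v i + 1 := by omega
          exact clamp_of_one_le (by rw [← hm, h5]; simp)
      exact (H.eq_snd t hbd).trans rfl

/-- One step of the deformation of the skeleta of the grid to the base point. -/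
lemma exists_controlledHomotopic_step {B : Set Y} {y₀ : Y} (c : Contraction B y₀) {r : ℕ}
    (hπ : Subsingleton (HomotopyGroup (Fin r) Y y₀)) (g : C(Fin n → ℝ, Y))
    (hg : ∀ x, (nonint x).card < r → g x = y₀) :
    ∃ g' : C(Fin n → ℝ, Y), ControlledHomotopic B g 2 g g' ∧
      ∀ x, (nonint x).card < r + 1 → g' x = y₀ := by
  classical
  have ha0 : (0 : ℝ) ≤ 1 / 4 := by norm_num
  have ha : (1 / 4 : ℝ) < 1 / 2 := by norm_num
  set s := squeezeMap n ha0 ha with hs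
  obtain ⟨χ, hχ1, hχ0⟩ := exists_cutoff (n := n) ha0 ha (by norm_num) r
  have hF := fun (S : {S : Finset (Fin n) // S.card = r}) (v : Fin n → ℤ) =>
    exists_cell_homotopy c hπ g hg S.1 S.2 v
  choose F hFc hF0 hF1 hFb hFB using hF
  let G : I × (Fin n → ℝ) → Y := fun p =>
    if h : (nonint (s p.2)).card = r then
      F ⟨nonint (s p.2), h⟩ (fun i => ⌊s p.2 i⌋) (s p.2, p.1 * χ p.2)
    else g (s p.2)
  have hGcell : ∀ (S : {S : Finset (Fin n) // S.card = r}) (v : Fin n → ℤ) (t : I)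
      (x : Fin n → ℝ), s x ∈ gridCell S.1 v → G (t, x) = F S v (s x, t * χ x) := by
    rintro ⟨S, hS⟩ v t x hx
    have hsub := nonint_subset_of_mem_gridCell hx
    by_cases h : (nonint (s x)).card = r
    · have hSeq : nonint (s x) = S := Finset.eq_of_subset_of_card_le hsub (by rw [h, hS])
      have hv := floor_eq_of_mem_gridCell hx hSeq
      simp only [G, h, dif_pos]
      congr! 2
    · have hlt : (nonint (s x)).card < r := by
        have := Finset.card_le_card hsub
        simp only [hS] at this
        omega
      simp only [G, h, dif_neg, not_false_iff]
      rw [hg _ hlt, hFb ⟨S, hS⟩ v _ hx hlt]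
  have hGrest : ∀ (t : I) (x : Fin n → ℝ), ((nonint (s x)).card < r ∨ χ x = 0) →
      G (t, x) = g (s x) := by
    intro t x h
    by_cases h' : (nonint (s x)).card = r
    · have hχ : χ x = 0 := h.resolve_left (by omega)
      rw [hGcell ⟨_, h'⟩ _ t x (mem_gridCell_floor _), hχ, mul_zero]
      exact hF0 _ _ _ (mem_gridCell_floor _)
    · simp only [G, h', dif_neg, not_false_iff]
  let T : Option ({S : Finset (Fin n) // S.card = r} × (Fin n → ℤ)) → Set (I × (Fin n → ℝ)) :=
    fun o => o.elim {p | (nonint (s p.2)).card < r ∨ χ p.2 = 0}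
      fun d => {p | s p.2 ∈ gridCell d.1.1 d.2}
  have hGc : Continuous G := by
    refine LocallyFinite.continuous (f := T) ?_ ?_ ?_ ?_
    · have h1 : LocallyFinite fun d : {S : Finset (Fin n) // S.card = r} × (Fin n → ℤ) =>
          gridCell d.1.1 d.2 :=
        locallyFinite_gridCell.comp_injective (g := fun d :
          {S : Finset (Fin n) // S.card = r} × (Fin n → ℤ) => (d.1.1, d.2)) (by
            rintro ⟨⟨S, _⟩, v⟩ ⟨⟨S', _⟩, v'⟩ h
            simpa using h)
      have h2 := h1.preimage_continuous (g := fun p : I × (Fin n → ℝ) => s p.2) (by fun_prop)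
      exact locallyFinite_option.2 h2
    · rw [Set.eq_univ_iff_forall]
      rintro ⟨t, x⟩
      rcases lt_trichotomy (nonint (s x)).card r with h | h | h
      · exact mem_iUnion.2 ⟨none, Or.inl h⟩
      · exact mem_iUnion.2 ⟨some (⟨_, h⟩, _), mem_gridCell_floor (s x)⟩
      · exact mem_iUnion.2 ⟨none, Or.inr (hχ0 x h)⟩
    · rintro (_ | d)
      · have h1 : IsClosed {x : Fin n → ℝ | (nonint x).card < r} := by
          rcases r with _ | r
          · simp
          · simpa only [Nat.lt_succ_iff] using isClosed_skeleton n r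
        have h2 : IsClosed {x | χ x = 0} := isClosed_eq χ.continuous continuous_const
        exact (h1.preimage (s.continuous.comp continuous_snd)).union
          (h2.preimage continuous_snd)
      · exact (isClosed_gridCell d.1.1 d.2).preimage (s.continuous.comp continuous_snd)
    · rintro (_ | d)
      · exact (by fun_prop : Continuous fun p : I × (Fin n → ℝ) => g (s p.2)).continuousOn.congr
          fun p hp => hGrest p.1 p.2 hp
      · refine ContinuousOn.congr (f := fun p : I × (Fin n → ℝ) => F d.1 d.2 (s p.2, p.1 * χ p.2))
          ?_ fun p hp => hGcell d.1 d.2 p.1 p.2 hp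
        exact (hFc d.1 d.2).comp (by fun_prop) fun p hp => ⟨hp, mem_univ _⟩
  refine ⟨⟨fun x => G (1, x), by fun_prop⟩,
    (((controlledHomotopic_squeezeMap ha0 ha B g).mono (by norm_num)).trans
      ⟨⟨⟨G, hGc⟩, fun x => ?_, fun x => rfl⟩, fun x hx t => ?_⟩), fun x hx => ?_⟩
  · by_cases h : (nonint (s x)).card = r
    · change G (0, x) = g (s x)
      rw [hGcell ⟨_, h⟩ _ 0 x (mem_gridCell_floor _), zero_mul]
      exact hF0 _ _ _ (mem_gridCell_floor _)
    · simp only [G, h, dif_neg, not_false_iff]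
      rfl
  · have hsx : dist (s x) x ≤ 1 := dist_squeezeMap_le ha0 ha x
    change G (t, x) ∈ B
    by_cases h : (nonint (s x)).card = r
    · rw [hGcell ⟨_, h⟩ _ t x (mem_gridCell_floor _)]
      refine hFB _ _ (fun z hz => hx z ?_) _ (mem_gridCell_floor _) _
      have h1 := dist_le_of_mem_gridCell hz (mem_gridCell_floor (s x))
      linarith [dist_triangle z (s x) x]
    · simp only [G, h, dif_neg, not_false_iff]
      exact hx _ (by linarith)
  · have hle : (nonint (s x)).card ≤ (nonint x).card :=
      Finset.card_le_card (nonint_squeezeMap_subset ha0 ha x)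
    change G (1, x) = y₀
    by_cases h : (nonint (s x)).card = r
    · rw [hGcell ⟨_, h⟩ _ 1 x (mem_gridCell_floor _), hχ1 x (by omega), mul_one]
      exact hF1 _ _ _ (mem_gridCell_floor _)
    · have hlt : (nonint (s x)).card < r := by omega
      rw [hGrest 1 x (Or.inl hlt), hg _ hlt]

/-- A map to a `k`-connected space can be deformed, in a controlled way, so that the
`k`-skeleton of the grid goes to the base point. -/
lemma exists_controlledHomotopic_skeleton {B : Set Y} {y₀ : Y} (c : Contraction B y₀) (k : ℕ)
    (hπ : ∀ r < k, Subsingleton (HomotopyGroup (Fin r) Y y₀)) (g : C(Fin n → ℝ, Y)) :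
    ∃ g' : C(Fin n → ℝ, Y), ControlledHomotopic B g (2 * k) g g' ∧
      ∀ x, (nonint x).card < k → g' x = y₀ := by
  induction k with
  | zero => exact ⟨g, .refl (by simp), by simp⟩
  | succ k ih =>
    obtain ⟨g', h, hg'⟩ := ih fun r hr => hπ r (by omega)
    obtain ⟨g'', h', hg''⟩ := exists_controlledHomotopic_step c (hπ k (by omega)) g' hg'
    refine ⟨g'', ?_, hg''⟩
    convert h.comp h' (by norm_num) using 1
    push_cast
    ring

/-- A map to a `k`-connected space can be deformed, in a controlled way, so that all points
which squeeze into the `k`-skeleton of the grid go to the base point. -/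
lemma exists_controlledHomotopic_squeeze {B : Set Y} {y₀ : Y} (c : Contraction B y₀) (k : ℕ)
    (hπ : ∀ r < k, Subsingleton (HomotopyGroup (Fin r) Y y₀)) (g : C(Fin n → ℝ, Y)) {a : ℝ}
    (ha0 : 0 ≤ a) (ha : a < 1 / 2) :
    ∃ g' : C(Fin n → ℝ, Y), ControlledHomotopic B g (2 * k + 1) g g' ∧
      ∀ x, (nonint (squeezeMap n ha0 ha x)).card < k → g' x = y₀ := by
  obtain ⟨g', h, hg'⟩ := exists_controlledHomotopic_skeleton c k hπ g
  exact ⟨g'.comp (squeezeMap n ha0 ha),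
    h.comp (controlledHomotopic_squeezeMap ha0 ha B g') (by norm_num),
    fun x hx => hg' _ hx⟩

/-! ### Covering a Euclidean space by deformed preimages -/

lemma exists_shift_squeeze_skeleton {L k : ℕ} (hL : n < L * k) {a : ℝ} (ha0 : 0 ≤ a)
    (ha : a < 1 / 2) (haL : 1 - 1 / L ≤ 2 * a) (x : Fin n → ℝ) :
    ∃ j : Fin L, (nonint (squeezeMap n ha0 ha fun i => x i - (j : ℝ) / L)).card < k := by
  by_contra! h
  have hLpos : 0 < L := Nat.pos_of_ne_zero (by rintro rfl; simp at hL)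
  have hL0 : (0 : ℝ) < L := by exact_mod_cast hLpos
  have hdisj : ∀ j j' : Fin L, j ≠ j' →
      Disjoint (nonint (squeezeMap n ha0 ha fun i => x i - (j : ℝ) / L))
        (nonint (squeezeMap n ha0 ha fun i => x i - (j' : ℝ) / L)) := by
    intro j j' hne
    rw [Finset.disjoint_left]
    intro i hi hi'
    obtain ⟨h1, h2⟩ := fract_mem_of_squeeze_notMem ha (mem_nonint.1 hi)
    obtain ⟨h3, h4⟩ := fract_mem_of_squeeze_notMem ha (mem_nonint.1 hi')
    have e1 := Int.floor_add_fract (x i - (j : ℝ) / L)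
    have e2 := Int.floor_add_fract (x i - (j' : ℝ) / L)
    set p := ⌊x i - (j : ℝ) / L⌋
    set p' := ⌊x i - (j' : ℝ) / L⌋
    have e3 : |(j' : ℝ) / L - (j : ℝ) / L - (p - p' : ℤ)| < 1 / L := by
      rw [abs_lt]
      push_cast
      constructor <;> linarith
    have e4 : |((j' - j - L * (p - p') : ℤ) : ℝ)| < 1 := by
      have : ((j' - j - L * (p - p') : ℤ) : ℝ) =
          L * ((j' : ℝ) / L - (j : ℝ) / L - (p - p' : ℤ)) := by
        push_cast
        field_simp
      rw [this, abs_mul, abs_of_pos hL0]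
      calc (L : ℝ) * _ < L * (1 / L) := mul_lt_mul_of_pos_left e3 hL0
        _ = 1 := by field_simp
    have e5 : (j' - j - L * (p - p') : ℤ) = 0 := by
      rw [← Int.cast_abs] at e4
      exact Int.abs_lt_one_iff.1 (by exact_mod_cast e4)
    have hj := j.2
    have hj' := j'.2
    have e6 : p - p' = 0 := by
      by_contra hne'
      rcases lt_or_gt_of_ne hne' with hlt | hgt <;> nlinarith
    rw [e6] at e5
    exact hne (Fin.ext (by omega))
  have hsum := Finset.card_biUnion (s := Finset.univ)
    (t := fun j : Fin L => nonint (squeezeMap n ha0 ha fun i => x i - (j : ℝ) / L))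
    fun j _ j' _ => hdisj j j'
  have hle := Finset.card_le_univ (Finset.univ.biUnion
    fun j : Fin L => nonint (squeezeMap n ha0 ha fun i => x i - (j : ℝ) / L))
  have hge := Finset.card_nsmul_le_sum (Finset.univ : Finset (Fin L))
    (fun j => (nonint (squeezeMap n ha0 ha fun i => x i - (j : ℝ) / L)).card) k fun j _ => h j
  simp only [Fintype.card_fin, Finset.card_univ, smul_eq_mul] at hle hge
  omega

/-- Given `L` maps `ℝⁿ → Y` such that the preimages of `B` cover a compact set `S`, if
`n < L * k` and `Y` is `(k - 1)`-connected then the maps can be deformed relative to `S`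
until the preimages of `B` cover everything. -/
lemma exists_covering_homotopies {B : Set Y} {y₀ : Y} (c : Contraction B y₀) (hB : IsOpen B)
    {k L : ℕ} (hL : n < L * k) (hπ : ∀ r < k, Subsingleton (HomotopyGroup (Fin r) Y y₀))
    (g : Fin L → C(Fin n → ℝ, Y)) {S : Set (Fin n → ℝ)} (hS : IsCompact S)
    (hcov : ∀ x ∈ S, ∃ j, g j x ∈ B) :
    ∃ K : Fin L → C((Fin n → ℝ) × I, Y), (∀ j x, K j (x, 0) = g j x) ∧
      (∀ j, ∀ x ∈ S, ∀ t, K j (x, t) = g j x) ∧ ∀ x, ∃ j, K j (x, 1) ∈ B := by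
  obtain ⟨ε, hε, hlam⟩ := lebesgue_number_lemma_of_metric hS
    (c := fun j => g j ⁻¹' B) (fun j => hB.preimage (g j).continuous)
    (fun x hx => mem_iUnion.2 (hcov x hx))
  have hLpos : 0 < L := Nat.pos_of_ne_zero (by rintro rfl; simp at hL)
  have hL1 : (1 : ℝ) ≤ L := by exact_mod_cast hLpos
  have hL2 : (1 : ℝ) / L ≤ 1 := (div_le_one (by linarith)).2 hL1
  have hL3 : (0 : ℝ) < 1 / L := by positivity
  have ha0 : (0 : ℝ) ≤ (1 - 1 / L) / 2 := by linarith
  have ha : (1 - 1 / L : ℝ) / 2 < 1 / 2 := by linarith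
  obtain ⟨θ, hθ0, hθ1, hθ⟩ := exists_continuous_zero_one_of_isClosed hS.isClosed
    (isOpen_thickening (δ := ε / 2) (E := S)).isClosed_compl
    (disjoint_compl_right_iff_subset.2 (self_subset_thickening (half_pos hε) S))
  let N : ℝ := (2 * k + 1) / (ε / 2)
  have hN : 0 < N := by positivity
  let A : Fin L → C(Fin n → ℝ, Fin n → ℝ) := fun j =>
    ⟨fun x i => N * x i - (j : ℝ) / L, by fun_prop⟩
  let A' : Fin L → C(Fin n → ℝ, Fin n → ℝ) :=
    fun j => ⟨fun x i => N⁻¹ * (x i + (j : ℝ) / L), by fun_prop⟩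
  have hA : ∀ j x, A' j (A j x) = x := by
    intro j x
    funext i
    simp [A, A', hN.ne']
  have hA' : ∀ j x z, dist (A' j z) (A' j x) ≤ N⁻¹ * dist z x := by
    intro j x z
    refine (dist_pi_le_iff (by positivity)).2 fun i => ?_
    have h1 : A' j z i - A' j x i = N⁻¹ * (z i - x i) := by
      simp only [A', ContinuousMap.coe_mk]
      ring
    rw [Real.dist_eq, h1, abs_mul, abs_of_pos (inv_pos.2 hN), ← Real.dist_eq]
    exact mul_le_mul_of_nonneg_left (dist_le_pi_dist z x i) (by positivity)
  have hG := fun j => exists_controlledHomotopic_squeeze c k hπ ((g j).comp (A' j)) ha0 ha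
  choose g' hG hg' using hG
  choose F hF using hG
  let θ' : C(Fin n → ℝ, I) := ⟨fun x => ⟨θ x, hθ x⟩, by fun_prop⟩
  have hK0 : ∀ j x, F j (0, A j x) = g j x := by
    intro j x
    rw [(F j).apply_zero, ContinuousMap.comp_apply, hA]
  refine ⟨fun j => ⟨fun p => F j (p.2 * θ' p.1, A j p.1), by fun_prop⟩, ?_, ?_, ?_⟩
  · intro j x
    simp only [ContinuousMap.coe_mk, zero_mul]
    exact hK0 j x
  · intro j x hx t
    have : θ' x = 0 := Subtype.ext (hθ0 hx)
    simp only [ContinuousMap.coe_mk, this, mul_zero]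
    exact hK0 j x
  · intro x
    by_cases hx : x ∈ thickening (ε / 2) S
    · obtain ⟨p, hp, hxp⟩ := mem_thickening_iff.1 hx
      obtain ⟨j, hj⟩ := hlam p hp
      refine ⟨j, hF j _ (fun z hz => hj ?_) _⟩
      have h1 := hA' j (A j x) z
      rw [hA] at h1
      have h2 : N⁻¹ * dist z (A j x) ≤ ε / 2 := by
        refine (mul_le_mul_of_nonneg_left hz (by positivity)).trans (le_of_eq ?_)
        simp only [N]
        field_simp
      rw [mem_ball]
      linarith [dist_triangle (A' j z) x p]
    · obtain ⟨j, hj⟩ := exists_shift_squeeze_skeleton hL ha0 ha (by linarith) fun i => N * x i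
      refine ⟨j, ?_⟩
      have : θ' x = 1 := Subtype.ext (hθ1 hx)
      simp only [ContinuousMap.coe_mk, this, mul_one, (F j).apply_one]
      rw [show g' j (A j x) = y₀ from hg' j _ hj]
      exact c.base_mem

/-! ### Attaching a cell -/

/-- The closed unit ball of a Euclidean space. -/
abbrev unitBall (n : ℕ) : Set (EuclideanSpace ℝ (Fin n)) := closedBall 0 1

/-- The radial retraction of a Euclidean space onto its closed unit ball. -/
noncomputable def ballRetraction (n : ℕ) :
    C(EuclideanSpace ℝ (Fin n), unitBall n) where
  toFun y := ⟨(max 1 ‖y‖)⁻¹ • y, by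
    have h : 0 < max 1 ‖y‖ := lt_max_of_lt_left one_pos
    rw [mem_closedBall_zero_iff, norm_smul, norm_inv, Real.norm_of_nonneg h.le,
      inv_mul_le_one₀ h]
    exact le_max_right _ _⟩
  continuous_toFun := by
    refine Continuous.subtype_mk (Continuous.smul (Continuous.inv₀
      (continuous_const.max continuous_norm) fun y => ?_) continuous_id) _
    exact (lt_max_of_lt_left one_pos).ne'

lemma coe_ballRetraction (y : EuclideanSpace ℝ (Fin n)) :
    (ballRetraction n y : EuclideanSpace ℝ (Fin n)) = (max 1 ‖y‖)⁻¹ • y := rfl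

lemma ballRetraction_coe (z : unitBall n) :
    ballRetraction n z = z := by
  have h := mem_closedBall_zero_iff.1 z.2
  ext1
  rw [coe_ballRetraction, max_eq_left h, inv_one, one_smul]

lemma ballRetraction_smul (z : unitBall n)
    (hz : ‖(z : EuclideanSpace ℝ (Fin n))‖ = 1) {t : ℝ} (ht : 1 ≤ t) :
    ballRetraction n (t • (z : EuclideanSpace ℝ (Fin n))) = z := by
  ext1
  rw [coe_ballRetraction, norm_smul, hz, mul_one, Real.norm_of_nonneg (by linarith),
    max_eq_right ht, smul_smul, inv_mul_cancel₀ (by linarith), one_smul]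

/-- `L` homotopies on a subset `A`, starting at the inclusion, such that the preimages of `B` under
the final maps cover `A`. -/
def DeformsInto {X : Type*} [TopologicalSpace X] (B : Set X) (L : ℕ) (A : Set X) : Prop :=
  ∃ H : Fin L → X × I → X, (∀ j, ContinuousOn (H j) (A ×ˢ univ)) ∧
    (∀ j, ∀ x ∈ A, H j (x, 0) = x) ∧ ∀ x ∈ A, ∃ j, H j (x, 1) ∈ B

variable {X : Type*} [TopologicalSpace X]

lemma exists_ball_homotopies {B : Set X} {x₀ : X} (c : Contraction B x₀) (hB : IsOpen B)
    {k L : ℕ} (hL : n < L * k) (hπ : ∀ r < k, Subsingleton (HomotopyGroup (Fin r) X x₀))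
    {A : Set X} {H : Fin L → X × I → X} (hH : ∀ j, ContinuousOn (H j) (A ×ˢ univ))
    (hH0 : ∀ j, ∀ x ∈ A, H j (x, 0) = x) (hH1 : ∀ x ∈ A, ∃ j, H j (x, 1) ∈ B)
    (Φ : C(unitBall n, X))
    (hΦ : ∀ z : unitBall n, ‖(z : EuclideanSpace ℝ (Fin n))‖ = 1 → Φ z ∈ A) :
    ∃ v : Fin L → C(unitBall n × I, X),
      (∀ j, ∀ z : unitBall n, v j (z, 0) = Φ z) ∧
      (∀ j, ∀ z : unitBall n, ‖(z : EuclideanSpace ℝ (Fin n))‖ = 1 →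
        ∀ t : I, v j (z, t) = H j (Φ z, clamp (2 * t))) ∧
      ∀ z, ∃ j, v j (z, 1) ∈ B := by
  have hcl := continuous_clamp
  have hret : ∀ y : EuclideanSpace ℝ (Fin n), 1 ≤ ‖y‖ → Φ (ballRetraction n y) ∈ A := by
    intro y hy
    refine hΦ _ ?_
    rw [coe_ballRetraction, norm_smul, norm_inv, max_eq_right hy, norm_norm,
      inv_mul_cancel₀ (by linarith)]
  let W : Fin L → C(EuclideanSpace ℝ (Fin n), X) := fun j =>
    ⟨fun y => if ‖y‖ ≤ 1 then Φ (ballRetraction n y)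
      else H j (Φ (ballRetraction n y), clamp (‖y‖ - 1)), by
      refine continuous_if_le continuous_norm continuous_const (by fun_prop) ?_ ?_
      · exact (hH j).comp (by fun_prop) fun y hy => ⟨hret y hy, mem_univ _⟩
      · intro y hy
        rw [clamp_of_nonpos (by linarith), hH0 j _ (hret y hy.ge)]⟩
  have hWball : ∀ j (z : unitBall n), W j z = Φ z := by
    intro j z
    have h := mem_closedBall_zero_iff.1 z.2
    simp only [W, ContinuousMap.coe_mk, h, if_true, ballRetraction_coe]
  have hWsphere : ∀ j (z : unitBall n),
      ‖(z : EuclideanSpace ℝ (Fin n))‖ = 1 → ∀ s : I,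
      W j ((1 + (s : ℝ)) • (z : EuclideanSpace ℝ (Fin n))) = H j (Φ z, s) := by
    intro j z hz s
    have hs := s.2.1
    have hnorm : ‖(1 + (s : ℝ)) • (z : EuclideanSpace ℝ (Fin n))‖ = 1 + s := by
      rw [norm_smul, hz, mul_one, Real.norm_of_nonneg (by linarith)]
    simp only [W, ContinuousMap.coe_mk, hnorm, ballRetraction_smul z hz
      (show 1 ≤ 1 + (s : ℝ) by linarith), add_sub_cancel_left, clamp_coe]
    split_ifs with h
    · have : s = 0 := Subtype.ext (le_antisymm (by simpa using h) hs)
      rw [this, hH0 j _ (hΦ z hz)]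
    · rfl
  let e : EuclideanSpace ℝ (Fin n) ≃ₜ (Fin n → ℝ) := (EuclideanSpace.equiv (Fin n) ℝ).toHomeomorph
  obtain ⟨K, hK0, hKS, hK1⟩ := exists_covering_homotopies c hB hL hπ
    (fun j => (W j).comp ⟨e.symm, e.symm.continuous⟩)
    (S := e '' sphere 0 2) ((isCompact_sphere _ _).image e.continuous) (by
      rintro _ ⟨y, hy, rfl⟩
      have hy' : ‖y‖ = 2 := by simpa using hy
      obtain ⟨j, hj⟩ := hH1 _ (hret y (by linarith))
      refine ⟨j, ?_⟩
      simp only [ContinuousMap.comp_apply, ContinuousMap.coe_mk, e.symm_apply_apply, W, hy']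
      rw [if_neg (by norm_num), clamp_of_one_le (by norm_num)]
      exact hj)
  refine ⟨fun j => ⟨fun p => K j (e ((1 + (clamp (2 * p.2) : ℝ)) •
    (p.1 : EuclideanSpace ℝ (Fin n))), clamp (2 * p.2 - 1)), by
      have := e.continuous
      fun_prop⟩, ?_, ?_, ?_⟩
  · intro j z
    have h1 : clamp (2 * ((0 : I) : ℝ)) = 0 := clamp_of_nonpos (by simp)
    have h2 : clamp (2 * ((0 : I) : ℝ) - 1) = 0 := clamp_of_nonpos (by simp)
    simp only [ContinuousMap.coe_mk, h1, h2, hK0, ContinuousMap.comp_apply, e.symm_apply_apply]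
    simpa using hWball j z
  · intro j z hz t
    simp only [ContinuousMap.coe_mk]
    have key : W j ((1 + (clamp (2 * t) : ℝ)) • (z : EuclideanSpace ℝ (Fin n))) =
        H j (Φ z, clamp (2 * t)) := hWsphere j z hz _
    rw [← key]
    rcases le_total (2 * (t : ℝ)) 1 with ht | ht
    · rw [clamp_of_nonpos (show 2 * (t : ℝ) - 1 ≤ 0 by linarith), hK0]
      simp
    · rw [clamp_of_one_le ht, hKS]
      · simp
      · refine ⟨_, ?_, rfl⟩
        rw [mem_sphere_zero_iff_norm, norm_smul, hz]
        norm_num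
  · intro z
    obtain ⟨j, hj⟩ := hK1 (e ((1 + (clamp (2 * ((1 : I) : ℝ)) : ℝ)) •
      (z : EuclideanSpace ℝ (Fin n))))
    refine ⟨j, ?_⟩
    have h2 : clamp (2 * ((1 : I) : ℝ) - 1) = 1 := clamp_of_one_le (by norm_num)
    simp only [ContinuousMap.coe_mk, h2]
    exact hj

lemma continuousOn_range_of_comp {D Z W : Type*} [TopologicalSpace D] [TopologicalSpace Z]
    [TopologicalSpace W] {f : D → Z} (hf : IsClosedMap f) {u : Z → W} (hu : Continuous (u ∘ f)) :
    ContinuousOn u (range f) := by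
  rw [continuousOn_iff_isClosed]
  intro C hC
  refine ⟨f '' (u ∘ f ⁻¹' C), hf _ (hC.preimage hu), ?_⟩
  ext z
  constructor
  · rintro ⟨hz, d, rfl⟩
    exact ⟨⟨d, hz, rfl⟩, d, rfl⟩
  · rintro ⟨⟨d, hd, rfl⟩, -⟩
    exact ⟨hd, d, rfl⟩

lemma DeformsInto.union_range [T2Space X] {B : Set X} {x₀ : X} (c : Contraction B x₀)
    (hB : IsOpen B) {k L : ℕ} (hL : n < L * k)
    (hπ : ∀ r < k, Subsingleton (HomotopyGroup (Fin r) X x₀))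
    {A : Set X} (hA : IsClosed A) (h : DeformsInto B L A)
    (Φ : C(unitBall n, X))
    (hΦ : ∀ z : unitBall n, ‖(z : EuclideanSpace ℝ (Fin n))‖ = 1 → Φ z ∈ A)
    (hinj : Set.InjOn Φ {x | ‖(x : EuclideanSpace ℝ (Fin n))‖ < 1})
    (hdisj : Disjoint (Φ '' {x | ‖(x : EuclideanSpace ℝ (Fin n))‖ < 1}) A) :
    DeformsInto B L (A ∪ range Φ) := by
  classical
  obtain ⟨H, hH, hH0, hH1⟩ := h
  obtain ⟨v, hv0, hvs, hv1⟩ := exists_ball_homotopies c hB hL hπ hH hH0 hH1 Φ hΦ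
  have hcl := continuous_clamp
  have hnorm : ∀ z : unitBall n, Φ z ∈ A ↔ ‖(z : EuclideanSpace ℝ (Fin n))‖ = 1 := by
    refine fun z => ⟨fun hz => le_antisymm (mem_closedBall_zero_iff.1 z.2) ?_, hΦ z⟩
    by_contra! hlt
    exact Set.disjoint_left.1 hdisj ⟨z, hlt, rfl⟩ hz
  have hlt : ∀ z : unitBall n, Φ z ∉ A → ‖(z : EuclideanSpace ℝ (Fin n))‖ < 1 := fun z hz =>
    lt_of_le_of_ne (mem_closedBall_zero_iff.1 z.2) fun h => hz ((hnorm z).2 h)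
  let H' : Fin L → X × I → X := fun j p =>
    if p.1 ∈ A then H j (p.1, clamp (2 * p.2))
    else if h : ∃ z, Φ z = p.1 then v j (h.choose, p.2) else p.1
  have hH'A : ∀ j, ∀ x ∈ A, ∀ t : I, H' j (x, t) = H j (x, clamp (2 * t)) := by
    intro j x hx t
    simp only [H', hx, if_true]
  have hH'Φ : ∀ j z t, H' j (Φ z, t) = v j (z, t) := by
    intro j z t
    by_cases hz : Φ z ∈ A
    · rw [hH'A j _ hz, hvs j z ((hnorm z).1 hz)]
    · have hex : ∃ z', Φ z' = Φ z := ⟨z, rfl⟩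
      have heq : hex.choose = z :=
        hinj (hlt _ (by rwa [hex.choose_spec])) (hlt z hz) hex.choose_spec
      simp only [H', hz, if_false, dif_pos hex, heq]
  refine ⟨H', fun j => ?_, ?_, ?_⟩
  · rw [Set.union_prod]
    refine ContinuousOn.union_of_isClosed ?_ ?_ (hA.prod isClosed_univ)
      ((isCompact_range Φ.continuous).isClosed.prod isClosed_univ)
    · refine ContinuousOn.congr (f := fun p : X × I => H j (p.1, clamp (2 * p.2))) ?_
        fun p hp => hH'A j p.1 hp.1 p.2
      exact (hH j).comp (by fun_prop) fun p hp => ⟨hp.1, mem_univ _⟩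
    · have hr : range Φ ×ˢ (univ : Set I) = range (Prod.map Φ (id : I → I)) := by
        rw [Set.range_prodMap, range_id]
      rw [hr]
      refine continuousOn_range_of_comp
        (Continuous.isClosedMap (Φ.continuous.prodMap continuous_id)) ?_
      exact (v j).continuous.congr fun p => (hH'Φ j p.1 p.2).symm
  · rintro j x (hx | ⟨z, rfl⟩)
    · rw [hH'A j x hx, clamp_of_nonpos (by simp), hH0 j x hx]
    · rw [hH'Φ, hv0]
  · rintro x (hx | ⟨z, rfl⟩)
    · obtain ⟨j, hj⟩ := hH1 x hx
      refine ⟨j, ?_⟩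
      rwa [hH'A j x hx, clamp_of_one_le (by norm_num)]
    · obtain ⟨j, hj⟩ := hv1 z
      exact ⟨j, by rwa [hH'Φ]⟩

/-! ### Finite CW complexes -/

section CW

variable (C : FiniteCWStructure X)

/-- The union of the closed cells of dimension less than `d`. -/
def lowerSkeleton (d : ℕ) : Set X := ⋃ (m : ℕ) (_ : m < d) (j : Fin (C.cells m)),
  range (C.attach m j)

/-- The open cells. -/
def openCell (n : ℕ) (i : Fin (C.cells n)) : Set X :=
  C.attach n i '' {x | ‖(x : EuclideanSpace ℝ (Fin n))‖ < 1}

lemma mem_lowerSkeleton {d : ℕ} {x : X} :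
    x ∈ lowerSkeleton C d ↔ ∃ m < d, ∃ j, x ∈ range (C.attach m j) := by
  simp [lowerSkeleton]

lemma range_attach_subset (n : ℕ) (i : Fin (C.cells n)) :
    range (C.attach n i) ⊆ openCell C n i ∪ lowerSkeleton C n := by
  rintro _ ⟨z, rfl⟩
  rcases (mem_closedBall_zero_iff.1 z.2).lt_or_eq with h | h
  · exact Or.inl ⟨z, h, rfl⟩
  · exact Or.inr (C.sphere_mapsTo n i z h)

lemma exists_openCell_of_mem_lowerSkeleton {d : ℕ} {x : X} (hx : x ∈ lowerSkeleton C d) :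
    ∃ m < d, ∃ j, x ∈ openCell C m j := by
  induction d using Nat.strong_induction_on with
  | _ d ih =>
    obtain ⟨m, hm, j, hj⟩ := (mem_lowerSkeleton C).1 hx
    rcases range_attach_subset C m j hj with h | h
    · exact ⟨m, hm, j, h⟩
    · obtain ⟨m', hm', h'⟩ := ih m hm h
      exact ⟨m', hm'.trans hm, h'⟩

lemma disjoint_openCell_lowerSkeleton (n : ℕ) (i : Fin (C.cells n)) :
    Disjoint (openCell C n i) (lowerSkeleton C n) := by
  rw [Set.disjoint_left]
  intro x hx hx'
  obtain ⟨m, hm, j, hj⟩ := exists_openCell_of_mem_lowerSkeleton C hx'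
  refine Set.disjoint_left.1 (C.openCells_disjoint n i m j fun h => ?_) hx hj
  have := congrArg Sigma.fst h
  simp only at this
  omega

lemma disjoint_openCell_range_attach {n : ℕ} {i j : Fin (C.cells n)} (hij : i ≠ j) :
    Disjoint (openCell C n i) (range (C.attach n j)) := by
  refine (Set.disjoint_union_right.2 ⟨?_, disjoint_openCell_lowerSkeleton C n i⟩).mono_right
    (range_attach_subset C n j)
  exact C.openCells_disjoint n i n j fun h => hij (by simpa using h)

lemma lowerSkeleton_succ (d : ℕ) :
    lowerSkeleton C (d + 1) = lowerSkeleton C d ∪ ⋃ j, range (C.attach d j) := by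
  ext x
  simp only [lowerSkeleton, Nat.lt_succ_iff_lt_or_eq, mem_union, mem_iUnion, exists_prop]
  constructor
  · rintro ⟨m, hm | rfl, j, hj⟩
    · exact Or.inl ⟨m, hm, j, hj⟩
    · exact Or.inr ⟨j, hj⟩
  · rintro (⟨m, hm, j, hj⟩ | ⟨j, hj⟩)
    · exact ⟨m, Or.inl hm, j, hj⟩
    · exact ⟨d, Or.inr rfl, j, hj⟩

lemma mem_lowerSkeleton_dim (x : X) : x ∈ lowerSkeleton C (C.dim + 1) := by
  have hx : x ∈ ⋃ (n) (i), openCell C n i := C.openCells_cover ▸ mem_univ x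
  obtain ⟨n, i, z, -, hz⟩ := mem_iUnion₂.1 hx
  refine (mem_lowerSkeleton C).2 ⟨n, ?_, i, z, hz⟩
  by_contra! h
  have h0 := C.cells_eq_zero n (by omega)
  exact absurd i.2 (by omega)

variable [T2Space X]

lemma isClosed_range_attach (n : ℕ) (i : Fin (C.cells n)) : IsClosed (range (C.attach n i)) :=
  (isCompact_range (C.attach n i).continuous).isClosed

lemma isClosed_lowerSkeleton (d : ℕ) : IsClosed (lowerSkeleton C d) :=
  (Set.finite_lt_nat d).isClosed_biUnion fun m _ =>
    isClosed_iUnion_of_finite fun j => isClosed_range_attach C m j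

lemma deformsInto_lowerSkeleton {B : Set X} {x₀ : X} (c : Contraction B x₀) (hB : IsOpen B)
    {k L : ℕ} (hL : C.dim < L * k) (hπ : ∀ r < k, Subsingleton (HomotopyGroup (Fin r) X x₀))
    (d : ℕ) : DeformsInto B L (lowerSkeleton C d) := by
  classical
  induction d with
  | zero => exact ⟨fun _ p => p.1, by simp [lowerSkeleton]⟩
  | succ d ih =>
    have key : ∀ s : Finset (Fin (C.cells d)),
        DeformsInto B L (lowerSkeleton C d ∪ ⋃ j ∈ s, range (C.attach d j)) := by
      intro s
      induction s using Finset.induction_on with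
      | empty => simpa using ih
      | insert i s hi ihs =>
        have hd : d < L * k := by
          by_contra! h
          have h0 := C.cells_eq_zero d (by omega)
          exact absurd i.2 (by omega)
        have h := ihs.union_range c hB hd hπ ((isClosed_lowerSkeleton C d).union
          (s.finite_toSet.isClosed_biUnion fun j _ => isClosed_range_attach C d j))
          (C.attach d i) (fun z hz => Or.inl (C.sphere_mapsTo d i z hz)) (C.attach_injOn d i)
          (Set.disjoint_union_right.2 ⟨disjoint_openCell_lowerSkeleton C d i,
            Set.disjoint_iUnion₂_right.2 fun j hj => disjoint_openCell_range_attach C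
              (by rintro rfl; exact hi hj)⟩)
        have e : lowerSkeleton C d ∪ ⋃ j ∈ insert i s, range (C.attach d j) =
            (lowerSkeleton C d ∪ ⋃ j ∈ s, range (C.attach d j)) ∪ range (C.attach d i) := by
          rw [Finset.set_biUnion_insert, Set.union_comm (range _), Set.union_assoc]
        rw [e]
        exact h
    simpa [lowerSkeleton_succ] using key Finset.univ

/-- Open cells are contractible to their centers. -/
lemma nonempty_contraction_openCell (n : ℕ) (i : Fin (C.cells n)) :
    Nonempty (Contraction (openCell C n i) (C.attach n i ⟨0, by simp⟩)) := by
  classical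
  set Φ := C.attach n i with hΦ
  have hinj := C.attach_injOn n i
  have hnorm : ∀ z : unitBall n, Φ z ∈ openCell C n i → ‖(z : EuclideanSpace ℝ (Fin n))‖ < 1 := by
    intro z hz
    refine lt_of_le_of_ne (mem_closedBall_zero_iff.1 z.2) fun h => ?_
    exact Set.disjoint_left.1 (disjoint_openCell_lowerSkeleton C n i) hz
      (C.sphere_mapsTo n i z h)
  have hscale : ∀ (z : unitBall n) (t : I),
      ‖(1 - (t : ℝ)) • (z : EuclideanSpace ℝ (Fin n))‖ ≤ ‖(z : EuclideanSpace ℝ (Fin n))‖ := by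
    intro z t
    rw [norm_smul, Real.norm_of_nonneg (by linarith [t.2.2])]
    exact mul_le_of_le_one_left (norm_nonneg _) (by linarith [t.2.1])
  let shrink : unitBall n × I → unitBall n := fun p =>
    ⟨(1 - (p.2 : ℝ)) • (p.1 : EuclideanSpace ℝ (Fin n)), mem_closedBall_zero_iff.2
      ((hscale p.1 p.2).trans (mem_closedBall_zero_iff.1 p.1.2))⟩
  have hshrink : Continuous shrink := by fun_prop
  let x₀ := Φ ⟨0, by simp⟩
  let F : X × I → X := fun p =>
    if h : ∃ z : unitBall n, ‖(z : EuclideanSpace ℝ (Fin n))‖ < 1 ∧ Φ z = p.1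
    then Φ (shrink (h.choose, p.2)) else x₀
  have hF : ∀ (z : unitBall n) (t : I), ‖(z : EuclideanSpace ℝ (Fin n))‖ < 1 →
      F (Φ z, t) = Φ (shrink (z, t)) := by
    intro z t hz
    have h : ∃ z' : unitBall n, ‖(z' : EuclideanSpace ℝ (Fin n))‖ < 1 ∧ Φ z' = Φ z :=
      ⟨z, hz, rfl⟩
    have heq : h.choose = z := hinj h.choose_spec.1 hz h.choose_spec.2
    simp only [F, dif_pos h, heq]
  refine ⟨⟨F, ?_, ?_, ?_, ?_, ?_, ?_⟩⟩
  · let s : Set (X × I) := openCell C n i ×ˢ univ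
    have hcl : IsClosedMap (Prod.map Φ (id : I → I)) :=
      (Φ.continuous.prodMap continuous_id).isClosedMap
    have h := continuousOn_range_of_comp (hcl.restrictPreimage s) (u := s.domRestrict F) (by
      have : Continuous fun p : Prod.map Φ (id : I → I) ⁻¹' s => Φ (shrink p.1) := by fun_prop
      refine this.congr fun p => (hF p.1.1 p.1.2 (hnorm _ p.2.1)).symm)
    have hr : range (s.restrictPreimage (Prod.map Φ (id : I → I))) = univ := by
      rw [Set.range_eq_univ]
      rintro ⟨⟨y, t⟩, hy⟩
      obtain ⟨z, hz, rfl : Φ z = y⟩ := hy.1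
      exact ⟨⟨(z, t), ⟨z, hz, rfl⟩, mem_univ _⟩, rfl⟩
    rw [hr, continuousOn_univ] at h
    exact continuousOn_iff_continuous_domRestrict.2 h
  · rintro _ ⟨z, hz, rfl⟩
    rw [hF z 0 hz]
    congr 1
    ext1
    simp [shrink]
  · rintro _ ⟨z, hz, rfl⟩
    rw [hF z 1 hz]
    congr 1
    ext1
    simp [shrink]
  · intro t
    rw [hF _ t (by simp)]
    congr 1
    ext1
    simp [shrink]
  · exact ⟨⟨0, by simp⟩, by simp, rfl⟩
  · rintro _ ⟨z, hz, rfl⟩ t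
    rw [hF z t hz]
    exact ⟨shrink (z, t), (hscale z t).trans_lt hz, rfl⟩

/-- A nonempty finite CW complex has a nonempty open subset which is contractible in itself. -/
lemma exists_open_contraction [Nonempty X] (C : FiniteCWStructure X) :
    ∃ (B : Set X) (x₀ : X), IsOpen B ∧ Nonempty (Contraction B x₀) := by
  classical
  obtain ⟨x⟩ := ‹Nonempty X›
  obtain ⟨d, hd, j, -⟩ := (mem_lowerSkeleton C).1 (mem_lowerSkeleton_dim C x)
  set n := Nat.findGreatest (fun m => 0 < C.cells m) C.dim with hn
  have hpos : 0 < C.cells n :=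
    Nat.findGreatest_spec (P := fun m => 0 < C.cells m) (Nat.lt_succ_iff.1 hd) j.pos
  have hmax : ∀ m, 0 < C.cells m → m ≤ n := by
    intro m hm
    refine Nat.le_findGreatest ?_ hm
    by_contra! h
    exact hm.ne' (C.cells_eq_zero m h)
  let i : Fin (C.cells n) := ⟨0, hpos⟩
  refine ⟨openCell C n i, _, ?_, nonempty_contraction_openCell C n i⟩
  have hcompl : (openCell C n i)ᶜ =
      lowerSkeleton C n ∪ ⋃ j ∈ {j | j ≠ i}, range (C.attach n j) := by
    apply Set.Subset.antisymm
    · intro y hy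
      obtain ⟨m, -, j, hj⟩ := (mem_lowerSkeleton C).1 (mem_lowerSkeleton_dim C y)
      rcases (hmax m j.pos).lt_or_eq with hm | rfl
      · exact Or.inl ((mem_lowerSkeleton C).2 ⟨m, hm, j, hj⟩)
      · by_cases hji : j = i
        · exact Or.inl ((range_attach_subset C n i (hji ▸ hj)).resolve_left hy)
        · exact Or.inr (mem_biUnion (show j ∈ {j | j ≠ i} from hji) hj)
    · refine Set.subset_compl_iff_disjoint_left.2 (Set.disjoint_union_right.2
        ⟨disjoint_openCell_lowerSkeleton C n i, Set.disjoint_iUnion₂_right.2 fun j hj =>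
          disjoint_openCell_range_attach C (Ne.symm hj)⟩)
  rw [← isClosed_compl_iff, hcompl]
  exact (isClosed_lowerSkeleton C n).union
    ((Set.toFinite _).isClosed_biUnion fun j _ => isClosed_range_attach C n j)

end CW

lemma contractibleIn_of_homotopy {B : Set X} {x₀ : X} (c : Contraction B x₀) {H : X × I → X}
    (hH : Continuous H) (hH0 : ∀ x, H (x, 0) = x) :
    ContractibleIn {x | H (x, 1) ∈ B} := by
  let m : C({x | H (x, 1) ∈ B}, X) := ⟨fun x => H (x, 1), by fun_prop⟩
  refine ⟨x₀, ContinuousMap.Homotopic.trans (g := m) ⟨⟨⟨fun p => H (p.2, p.1), by fun_prop⟩,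
    fun x => hH0 x, fun x => rfl⟩⟩ ⟨⟨⟨fun p => c.toFun (m p.2, p.1), ?_⟩,
    fun x => c.apply_zero _ x.2, fun x => c.apply_one _ x.2⟩⟩⟩
  exact c.continuousOn.comp_continuous (by fun_prop) fun p => ⟨p.2.2, mem_univ _⟩

lemma lsCat_le_of_deformsInto {B : Set X} {x₀ : X} (c : Contraction B x₀) (hB : IsOpen B)
    {l : ℕ} (h : DeformsInto B (l + 1) (univ : Set X)) : lsCat X ≤ l := by
  obtain ⟨H, hH, hH0, hH1⟩ := h
  have hc : ∀ j, Continuous (H j) := fun j => by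
    simpa [Set.univ_prod_univ, continuousOn_univ] using hH j
  refine sInf_le ⟨l, rfl, fun j => {x | H j (x, 1) ∈ B}, fun j => ?_, ?_, fun j =>
    contractibleIn_of_homotopy c (hc j) fun x => hH0 j x (mem_univ x)⟩
  · have := hc j
    exact hB.preimage (by fun_prop : Continuous fun x => H j (x, 1))
  · exact Set.eq_univ_of_forall fun x => mem_iUnion.2 (hH1 x (mem_univ x))

end GrossmanWhitehead

/-- **Grossman–Whitehead.** For a `k`-connected finite CW complex `X`
(nonempty, with `π_r X` trivial for `r ≤ k`), the Lusternik–Schnirelmann category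
satisfies `cat X ≤ dim X / (k+1)`, i.e. `(k+1) · cat X ≤ dim X`. -/
theorem grossman_whitehead (X : Type u) [TopologicalSpace X] [T2Space X]
    (C : FiniteCWStructure X) (k : ℕ) (hne : Nonempty X)
    (hconn : ∀ (x : X) (r : ℕ), r ≤ k → Subsingleton (HomotopyGroup (Fin r) X x)) :
    lsCat X * (k + 1 : ℕ∞) ≤ (C.dim : ℕ∞) := by
  obtain ⟨B, x₀, hB, ⟨c⟩⟩ := GrossmanWhitehead.exists_open_contraction C
  have hdim : C.dim < (C.dim / (k + 1) + 1) * (k + 1) := by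
    rw [mul_comm]
    exact Nat.lt_mul_div_succ _ k.succ_pos
  have hdef := GrossmanWhitehead.deformsInto_lowerSkeleton C c hB hdim
    (fun r hr => hconn x₀ r (by omega)) (C.dim + 1)
  rw [Set.eq_univ_of_forall (GrossmanWhitehead.mem_lowerSkeleton_dim C)] at hdef
  calc lsCat X * (k + 1 : ℕ∞) ≤ ((C.dim / (k + 1) : ℕ) : ℕ∞) * (k + 1 : ℕ∞) :=
        mul_le_mul_left (GrossmanWhitehead.lsCat_le_of_deformsInto c hB hdef) _
    _ = ((C.dim / (k + 1) * (k + 1) : ℕ) : ℕ∞) := by push_cast; rfl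
    _ ≤ (C.dim : ℕ∞) := by exact_mod_cast Nat.div_mul_le_self _ _
end

section
/- Let X be a compact metric space with covering dimension dim X ≤ n, and let m > n. Then X admits an (n+1)-cover consisting of m subsets, each of which is 0-dimensional (indeed each can be taken to be a G_δ set). -/
open Set Topology BoundedContinuousFunction

/-- Every open cover of `X` has an open refinement of order at most `n + 1`. -/
def HasOrderRefinements (X : Type*) [TopologicalSpace X] (n : ℕ) : Prop :=
  ∀ 𝒰 : Set (Set X), (∀ U ∈ 𝒰, IsOpen U) → ⋃₀ 𝒰 = Set.univ →
    ∃ 𝒱 : Set (Set X), (∀ V ∈ 𝒱, IsOpen V) ∧ ⋃₀ 𝒱 = Set.univ ∧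
      (∀ V ∈ 𝒱, ∃ U ∈ 𝒰, V ⊆ U) ∧
      ∀ x : X, {V | V ∈ 𝒱 ∧ x ∈ V}.encard ≤ (n : ℕ∞) + 1

theorem hasOrderRefinements_of_coveringDim_le {X : Type*} [TopologicalSpace X] {n : ℕ}
    (h : coveringDim X ≤ n) : HasOrderRefinements X n := by
  have hne : {N : ℕ∞ | ∃ n : ℕ, N = n ∧ HasOrderRefinements X n}.Nonempty := by
    by_contra hcon
    rw [not_nonempty_iff_eq_empty] at hcon
    have h' : sInf {N : ℕ∞ | ∃ n : ℕ, N = n ∧ HasOrderRefinements X n} ≤ n := h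
    rw [hcon, sInf_empty] at h'
    exact absurd h' (by simp)
  obtain ⟨k, hk, hP⟩ := csInf_mem hne
  have hkn : (k : ℕ∞) ≤ n := hk ▸ h
  intro 𝒰 hU hcov
  obtain ⟨𝒱, h1, h2, h3, h4⟩ := hP 𝒰 hU hcov
  exact ⟨𝒱, h1, h2, h3, fun x => (h4 x).trans (by gcongr)⟩

/-- A space with a countable base of clopen sets has covering dimension at most zero. -/
theorem coveringDim_le_zero_of_clopen_base {Y κ : Type*} [TopologicalSpace Y] [Countable κ]
    (C : κ → Set Y) (hC : ∀ k, IsClopen (C k))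
    (hbase : ∀ (y : Y) (U : Set Y), IsOpen U → y ∈ U → ∃ k, y ∈ C k ∧ C k ⊆ U) :
    coveringDim Y ≤ 0 := by
  refine sInf_le ⟨0, rfl, fun 𝒰 hU hcov => ?_⟩
  obtain ⟨e, he⟩ := exists_injective_nat κ
  let good : Set κ := {k | ∃ U ∈ 𝒰, C k ⊆ U}
  let D : κ → Set Y := fun k => C k \ ⋃ l ∈ {l | l ∈ good ∧ e l < e k}, C l
  have hfin : ∀ k, {l | l ∈ good ∧ e l < e k}.Finite := fun k =>
    ((Set.finite_Iio (e k)).preimage he.injOn).subset fun l hl => hl.2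
  have huniq : ∀ y, ∀ k ∈ good, ∀ l ∈ good, y ∈ D k → y ∈ D l → k = l := by
    intro y k hk l hl hyk hyl
    rcases lt_trichotomy (e k) (e l) with h | h | h
    · exact absurd (mem_biUnion (show k ∈ {j | j ∈ good ∧ e j < e l} from ⟨hk, h⟩) hyk.1) hyl.2
    · exact he h
    · exact absurd (mem_biUnion (show l ∈ {j | j ∈ good ∧ e j < e k} from ⟨hl, h⟩) hyl.1) hyk.2
  refine ⟨D '' good, ?_, ?_, ?_, ?_⟩
  · rintro _ ⟨k, -, rfl⟩
    exact (hC k).isOpen.sdiff ((hfin k).isClosed_biUnion fun l _ => (hC l).isClosed)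
  · refine eq_univ_of_forall fun y => ?_
    obtain ⟨U, hUm, hyU⟩ : y ∈ ⋃₀ 𝒰 := hcov ▸ mem_univ y
    obtain ⟨k₀, hyk₀, hk₀⟩ := hbase y U (hU U hUm) hyU
    obtain ⟨k, ⟨hk, hyk⟩, hmin⟩ := (InvImage.wf e Nat.lt_wfRel.wf).has_min
      {k | k ∈ good ∧ y ∈ C k} ⟨k₀, ⟨U, hUm, hk₀⟩, hyk₀⟩
    refine ⟨D k, mem_image_of_mem D hk, hyk, fun hmem => ?_⟩
    obtain ⟨l, ⟨hl, hlk⟩, hyl⟩ := mem_iUnion₂.1 hmem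
    exact hmin l ⟨hl, hyl⟩ hlk
  · rintro _ ⟨k, ⟨U, hUm, hk⟩, rfl⟩
    exact ⟨U, hUm, sdiff_subset.trans hk⟩
  · intro y
    rw [Nat.cast_zero, zero_add, encard_le_one_iff]
    rintro _ _ ⟨⟨k, hk, rfl⟩, hyk⟩ ⟨⟨l, hl, rfl⟩, hyl⟩
    rw [huniq y k hk l hl hyk hyl]

/-- Finitely many vectors can be perturbed so that any `finrank ℝ E` of them are linearly
independent. -/
theorem exists_dist_lt_forall_linearIndepOn {ι E : Type*} [Finite ι] [NormedAddCommGroup E]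
    [NormedSpace ℝ E] [FiniteDimensional ℝ E] (c : ι → E) {δ : ℝ} (hδ : 0 < δ) :
    ∃ y : ι → E, (∀ i, dist (y i) (c i) < δ) ∧
      ∀ T : Finset ι, T.card ≤ Module.finrank ℝ E → LinearIndepOn ℝ y (T : Set ι) := by
  classical
  cases nonempty_fintype ι
  suffices H : ∀ s : Finset ι, ∃ y : ι → E, (∀ i, dist (y i) (c i) < δ) ∧
      ∀ T ⊆ s, T.card ≤ Module.finrank ℝ E → LinearIndepOn ℝ y (T : Set ι) by
    obtain ⟨y, hy, hT⟩ := H Finset.univ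
    exact ⟨y, hy, fun T => hT T (Finset.subset_univ T)⟩
  intro s
  induction s using Finset.induction_on with
  | empty =>
    refine ⟨c, fun i => by simpa using hδ, fun T hT _ => ?_⟩
    rw [Finset.subset_empty.1 hT, Finset.coe_empty]
    exact linearIndepOn_empty ℝ c
  | insert a s ha ih =>
    obtain ⟨y, hy, hlin⟩ := ih
    obtain ⟨v, hv, hvspan⟩ : ∃ v ∈ Metric.ball (c a) δ, ∀ T : Finset ι,
        T.card < Module.finrank ℝ E → v ∉ Submodule.span ℝ (y '' (T : Set ι)) := by
      let _ : MeasurableSpace E := borel E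
      have : BorelSpace E := ⟨rfl⟩
      let μ : MeasureTheory.Measure E := MeasureTheory.Measure.addHaar
      have hnull : μ (⋃ T ∈ {T : Finset ι | T.card < Module.finrank ℝ E},
          (Submodule.span ℝ (y '' (T : Set ι)) : Set E)) = 0 := by
        refine (MeasureTheory.measure_biUnion_null_iff (Set.to_countable _)).2 fun T hT => ?_
        refine MeasureTheory.Measure.addHaar_submodule μ _ fun htop => ?_
        have h1 : Module.finrank ℝ (Submodule.span ℝ (y '' (T : Set ι))) ≤ T.card := by
          rw [← Finset.coe_image]
          exact (finrank_span_finset_le_card _).trans Finset.card_image_le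
        rw [htop, finrank_top] at h1
        exact absurd h1 (not_le.2 hT)
      have hpos : 0 < μ (Metric.ball (c a) δ) := Metric.measure_ball_pos μ _ hδ
      by_contra! hcon
      refine hpos.ne' (MeasureTheory.measure_mono_null (fun v hv => ?_) hnull)
      obtain ⟨T, hT, hvT⟩ := hcon v hv
      exact mem_biUnion (show T ∈ {T : Finset ι | T.card < Module.finrank ℝ E} from hT) hvT
    refine ⟨Function.update y a v, fun i => ?_, fun T hT hcard => ?_⟩
    · rcases eq_or_ne i a with rfl | h
      · simpa using hv
      · simpa [Function.update_of_ne h] using hy i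
    · have hEq : EqOn y (Function.update y a v) ((T.erase a : Finset ι) : Set ι) := fun i hi =>
        (Function.update_of_ne (Finset.ne_of_mem_erase (Finset.mem_coe.1 hi)) _ _).symm
      have hsub : T.erase a ⊆ s := by
        rwa [← Finset.subset_insert_iff]
      have hind := (linearIndepOn_congr hEq).1
        (hlin _ hsub ((Finset.card_le_card (Finset.erase_subset a T)).trans hcard))
      by_cases haT : a ∈ T
      · rw [← Finset.insert_erase haT, Finset.coe_insert, linearIndepOn_insert (by simp)]
        refine ⟨hind, ?_⟩
        rw [Function.update_self, ← hEq.image_eq]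
        refine hvspan _ ?_
        have := Finset.card_erase_lt_of_mem haT
        omega
      · rwa [Finset.erase_eq_of_notMem haT] at hind

/-- On a compact space of dimension at most `n`, maps to `ℝⁿ⁺¹` can be perturbed to avoid
the origin. -/
theorem HasOrderRefinements.exists_dist_le_forall_ne_zero {X E : Type*} [TopologicalSpace X]
    [CompactSpace X] [T2Space X] [NormedAddCommGroup E] [NormedSpace ℝ E]
    [FiniteDimensional ℝ E] {n : ℕ} (hX : HasOrderRefinements X n)
    (hE : n + 1 ≤ Module.finrank ℝ E) (g : C(X, E)) {ε : ℝ} (hε : 0 < ε) :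
    ∃ g' : C(X, E), (∀ x, dist (g' x) (g x) ≤ ε) ∧ ∀ x, g' x ≠ 0 := by
  classical
  obtain ⟨𝒱, hVo, hVc, hVr, hVn⟩ := hX (range fun c => g ⁻¹' Metric.ball c (ε / 2))
    (by rintro _ ⟨c, rfl⟩; exact Metric.isOpen_ball.preimage g.continuous)
    (eq_univ_of_forall fun x => ⟨_, ⟨g x, rfl⟩, Metric.mem_ball_self (half_pos hε)⟩)
  obtain ⟨t, ht𝒱, htfin, htcov⟩ := isCompact_univ.elim_finite_subcover_image (c := id) hVo
    (hVc.ge.trans sUnion_eq_biUnion.le)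
  have := htfin.fintype
  have hc : ∀ V : t, ∃ c, (V : Set X) ⊆ g ⁻¹' Metric.ball c (ε / 2) := fun V => by
    obtain ⟨_, ⟨c, rfl⟩, h⟩ := hVr V (ht𝒱 V.2)
    exact ⟨c, h⟩
  choose c hc using hc
  obtain ⟨y, hy, hlin⟩ := exists_dist_lt_forall_linearIndepOn c (half_pos hε)
  obtain ⟨φ, hφ⟩ := PartitionOfUnity.exists_isSubordinate isClosed_univ
    (fun V : t => (V : Set X)) (fun V => hVo _ (ht𝒱 V.2))
    (by rw [← sUnion_eq_iUnion, sUnion_eq_biUnion]; exact htcov)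
  have hsum : ∀ x, ∑ V, φ V x = 1 := fun x => by
    rw [← finsum_eq_sum_of_fintype]; exact φ.sum_eq_one (mem_univ x)
  have hmem : ∀ V x, φ V x ≠ 0 → x ∈ (V : Set X) := fun V x h =>
    hφ V (subset_tsupport _ h)
  refine ⟨⟨fun x => ∑ V, φ V x • y V, by fun_prop⟩, fun x => ?_, fun x hx => ?_⟩
  · change (∑ V, φ V x • y V) ∈ Metric.closedBall (g x) ε
    rw [← finsum_eq_sum_of_fintype]
    refine φ.finsum_smul_mem_convex (g := fun V _ => y V) (mem_univ x) (fun V hV => ?_) (convex_closedBall _ _)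
    have h1 : dist (g x) (c V) < ε / 2 := hc V (hmem V x hV)
    have h2 := hy V
    have h3 := dist_triangle_right (y V) (g x) (c V)
    rw [Metric.mem_closedBall]
    linarith
  · change ∑ V, φ V x • y V = 0 at hx
    let T : Finset t := Finset.univ.filter fun V => φ V x ≠ 0
    have hTcard : T.card ≤ n + 1 := by
      have h1 : ((T.map (Function.Embedding.subtype _) : Finset (Set X)) : Set (Set X)).encard
          ≤ n + 1 := by
        refine (encard_le_encard fun V hV => ?_).trans (hVn x)
        obtain ⟨W, hW, rfl⟩ := Finset.mem_map.1 (Finset.mem_coe.1 hV)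
        exact ⟨ht𝒱 W.2, hmem W x (Finset.mem_filter.1 hW).2⟩
      rw [encard_coe_eq_coe_finsetCard, Finset.card_map] at h1
      exact_mod_cast h1
    have hT : ∑ V ∈ T, φ V x • y V = 0 := by
      rw [← hx]
      refine Finset.sum_subset (Finset.subset_univ T) fun V _ hV => ?_
      have : φ V x = 0 := by simpa [T] using hV
      rw [this, zero_smul]
    have hzero : ∀ V, φ V x = 0 := fun V => by
      by_contra hV
      exact hV (linearIndepOn_finset_iff.1 (hlin T (hTcard.trans hE)) (fun V => φ V x) hT V
        (by simp [T, hV]))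
    simpa [hzero] using hsum x

/-- The families of functions for which the members indexed by `e` have no common zero form
an open set. -/
theorem isOpen_setOf_forall_exists_ne_zero {X ι σ : Type*} [TopologicalSpace X] [CompactSpace X]
    [TopologicalSpace ι] (e : σ → ι) :
    IsOpen {F : ι →ᵇ C(X, ℝ) | ∀ x, ∃ j, F (e j) x ≠ 0} := by
  have hcl : IsClosed {p : (ι →ᵇ C(X, ℝ)) × X | ∀ j, p.1 (e j) p.2 = 0} := by
    simp only [ofPred_forall]
    refine isClosed_iInter fun j => isClosed_eq ?_ continuous_const
    have h : Continuous fun p : (ι →ᵇ C(X, ℝ)) × X => p.1 (e j) :=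
      (continuous_eval_const (e j)).comp continuous_fst
    exact continuous_eval.comp (h.prodMk continuous_snd)
  convert (isClosedMap_fst_of_compactSpace _ hcl).isOpen_compl using 1
  ext F
  simp

/-- On a compact space of dimension at most `n`, the families of functions for which `n + 1`
given members have no common zero are dense. -/
theorem HasOrderRefinements.dense_setOf_forall_exists_ne_zero {X ι : Type*} [TopologicalSpace X]
    [CompactSpace X] [T2Space X] [TopologicalSpace ι] [DiscreteTopology ι] {n : ℕ}
    (hX : HasOrderRefinements X n) {e : Fin (n + 1) → ι} (he : Function.Injective e) :
    Dense {F : ι →ᵇ C(X, ℝ) | ∀ x, ∃ j, F (e j) x ≠ 0} := by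
  refine Metric.dense_iff.2 fun F r hr => ?_
  obtain ⟨g, hg, hg0⟩ := hX.exists_dist_le_forall_ne_zero (E := Fin (n + 1) → ℝ) (by simp)
    ⟨fun x j => F (e j) x, by fun_prop⟩ (half_pos hr)
  let h : Fin (n + 1) → C(X, ℝ) := fun j => ⟨fun x => g x j, by fun_prop⟩
  let H : ι → C(X, ℝ) := Function.extend e h F
  have hH : ∀ i, dist (H i) (F i) ≤ r / 2 := fun i => by
    by_cases hi : ∃ j, e j = i
    · obtain ⟨j, rfl⟩ := hi
      rw [show H (e j) = h j from he.extend_apply _ _ _,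
        ContinuousMap.dist_le (half_pos hr).le]
      exact fun x => (dist_le_pi_dist (g x) (fun j => F (e j) x) j).trans (hg x)
    · rw [show H i = F i from Function.extend_apply' _ _ _ hi, dist_self]
      exact (half_pos hr).le
  obtain ⟨K, hK⟩ := F.bounded
  let F' : ι →ᵇ C(X, ℝ) := BoundedContinuousFunction.mkOfDiscrete H (r / 2 + K + r / 2)
    fun i j => by
      have h1 := dist_triangle4 (H i) (F i) (F j) (H j)
      have h2 := hH j
      rw [dist_comm] at h2
      linarith [hH i, hK i j]
  refine ⟨F', ?_, fun x => ?_⟩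
  · exact ((dist_le (half_pos hr).le).2 hH).trans_lt (half_lt_self hr)
  · obtain ⟨j, hj⟩ := Function.ne_iff.1 (hg0 x)
    refine ⟨j, ?_⟩
    change H (e j) x ≠ 0
    rw [show H (e j) = h j from he.extend_apply _ _ _]
    exact hj

/-- A countable uniformly bounded family of functions on a compact metric space such that the
positivity sets of any sufficiently close family form a base. -/
theorem exists_countable_bump_family (X : Type u) [MetricSpace X] [CompactSpace X] :
    ∃ (κ : Type u) (_ : Countable κ) (g : κ → C(X, ℝ)), (∀ k, ‖g k‖ ≤ 1) ∧
      ∀ (x : X) (U : Set X), IsOpen U → x ∈ U →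
        ∃ k, 1 / 2 ≤ g k x ∧ ∀ y, -(1 / 2) ≤ g k y → y ∈ U := by
  obtain ⟨s, hs, hd⟩ := TopologicalSpace.exists_countable_dense X
  have := hs.to_subtype
  refine ⟨s × ℕ, inferInstance,
    fun k => ⟨fun y => max (-1) (1 - (k.2 + 1) * dist (k.1 : X) y), by fun_prop⟩, fun k => ?_, ?_⟩
  · refine (ContinuousMap.norm_le _ zero_le_one).2 fun y => ?_
    rw [Real.norm_eq_abs, abs_le]
    refine ⟨le_max_left _ _, max_le (by norm_num) ?_⟩
    have : (0 : ℝ) ≤ (k.2 + 1) * dist (k.1 : X) y := by positivity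
    linarith
  · intro x U hU hxU
    obtain ⟨ε, hε, hball⟩ := Metric.isOpen_iff.1 hU x hxU
    obtain ⟨N, hN⟩ := exists_nat_gt (2 / ε)
    have hN0 : (0 : ℝ) < N + 1 := by positivity
    have hNε : 2 < (N + 1) * ε := by
      rw [div_lt_iff₀ hε] at hN
      nlinarith
    obtain ⟨a, has, hxa⟩ := hd.exists_dist_lt x (show (0 : ℝ) < 1 / 2 / (N + 1) by positivity)
    rw [lt_div_iff₀ hN0, dist_comm] at hxa
    refine ⟨(⟨a, has⟩, N), le_max_of_le_right ?_, fun y hy => hball ?_⟩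
    · change 1 / 2 ≤ 1 - ((N : ℝ) + 1) * dist a x
      linarith
    · have hy' : (N + 1) * dist a y ≤ 3 / 2 := by
        rcases le_max_iff.1 hy with h | h
        · norm_num at h
        · change -(1 / 2) ≤ 1 - ((N : ℝ) + 1) * dist a y at h
          linarith
      rw [Metric.mem_ball]
      have h1 := dist_triangle_left y x a
      nlinarith [mul_le_mul_of_nonneg_left h1 hN0.le]

/-- **Ostrand.** Let `X` be a compact metric space with covering
dimension at most `n`, and `m > n`. Then `X` admits an `(n+1)`-cover by `m` sets
(every `n+1` of them cover `X`), each `0`-dimensional and `G_δ`. -/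
theorem exists_nCover_zero_dimensional (X : Type u) [MetricSpace X] [CompactSpace X]
    (n m : ℕ) (hdim : coveringDim X ≤ (n : ℕ∞)) (hm : n < m) :
    ∃ A : Fin m → Set X,
      (∀ s : Finset (Fin m), s.card = n + 1 → (⋃ i ∈ s, A i) = Set.univ) ∧
      (∀ i, coveringDim (A i) ≤ 0) ∧ (∀ i, IsGδ (A i)) := by
  have hX := hasOrderRefinements_of_coveringDim_le hdim
  obtain ⟨κ, hκ, g, hg1, hg⟩ := exists_countable_bump_family X
  let _ : TopologicalSpace (Fin m × κ) := ⊥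
  have : DiscreteTopology (Fin m × κ) := ⟨rfl⟩
  let G : (Fin m × κ) →ᵇ C(X, ℝ) := BoundedContinuousFunction.ofNormedAddCommGroupDiscrete
    (fun i => g i.2) 1 fun i => hg1 i.2
  have hdense : Dense (⋂ e : {e : Fin (n + 1) → Fin m × κ // Function.Injective e},
      {F : (Fin m × κ) →ᵇ C(X, ℝ) | ∀ x, ∃ j, F (e.1 j) x ≠ 0}) :=
    dense_iInter_of_isOpen (fun e => isOpen_setOf_forall_exists_ne_zero e.1)
      fun e => hX.dense_setOf_forall_exists_ne_zero e.2
  obtain ⟨F, hF, hFG⟩ := hdense.exists_dist_lt G (show (0 : ℝ) < 1 / 2 by norm_num)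
  rw [mem_iInter] at hF
  have hclose : ∀ j k x, |g k x - F (j, k) x| < 1 / 2 := fun j k x =>
    ((ContinuousMap.dist_apply_le_dist x).trans
      (BoundedContinuousFunction.dist_coe_le_dist (f := G) (g := F) (j, k))).trans_lt hFG
  refine ⟨fun j => {x | ∀ k, F (j, k) x ≠ 0}, fun s hs => ?_, fun j => ?_, fun j => ?_⟩
  · refine eq_univ_of_forall fun x => ?_
    by_contra hx
    have hx' : ∀ j ∈ s, ∃ k, F (j, k) x = 0 := by simpa using hx
    choose k hk using hx'
    obtain ⟨t, ht⟩ := hF ⟨fun t => (s.orderEmbOfFin hs t, k _ (s.orderEmbOfFin_mem hs t)),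
      fun t t' h => (s.orderEmbOfFin hs).injective (Prod.ext_iff.1 h).1⟩ x
    exact ht (hk _ (s.orderEmbOfFin_mem hs t))
  · refine coveringDim_le_zero_of_clopen_base (fun k => {x | 0 < F (j, k) x.1})
      (fun k => ⟨?_, ?_⟩) fun x U hU hxU => ?_
    · convert isClosed_le continuous_const
        ((F (j, k)).continuous.comp continuous_subtype_val) using 1
      ext x
      exact ⟨fun h => show 0 ≤ F (j, k) x.1 from le_of_lt h,
        fun h => lt_of_le_of_ne h (x.2 k).symm⟩
    · exact isOpen_lt continuous_const ((F (j, k)).continuous.comp continuous_subtype_val)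
    · obtain ⟨V, hV, rfl⟩ := isOpen_induced_iff.1 hU
      obtain ⟨k, hk, hkV⟩ := hg x V hV hxU
      refine ⟨k, ?_, fun y hy => hkV y ?_⟩
      · have := abs_lt.1 (hclose j k x)
        change 0 < F (j, k) x
        linarith
      · have := abs_lt.1 (hclose j k y)
        change 0 < F (j, k) y at hy
        linarith
  · simp only [ofPred_forall]
    exact IsGδ.iInter_of_isOpen fun k => isOpen_ne_fun (F (j, k)).continuous continuous_const
end
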